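/- Let X be a one-sided subshift of finite type with shift map σ, let θ ∈ (0,1), let φ : X → ℝ be a d_θ-Lipschitz potential, and let μ be the equilibrium state (Gibbs measure) of φ with pressure P ≥ 0. Let f : X → (1,∞) be Lipschitz with respect to d_θ, let Λ_f be the suspension space with special semi-flow Φ_f^t, and let ν = μ^f = (μ × Leb)/∫f dμ. Suppose {I_n}, I_n ⊆ X, satisfies the nested condition with ∩_{n∈ℕ} I_n = {z} for some z ∈ X. Then lim_{n→∞} R(ν, I_n × {0}, Λ_f)/ν(I_n × [0,1]) = γ(z), where γ(z) = 1 if z is not σ-periodic, and γ(z) = 1 − exp(Σ_{k=0}^{p−1} φ(σ^k z) − pP) if z is σ-periodic with prime period p. -/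

import Mathlib

open Filter Set MeasureTheory

noncomputable section

/-- The one-sided full shift map on sequences over the alphabet `Fin a`. -/
def shiftMap (a : ℕ) : (ℕ → Fin a) → (ℕ → Fin a) := fun x n => x (n + 1)

/-- The one-sided subshift of finite type determined by the 0-1 transition matrix `A`. -/
def SFT {a : ℕ} (A : Matrix (Fin a) (Fin a) ℕ) : Set (ℕ → Fin a) :=
  {x | ∀ n, A (x n) (x (n + 1)) = 1}

/-- The cylinder of length `n` around `x`. -/
def cyl {a : ℕ} (x : ℕ → Fin a) (n : ℕ) : Set (ℕ → Fin a) := {y | ∀ i < n, y i = x i}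

/-- The Birkhoff sum `S_m f(x) = Σ_{k<m} f(σ^k x)`. -/
def birkhoff {a : ℕ} (f : (ℕ → Fin a) → ℝ) (m : ℕ) (x : ℕ → Fin a) : ℝ :=
  ∑ k ∈ Finset.range m, f ((shiftMap a)^[k] x)

/-- The suspension space `Λ_f = {(x,t) : x ∈ X, 0 ≤ t < f(x)}`. -/
def susp {a : ℕ} (X : Set (ℕ → Fin a)) (f : (ℕ → Fin a) → ℝ) : Set ((ℕ → Fin a) × ℝ) :=
  {p | p.1 ∈ X ∧ 0 ≤ p.2 ∧ p.2 < f p.1}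

open Classical in
/-- The special semi-flow `Φ_f^t` over the shift with roof function `f`:
`Φ_f^t(x,s) = (σ^m x, s + t − S_m f(x))` where `S_m f(x) ≤ s+t < S_{m+1} f(x)`. -/
def susFlow {a : ℕ} (f : (ℕ → Fin a) → ℝ) (t : ℝ) (p : (ℕ → Fin a) × ℝ) :
    (ℕ → Fin a) × ℝ :=
  if h : ∃ m : ℕ, birkhoff f m p.1 ≤ p.2 + t ∧ p.2 + t < birkhoff f (m + 1) p.1 then
    ((shiftMap a)^[h.choose] p.1, p.2 + t - birkhoff f h.choose p.1)
  else p

/-- The normalized suspension measure `μ^f = (μ × Leb)/∫ f dμ` on `Λ_f`. -/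
def suspMeasure {a : ℕ} (μ : Measure (ℕ → Fin a)) [SFinite μ] (X : Set (ℕ → Fin a))
    (f : (ℕ → Fin a) → ℝ) : Measure ((ℕ → Fin a) × ℝ) :=
  (ENNReal.ofReal (∫ x, f x ∂μ))⁻¹ • ((μ.prod volume).restrict (susp X f))


/-- The Birkhoff sum `S_m φ(x)` was defined above; here is the real-valued non-escape
quantity `K(ν,t,H,Λ_f) = log ν{p ∈ Λ_f : Φ_f^s p ∉ H for all s ∈ [0,t]}`. -/
def Kc {a : ℕ} (ν : Measure ((ℕ → Fin a) × ℝ)) (t : ℝ) (H : Set ((ℕ → Fin a) × ℝ))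
    (X : Set (ℕ → Fin a)) (f : (ℕ → Fin a) → ℝ) : ℝ :=
  Real.log (ν {p | p ∈ susp X f ∧ ∀ s ∈ Set.Icc (0 : ℝ) t, susFlow f s p ∉ H}).toReal

/-- The escape rate `R(ν,H,Λ_f) = −limsup_{t→∞} (1/t) K(ν,t,H,Λ_f)`. -/
def Rc {a : ℕ} (ν : Measure ((ℕ → Fin a) × ℝ)) (H : Set ((ℕ → Fin a) × ℝ))
    (X : Set (ℕ → Fin a)) (f : (ℕ → Fin a) → ℝ) : ℝ :=
  - Filter.limsup (fun t : ℝ => Kc ν t H X f / t) Filter.atTop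

/-- The nested condition of Ferguson–Pollicott for a family of sets `I n ⊆ X` shrinking
to a point `z`. -/
def NestedCondition {a : ℕ} (A : Matrix (Fin a) (Fin a) ℕ) (μ : Measure (ℕ → Fin a))
    (I : ℕ → Set (ℕ → Fin a)) (z : ℕ → Fin a) : Prop :=
  (∀ n, 1 ≤ n → ∃ S : Finset (ℕ → Fin a), (↑S : Set (ℕ → Fin a)) ⊆ SFT A ∧
      I n = ⋃ x ∈ S, SFT A ∩ cyl x n) ∧
  (∀ n, 1 ≤ n → I (n + 1) ⊆ I n) ∧
  (⋂ n ∈ Set.Ici 1, I n) = {z} ∧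
  (∃ c : ℝ, 0 < c ∧ ∃ ρ : ℝ, 0 < ρ ∧ ρ < 1 ∧ ∀ n, 1 ≤ n →
      μ (I n) ≤ ENNReal.ofReal (c * ρ ^ n)) ∧
  (∃ l : ℕ → ℕ, ∃ κ : ℝ, 0 < κ ∧ ∀ n : ℕ, 1 ≤ n →
      κ * (n : ℝ) < (l n : ℝ) ∧ l n ≤ n ∧ I n ⊆ SFT A ∩ cyl z (l n)) ∧
  (∀ p : ℕ, 0 < p → (shiftMap a)^[p] z = z →
      (∀ q : ℕ, 0 < q → (shiftMap a)^[q] z = z → p ≤ q) →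
      ∃ N : ℕ, ∀ n, N ≤ n → (shiftMap a)^[p] ⁻¹' (I n) ∩ (SFT A ∩ cyl z p) ⊆ I n)

namespace EscapeRate

open scoped ENNReal

variable {a : ℕ}

/-- Prepend a symbol to a sequence. -/
def cons (i : Fin a) (x : ℕ → Fin a) : ℕ → Fin a
  | 0 => i
  | n + 1 => x n

/-- The transfer operator of the potential `ψ` on the subshift determined by `A`. -/
def transfer (A : Matrix (Fin a) (Fin a) ℕ) (ψ u : (ℕ → Fin a) → ℝ) (x : ℕ → Fin a) : ℝ :=
  ∑ i, if A i (x 0) = 1 then Real.exp (ψ (cons i x)) * u (cons i x) else 0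

/-- Lipschitz condition along the subshift, with explicit constant. -/
def LipX (A : Matrix (Fin a) (Fin a) ℕ) (θ K : ℝ) (ψ : (ℕ → Fin a) → ℝ) : Prop :=
  ∀ x ∈ SFT A, ∀ y ∈ SFT A, ∀ n : ℕ, (∀ i < n, x i = y i) → |ψ x - ψ y| ≤ K * θ ^ n

/-- The cone of nonnegative functions which are log-Lipschitz at scales finer than `m`. -/
def Cone (A : Matrix (Fin a) (Fin a) ℕ) (θ b : ℝ) (m : ℕ) (u : (ℕ → Fin a) → ℝ) : Prop :=
  (∀ x ∈ SFT A, 0 ≤ u x) ∧ ∀ x ∈ SFT A, ∀ y ∈ SFT A, ∀ r : ℕ, 1 ≤ r → m ≤ r →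
    (∀ i < r, x i = y i) → u x ≤ Real.exp (b * θ ^ r) * u y

@[simp] lemma cons_zero (i : Fin a) (x : ℕ → Fin a) : cons i x 0 = i := rfl
@[simp] lemma cons_succ (i : Fin a) (x : ℕ → Fin a) (n : ℕ) : cons i x (n + 1) = x n := rfl
@[simp] lemma shift_cons (i : Fin a) (x : ℕ → Fin a) : shiftMap a (cons i x) = x := rfl

lemma shift_iter (k : ℕ) (x : ℕ → Fin a) (n : ℕ) : (shiftMap a)^[k] x n = x (n + k) := by
  induction k generalizing x with
  | zero => rfl
  | succ k ih => rw [Function.iterate_succ_apply, ih]; simp [shiftMap]; congr 1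

lemma cons_mem {A : Matrix (Fin a) (Fin a) ℕ} {i : Fin a} {x : ℕ → Fin a} (hx : x ∈ SFT A)
    (h : A i (x 0) = 1) : cons i x ∈ SFT A := by
  intro n; cases n with
  | zero => exact h
  | succ n => exact hx n

lemma shift_mem {A : Matrix (Fin a) (Fin a) ℕ} {x : ℕ → Fin a} (hx : x ∈ SFT A) :
    shiftMap a x ∈ SFT A := fun n => hx (n + 1)

lemma shift_iter_mem {A : Matrix (Fin a) (Fin a) ℕ} {x : ℕ → Fin a} (hx : x ∈ SFT A) (k : ℕ) :
    (shiftMap a)^[k] x ∈ SFT A := by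
  induction k with
  | zero => exact hx
  | succ k ih => rw [Function.iterate_succ_apply']; exact shift_mem ih

lemma cons_agree {i : Fin a} {x y : ℕ → Fin a} {r : ℕ} (h : ∀ j < r, x j = y j) :
    ∀ j < r + 1, cons i x j = cons i y j := by
  intro j hj; cases j with
  | zero => rfl
  | succ j => exact h j (by omega)

section transfer
variable {A : Matrix (Fin a) (Fin a) ℕ} {ψ : (ℕ → Fin a) → ℝ}

lemma transfer_mono {u v : (ℕ → Fin a) → ℝ} (h : ∀ x ∈ SFT A, u x ≤ v x) :
    ∀ x ∈ SFT A, transfer A ψ u x ≤ transfer A ψ v x := by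
  intro x hx
  refine Finset.sum_le_sum fun i _ => ?_
  split_ifs with hi
  · exact mul_le_mul_of_nonneg_left (h _ (cons_mem hx hi)) (Real.exp_pos _).le
  · exact le_rfl

lemma transfer_congr {u v : (ℕ → Fin a) → ℝ} (h : ∀ x ∈ SFT A, u x = v x) :
    ∀ x ∈ SFT A, transfer A ψ u x = transfer A ψ v x := fun x hx =>
  le_antisymm (transfer_mono (fun y hy => (h y hy).le) x hx)
    (transfer_mono (fun y hy => (h y hy).ge) x hx)

lemma transfer_zero (x : ℕ → Fin a) : transfer A ψ (fun _ => 0) x = 0 := by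
  simp [transfer]

lemma transfer_nonneg {u : (ℕ → Fin a) → ℝ} (h : ∀ x ∈ SFT A, 0 ≤ u x) :
    ∀ x ∈ SFT A, 0 ≤ transfer A ψ u x := by
  intro x hx
  simpa [transfer_zero] using transfer_mono (ψ := ψ) (u := fun _ => 0) h x hx

lemma transfer_smul (c : ℝ) (u : (ℕ → Fin a) → ℝ) (x : ℕ → Fin a) :
    transfer A ψ (fun y => c * u y) x = c * transfer A ψ u x := by
  simp only [transfer, Finset.mul_sum]
  refine Finset.sum_congr rfl fun i _ => ?_
  split_ifs <;> ring

lemma transfer_add (u v : (ℕ → Fin a) → ℝ) (x : ℕ → Fin a) :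
    transfer A ψ (fun y => u y + v y) x = transfer A ψ u x + transfer A ψ v x := by
  simp only [transfer, ← Finset.sum_add_distrib]
  refine Finset.sum_congr rfl fun i _ => ?_
  split_ifs <;> ring

lemma transfer_mul_comp (u v : (ℕ → Fin a) → ℝ) (x : ℕ → Fin a) :
    transfer A ψ (fun y => u y * v (shiftMap a y)) x = transfer A ψ u x * v x := by
  simp only [transfer, Finset.sum_mul]
  refine Finset.sum_congr rfl fun i _ => ?_
  split_ifs
  · simp only [shift_cons]; ring
  · ring

lemma transfer_iter_mono {u v : (ℕ → Fin a) → ℝ} (h : ∀ x ∈ SFT A, u x ≤ v x) (k : ℕ) :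
    ∀ x ∈ SFT A, (transfer A ψ)^[k] u x ≤ (transfer A ψ)^[k] v x := by
  induction k with
  | zero => exact h
  | succ k ih =>
    simp only [Function.iterate_succ_apply']
    exact transfer_mono ih

lemma transfer_iter_congr {u v : (ℕ → Fin a) → ℝ} (h : ∀ x ∈ SFT A, u x = v x) (k : ℕ) :
    ∀ x ∈ SFT A, (transfer A ψ)^[k] u x = (transfer A ψ)^[k] v x := fun x hx =>
  le_antisymm (transfer_iter_mono (fun y hy => (h y hy).le) k x hx)
    (transfer_iter_mono (fun y hy => (h y hy).ge) k x hx)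

lemma transfer_iter_nonneg {u : (ℕ → Fin a) → ℝ} (h : ∀ x ∈ SFT A, 0 ≤ u x) (k : ℕ) :
    ∀ x ∈ SFT A, 0 ≤ (transfer A ψ)^[k] u x := by
  induction k with
  | zero => exact h
  | succ k ih =>
    simp only [Function.iterate_succ_apply']
    exact transfer_nonneg ih

lemma transfer_iter_smul (c : ℝ) (u : (ℕ → Fin a) → ℝ) (k : ℕ) :
    (transfer A ψ)^[k] (fun y => c * u y) = fun x => c * (transfer A ψ)^[k] u x := by
  induction k with
  | zero => rfl
  | succ k ih =>
    funext x
    rw [Function.iterate_succ_apply', Function.iterate_succ_apply', ih, transfer_smul]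

lemma transfer_iter_add (u v : (ℕ → Fin a) → ℝ) (k : ℕ) :
    (transfer A ψ)^[k] (fun y => u y + v y) =
      fun x => (transfer A ψ)^[k] u x + (transfer A ψ)^[k] v x := by
  induction k with
  | zero => rfl
  | succ k ih =>
    funext x
    rw [Function.iterate_succ_apply', Function.iterate_succ_apply', Function.iterate_succ_apply',
      ih, transfer_add]

lemma transfer_iter_mul_comp (u v : (ℕ → Fin a) → ℝ) (k : ℕ) (x : ℕ → Fin a) :
    (transfer A ψ)^[k] (fun y => u y * v ((shiftMap a)^[k] y)) x =
      (transfer A ψ)^[k] u x * v x := by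
  induction k generalizing v x with
  | zero => rfl
  | succ k ih =>
    rw [Function.iterate_succ_apply', Function.iterate_succ_apply']
    have : (transfer A ψ)^[k] (fun y => u y * v ((shiftMap a)^[k + 1] y)) =
        fun x => (transfer A ψ)^[k] u x * v (shiftMap a x) := by
      funext x
      rw [← ih (fun y => v (shiftMap a y))]
      simp only [Function.iterate_succ_apply']
    rw [this, transfer_mul_comp]

/-- The transfer operator improves the cone constant. -/
lemma Cone.transfer {θ K b : ℝ} (hψ : LipX A θ K ψ)
    {m : ℕ} {u : (ℕ → Fin a) → ℝ} (hu : Cone A θ b (m + 1) u) :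
    Cone A θ (θ * (b + K)) m (transfer A ψ u) := by
  refine ⟨transfer_nonneg hu.1, ?_⟩
  intro x hx y hy r hr hmr hxy
  simp only [EscapeRate.transfer, Finset.mul_sum]
  refine Finset.sum_le_sum fun i _ => ?_
  rw [hxy 0 hr]
  split_ifs with hi
  · have hx' := cons_mem hx (by rwa [hxy 0 hr]) (i := i)
    have hy' := cons_mem hy hi
    have h1 := hu.2 _ hx' _ hy' (r + 1) (by omega) (by omega) (cons_agree hxy)
    have h2 := (abs_le.1 (hψ _ hx' _ hy' (r + 1) (cons_agree hxy))).2
    have h3 : Real.exp (ψ (cons i x)) ≤ Real.exp (K * θ ^ (r + 1)) * Real.exp (ψ (cons i y)) := by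
      rw [← Real.exp_add]; exact Real.exp_le_exp.2 (by linarith)
    calc _ ≤ (Real.exp (K * θ ^ (r + 1)) * Real.exp (ψ (cons i y))) *
          (Real.exp (b * θ ^ (r + 1)) * u (cons i y)) :=
          mul_le_mul h3 h1 (hu.1 _ hx') (by positivity)
      _ = Real.exp (θ * (b + K) * θ ^ r) * (Real.exp (ψ (cons i y)) * u (cons i y)) := by
          have : θ * (b + K) * θ ^ r = K * θ ^ (r + 1) + b * θ ^ (r + 1) := by ring
          rw [this, Real.exp_add]; ring
  · simp

lemma Cone.mono {θ b b' : ℝ} (hθ : 0 ≤ θ) (hb : b ≤ b') {m m' : ℕ} (hm : m ≤ m')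
    {u : (ℕ → Fin a) → ℝ} (hu : Cone A θ b m u) : Cone A θ b' m' u := by
  refine ⟨hu.1, fun x hx y hy r hr hmr hxy => (hu.2 x hx y hy r hr (hm.trans hmr) hxy).trans ?_⟩
  refine mul_le_mul_of_nonneg_right (Real.exp_le_exp.2 ?_) (hu.1 y hy)
  exact mul_le_mul_of_nonneg_right hb (by positivity)

lemma Cone.iter {θ K b : ℝ} (hθ : 0 ≤ θ) (hψ : LipX A θ K ψ) (hb : θ * (b + K) ≤ b)
    (k : ℕ) : ∀ {m : ℕ} {u : (ℕ → Fin a) → ℝ}, Cone A θ b m u →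
    Cone A θ b (m - k) ((EscapeRate.transfer A ψ)^[k] u) := by
  induction k with
  | zero => intro m u hu; exact hu
  | succ k ih =>
    intro m u hu
    rw [Function.iterate_succ_apply']
    have h1 := ih hu
    exact (Cone.transfer hψ (h1.mono hθ le_rfl (by omega : m - k ≤ (m - (k + 1)) + 1))).mono hθ hb
      le_rfl

lemma cone_one {θ b : ℝ} (hθ : 0 ≤ θ) (hb : 0 ≤ b) : Cone A θ b 0 (fun _ => 1) := by
  refine ⟨fun _ _ => zero_le_one, fun x _ y _ r _ _ _ => ?_⟩
  rw [mul_one]; exact Real.one_le_exp (by positivity)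

lemma transfer_ge_of_pos {M : ℝ} (hM : ∀ x ∈ SFT A, |ψ x| ≤ M)
    (hA01 : ∀ i j, A i j = 0 ∨ A i j = 1) (k : ℕ) :
    ∀ (i : Fin a), ∀ x ∈ SFT A, 0 < (A ^ k) i (x 0) → ∃ x' ∈ SFT A, x' 0 = i ∧
      ∀ v : (ℕ → Fin a) → ℝ, (∀ y ∈ SFT A, 0 ≤ v y) →
        Real.exp (-(k * M)) * v x' ≤ (transfer A ψ)^[k] v x := by
  induction k with
  | zero =>
    intro i x hx h
    refine ⟨x, hx, ?_, fun v _ => by simp⟩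
    by_contra hne
    simp [Ne.symm hne] at h
  | succ k ih =>
    intro i x hx h
    rw [pow_succ, Matrix.mul_apply] at h
    obtain ⟨j, -, hj⟩ := Finset.exists_ne_zero_of_sum_ne_zero h.ne'
    have hj1 : A j (x 0) = 1 := (hA01 j (x 0)).resolve_left fun h0 => hj (by simp [h0])
    have hj2 : 0 < (A ^ k) i j := Nat.pos_of_ne_zero fun h0 => hj (by simp [h0])
    obtain ⟨x', hx', hx0, H⟩ := ih i (cons j x) (cons_mem hx hj1) (by simpa using hj2)
    refine ⟨x', hx', hx0, fun v hv => ?_⟩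
    rw [Function.iterate_succ_apply']
    have h1 : Real.exp (ψ (cons j x)) * (transfer A ψ)^[k] v (cons j x) ≤
        transfer A ψ ((transfer A ψ)^[k] v) x := by
      have := Finset.single_le_sum (f := fun i => if A i (x 0) = 1 then
        Real.exp (ψ (cons i x)) * (transfer A ψ)^[k] v (cons i x) else 0) (fun i _ => by
          split_ifs with hi
          · exact mul_nonneg (Real.exp_pos _).le (transfer_iter_nonneg hv k _ (cons_mem hx hi))
          · exact le_rfl) (Finset.mem_univ j)
      simpa [hj1, EscapeRate.transfer] using this
    refine le_trans ?_ h1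
    have h2 : Real.exp (-M) ≤ Real.exp (ψ (cons j x)) :=
      Real.exp_le_exp.2 (abs_le.1 (hM _ (cons_mem hx hj1))).1
    calc _ = Real.exp (-M) * (Real.exp (-(k * M)) * v x') := by
          rw [← mul_assoc, ← Real.exp_add]; push_cast; ring_nf
      _ ≤ _ := mul_le_mul h2 (H v hv) (mul_nonneg (Real.exp_pos _).le (hv x' hx'))
          (Real.exp_pos _).le

lemma cone_le_transfer_iter {θ b M : ℝ} (hθ : θ ∈ Set.Ioo (0 : ℝ) 1) (hb : 0 ≤ b)
    (hM : ∀ x ∈ SFT A, |ψ x| ≤ M) (hA01 : ∀ i j, A i j = 0 ∨ A i j = 1) {d : ℕ}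
    (hd : ∀ i j, 0 < (A ^ d) i j) {v : (ℕ → Fin a) → ℝ} (hv : Cone A θ b 0 v) :
    ∀ x ∈ SFT A, ∀ y ∈ SFT A, v y ≤ Real.exp (b + d * M) * (transfer A ψ)^[d] v x := by
  intro x hx y hy
  obtain ⟨x', hx', h0, H⟩ := transfer_ge_of_pos (ψ := ψ) hM hA01 d (y 0) x hx (hd _ _)
  have h1 := hv.2 y hy x' hx' 1 le_rfl (Nat.zero_le _) (by
    intro i hi; obtain rfl : i = 0 := by omega
    exact h0.symm)
  have h2 : Real.exp (b * θ ^ 1) ≤ Real.exp b := Real.exp_le_exp.2 (by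
    rw [pow_one]; exact mul_le_of_le_one_right hb hθ.2.le)
  have h3 := H v hv.1
  calc v y ≤ Real.exp b * v x' := h1.trans (mul_le_mul_of_nonneg_right h2 (hv.1 x' hx'))
    _ = Real.exp (b + d * M) * (Real.exp (-(d * M)) * v x') := by
        rw [← mul_assoc, ← Real.exp_add]; ring_nf
    _ ≤ _ := mul_le_mul_of_nonneg_left h3 (Real.exp_pos _).le

lemma LipX.bounded {θ K : ℝ} (hψ : LipX A θ K ψ) {z : ℕ → Fin a} (hz : z ∈ SFT A) :
    ∀ x ∈ SFT A, |ψ x| ≤ |ψ z| + K := by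
  intro x hx
  have := hψ x hx z hz 0 (by simp)
  simp only [pow_zero, mul_one] at this
  have h2 := abs_sub_abs_le_abs_sub (ψ x) (ψ z)
  linarith

end transfer

lemma measurable_shift : Measurable (shiftMap a) :=
  measurable_pi_iff.2 fun n => measurable_pi_apply (n + 1)

lemma measurable_shift_iter (k : ℕ) : Measurable ((shiftMap a)^[k]) := measurable_shift.iterate k

lemma measurable_cons (i : Fin a) : Measurable (cons i : (ℕ → Fin a) → ℕ → Fin a) := by
  refine measurable_pi_iff.2 fun n => ?_
  cases n with
  | zero => exact measurable_const
  | succ n => exact measurable_pi_apply n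

lemma isOpen_cyl (x : ℕ → Fin a) (n : ℕ) : IsOpen (cyl x n) := by
  have : cyl x n = ⋂ i ∈ Finset.range n, (fun y : ℕ → Fin a => y i) ⁻¹' {x i} := by
    ext y; simp [cyl]
  rw [this]
  exact isOpen_biInter_finset fun i _ => (isOpen_discrete _).preimage (continuous_apply i)

lemma measurableSet_cyl (x : ℕ → Fin a) (n : ℕ) : MeasurableSet (cyl x n) :=
  (isOpen_cyl x n).measurableSet

lemma isClosed_SFT (A : Matrix (Fin a) (Fin a) ℕ) : IsClosed (SFT A) := by
  have : SFT A = ⋂ n, (fun x : ℕ → Fin a => (x n, x (n + 1))) ⁻¹' {p | A p.1 p.2 = 1} := by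
    ext y; simp [SFT]
  rw [this]
  exact isClosed_iInter fun n => (isClosed_discrete _).preimage
    ((continuous_apply n).prodMk (continuous_apply (n + 1)))

lemma measurableSet_SFT (A : Matrix (Fin a) (Fin a) ℕ) : MeasurableSet (SFT A) :=
  (isClosed_SFT A).measurableSet

lemma cyl_eq_of_mem {x y : ℕ → Fin a} {n : ℕ} (h : y ∈ cyl x n) : cyl y n = cyl x n := by
  ext w
  exact ⟨fun hw i hi => (hw i hi).trans (h i hi), fun hw i hi => (hw i hi).trans (h i hi).symm⟩

lemma cyl_anti (x : ℕ → Fin a) {m n : ℕ} (h : m ≤ n) : cyl x n ⊆ cyl x m :=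
  fun _ hw i hi => hw i (by omega)

lemma LipX.continuousOn {A : Matrix (Fin a) (Fin a) ℕ} {θ K : ℝ} (hθ : θ ∈ Set.Ioo (0 : ℝ) 1)
    {ψ : (ℕ → Fin a) → ℝ} (hψ : LipX A θ K ψ) : ContinuousOn ψ (SFT A) := by
  intro x hx
  rw [ContinuousWithinAt, Metric.tendsto_nhds]
  intro ε hε
  have h1 : Tendsto (fun n : ℕ => K * θ ^ n) atTop (nhds 0) := by
    simpa using (tendsto_pow_atTop_nhds_zero_of_lt_one hθ.1.le hθ.2).const_mul K
  obtain ⟨n, hn⟩ := (h1.eventually (gt_mem_nhds hε)).exists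
  filter_upwards [self_mem_nhdsWithin, mem_nhdsWithin_of_mem_nhds
    ((isOpen_cyl x n).mem_nhds (fun i _ => rfl))] with y hy hyn
  rw [Real.dist_eq]
  exact (hψ y hy x hx n hyn).trans_lt hn

lemma LipX.measurable_indicator {A : Matrix (Fin a) (Fin a) ℕ} {θ K : ℝ}
    (hθ : θ ∈ Set.Ioo (0 : ℝ) 1)
    {ψ : (ℕ → Fin a) → ℝ} (hψ : LipX A θ K ψ) : Measurable ((SFT A).indicator ψ) := by
  classical
  rw [← Set.piecewise_eq_indicator]
  exact (hψ.continuousOn hθ).measurable_piecewise continuousOn_const (measurableSet_SFT A)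

lemma measure_le_of_saturated {μ₁ μ₂ : Measure (ℕ → Fin a)} {C : ℝ≥0∞} {n : ℕ}
    (h : ∀ y, μ₁ (cyl y n) ≤ C * μ₂ (cyl y n)) {V : Set (ℕ → Fin a)}
    (hV : ∀ x ∈ V, cyl x n ⊆ V) : μ₁ V ≤ C * μ₂ V := by
  classical
  let f : (ℕ → Fin a) → (Fin n → Fin a) := fun x i => x i
  have hf : Measurable f := measurable_pi_iff.2 fun i => measurable_pi_apply _
  have hcyl : ∀ x, f ⁻¹' {f x} = cyl x n := by
    intro x; ext y
    simp only [mem_preimage, mem_singleton_iff, funext_iff, cyl, mem_ofPred_eq, f]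
    exact ⟨fun h i hi => h ⟨i, hi⟩, fun h i => h i i.2⟩
  have hVf : V = f ⁻¹' ((Finset.univ.filter fun w => ∃ x ∈ V, f x = w : Finset _) : Set _) := by
    ext y
    simp only [mem_preimage, Finset.coe_filter, Finset.mem_univ, true_and, mem_ofPred_eq]
    refine ⟨fun hy => ⟨y, hy, rfl⟩, ?_⟩
    rintro ⟨x, hx, hxy⟩
    refine hV x hx ?_
    rw [← hcyl]; exact hxy.symm
  have key : ∀ μ : Measure (ℕ → Fin a), μ V =
      ∑ w ∈ Finset.univ.filter (fun w => ∃ x ∈ V, f x = w), μ (f ⁻¹' {w}) := by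
    intro μ
    rw [sum_measure_preimage_singleton _ fun w _ => hf (measurableSet_singleton w), ← hVf]
  rw [key μ₁, key μ₂, Finset.mul_sum]
  refine Finset.sum_le_sum fun w hw => ?_
  obtain ⟨x, -, rfl⟩ := (Finset.mem_filter.1 hw).2
  rw [hcyl]; exact h x

/-- A bound between two measures on long cylinders extends to all sets. -/
lemma measure_le_of_cyl {μ₁ μ₂ : Measure (ℕ → Fin a)} [IsFiniteMeasure μ₂] {C : ℝ≥0∞}
    (hC : C ≠ ∞) (hC0 : C ≠ 0) (k : ℕ)
    (h : ∀ y, ∀ n ≥ k, μ₁ (cyl y n) ≤ C * μ₂ (cyl y n)) (B : Set (ℕ → Fin a)) :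
    μ₁ B ≤ C * μ₂ B := by
  have hopen : ∀ O : Set (ℕ → Fin a), IsOpen O → μ₁ O ≤ C * μ₂ O := by
    intro O hO
    let V : ℕ → Set (ℕ → Fin a) := fun n => {x | cyl x (n + k) ⊆ O}
    have hmono : Monotone V := fun m n hmn x hx => (cyl_anti x (by omega)).trans hx
    have hU : O = ⋃ n, V n := by
      ext x
      simp only [mem_iUnion]
      constructor
      · intro hx
        obtain ⟨I, u, hu, hsub⟩ := isOpen_pi_iff.1 hO x hx
        refine ⟨I.sup id + 1, fun y hy => hsub ?_⟩
        intro i hi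
        rw [hy i (by have := Finset.le_sup (f := id) hi; simp only [id] at this; omega)]
        exact (hu i hi).2
      · rintro ⟨n, hn⟩
        exact hn fun i _ => rfl
    have h1 : ∀ n, μ₁ (V n) ≤ C * μ₂ O := fun n =>
      (measure_le_of_saturated (fun y => h y (n + k) (by omega)) (fun x hx y hy => by
        change cyl y (n + k) ⊆ O
        rw [cyl_eq_of_mem hy]; exact hx)).trans
        (by gcongr; rw [hU]; exact subset_iUnion V n)
    conv_lhs => rw [hU]
    rw [hmono.measure_iUnion]
    exact iSup_le h1
  rw [Set.measure_eq_iInf_isOpen B μ₂]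
  simp only [ENNReal.mul_iInf_of_ne hC0 hC]
  exact le_iInf₂ fun U hU => le_iInf fun hUo => (measure_mono hU).trans (hopen U hUo)

/-- The weight of the branch `cons i` in the transfer operator. -/
def branchWeight (A : Matrix (Fin a) (Fin a) ℕ) (ψ : (ℕ → Fin a) → ℝ) (i : Fin a)
    (x : ℕ → Fin a) : ℝ≥0∞ :=
  if A i (x 0) = 1 then ENNReal.ofReal (Real.exp (ψ (cons i x))) else 0

/-- The transfer operator acting on extended nonnegative functions. -/
def etransfer (A : Matrix (Fin a) (Fin a) ℕ) (ψ : (ℕ → Fin a) → ℝ) (u : (ℕ → Fin a) → ℝ≥0∞)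
    (x : ℕ → Fin a) : ℝ≥0∞ := ∑ i, branchWeight A ψ i x * u (cons i x)

/-- The dual of the transfer operator acting on measures. -/
def dual (A : Matrix (Fin a) (Fin a) ℕ) (ψ : (ℕ → Fin a) → ℝ) (μ : Measure (ℕ → Fin a)) :
    Measure (ℕ → Fin a) := ∑ i, (μ.withDensity (branchWeight A ψ i)).map (cons i)

section dual
variable {A : Matrix (Fin a) (Fin a) ℕ} {ψ : (ℕ → Fin a) → ℝ}

lemma measurable_branchWeight (hψ : Measurable ψ) (i : Fin a) :
    Measurable (branchWeight A ψ i) := by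
  refine Measurable.ite ?_ ?_ measurable_const
  · exact measurable_pi_apply (X := fun _ : ℕ => Fin a) 0 (DiscreteMeasurableSpace.forall_measurableSet {j | A i j = 1})
  · exact ENNReal.measurable_ofReal.comp
      (Real.measurable_exp.comp (hψ.comp (measurable_cons i)))

lemma measurable_etransfer (hψ : Measurable ψ) {u : (ℕ → Fin a) → ℝ≥0∞} (hu : Measurable u) :
    Measurable (etransfer A ψ u) :=
  Finset.measurable_sum _ fun i _ =>
    (measurable_branchWeight hψ i).mul (hu.comp (measurable_cons i))

lemma lintegral_dual (hψ : Measurable ψ) {u : (ℕ → Fin a) → ℝ≥0∞} (hu : Measurable u)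
    (μ : Measure (ℕ → Fin a)) :
    ∫⁻ x, u x ∂(dual A ψ μ) = ∫⁻ x, etransfer A ψ u x ∂μ := by
  rw [dual, lintegral_finsetSum_measure]
  simp only [etransfer]
  rw [lintegral_finsetSum _ (f := fun i x => branchWeight A ψ i x * u (cons i x)) fun i _ =>
    (measurable_branchWeight hψ i).mul (hu.comp (measurable_cons i))]
  refine Finset.sum_congr rfl fun i _ => ?_
  rw [lintegral_map hu (measurable_cons i)]
  exact lintegral_withDensity_eq_lintegral_mul _ (measurable_branchWeight hψ i)
    (hu.comp (measurable_cons i))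

lemma measurable_etransfer_iter (hψ : Measurable ψ) {u : (ℕ → Fin a) → ℝ≥0∞}
    (hu : Measurable u) (k : ℕ) : Measurable ((etransfer A ψ)^[k] u) := by
  induction k with
  | zero => exact hu
  | succ k ih => rw [Function.iterate_succ_apply']; exact measurable_etransfer hψ ih

lemma lintegral_dual_iter (hψ : Measurable ψ) {u : (ℕ → Fin a) → ℝ≥0∞} (hu : Measurable u)
    (μ : Measure (ℕ → Fin a)) (k : ℕ) :
    ∫⁻ x, u x ∂((dual A ψ)^[k] μ) = ∫⁻ x, (etransfer A ψ)^[k] u x ∂μ := by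
  induction k generalizing u with
  | zero => rfl
  | succ k ih =>
    rw [Function.iterate_succ_apply', lintegral_dual hψ hu, ih (measurable_etransfer hψ hu),
      Function.iterate_succ_apply]

lemma etransfer_mul_comp (u v : (ℕ → Fin a) → ℝ≥0∞) (x : ℕ → Fin a) :
    etransfer A ψ (fun y => u y * v (shiftMap a y)) x = etransfer A ψ u x * v x := by
  simp only [etransfer, Finset.sum_mul, shift_cons, mul_assoc]

lemma etransfer_iter_mul_comp (u v : (ℕ → Fin a) → ℝ≥0∞) (k : ℕ) (x : ℕ → Fin a) :
    (etransfer A ψ)^[k] (fun y => u y * v ((shiftMap a)^[k] y)) x =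
      (etransfer A ψ)^[k] u x * v x := by
  induction k generalizing v x with
  | zero => rfl
  | succ k ih =>
    rw [Function.iterate_succ_apply', Function.iterate_succ_apply']
    have : (etransfer A ψ)^[k] (fun y => u y * v ((shiftMap a)^[k + 1] y)) =
        fun x => (etransfer A ψ)^[k] u x * v (shiftMap a x) := by
      funext x
      rw [← ih (fun y => v (shiftMap a y))]
      simp only [Function.iterate_succ_apply']
    rw [this, etransfer_mul_comp]

lemma etransfer_ofReal {u : (ℕ → Fin a) → ℝ} {U : (ℕ → Fin a) → ℝ≥0∞}
    (hu : ∀ x ∈ SFT A, 0 ≤ u x) (hU : ∀ x ∈ SFT A, U x = ENNReal.ofReal (u x)) :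
    ∀ x ∈ SFT A, etransfer A ψ U x = ENNReal.ofReal (transfer A ψ u x) := by
  intro x hx
  rw [etransfer, transfer, ENNReal.ofReal_sum_of_nonneg]
  · refine Finset.sum_congr rfl fun i _ => ?_
    rw [branchWeight]
    split_ifs with hi
    · rw [hU _ (cons_mem hx hi), ENNReal.ofReal_mul (Real.exp_pos _).le]
    · simp
  · intro i _
    split_ifs with hi
    · exact mul_nonneg (Real.exp_pos _).le (hu _ (cons_mem hx hi))
    · exact le_rfl

lemma etransfer_iter_ofReal {u : (ℕ → Fin a) → ℝ} {U : (ℕ → Fin a) → ℝ≥0∞}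
    (hu : ∀ x ∈ SFT A, 0 ≤ u x) (hU : ∀ x ∈ SFT A, U x = ENNReal.ofReal (u x)) (k : ℕ) :
    ∀ x ∈ SFT A, (etransfer A ψ)^[k] U x = ENNReal.ofReal ((transfer A ψ)^[k] u x) := by
  induction k with
  | zero => exact hU
  | succ k ih =>
    intro x hx
    rw [Function.iterate_succ_apply', Function.iterate_succ_apply']
    exact etransfer_ofReal (transfer_iter_nonneg hu k) ih x hx

/-- Iterated transfer of a cylinder indicator, on one inverse branch. -/
lemma transfer_iter_cyl {θ K : ℝ} (hθ : θ ∈ Set.Ioo (0 : ℝ) 1) (hK : 0 ≤ K)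
    (hψ : LipX A θ K ψ) {y : ℕ → Fin a}
    (hy : y ∈ SFT A) {n : ℕ} (k : ℕ) (hkn : k < n) : ∀ x ∈ SFT A,
    (x ∈ cyl ((shiftMap a)^[k] y) (n - k) →
      Real.exp (birkhoff ψ k y - K * θ ^ (n - k) / (1 - θ)) ≤
        (transfer A ψ)^[k] ((cyl y n).indicator fun _ => 1) x ∧
      (transfer A ψ)^[k] ((cyl y n).indicator fun _ => 1) x ≤
        Real.exp (birkhoff ψ k y + K * θ ^ (n - k) / (1 - θ))) ∧
    (x ∉ cyl ((shiftMap a)^[k] y) (n - k) →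
      (transfer A ψ)^[k] ((cyl y n).indicator fun _ => 1) x = 0) := by
  have h1θ : 0 < 1 - θ := by linarith [hθ.2]
  induction k with
  | zero =>
    intro x hx
    have h0 : 0 ≤ K * θ ^ n / (1 - θ) := by have := hθ.1; positivity
    constructor
    · intro h
      replace h : x ∈ cyl y n := h
      simp [birkhoff, h, h0]
    · intro h
      replace h : x ∉ cyl y n := h
      simp [h]
  | succ k ih =>
    intro x hx
    specialize ih (by omega)
    rw [Function.iterate_succ_apply' (transfer A ψ)]
    set v := (transfer A ψ)^[k] ((cyl y n).indicator fun _ => 1) with hv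
    have hiff : ∀ i, cons i x ∈ cyl ((shiftMap a)^[k] y) (n - k) ↔
        i = y k ∧ x ∈ cyl ((shiftMap a)^[k + 1] y) (n - (k + 1)) := by
      intro i
      simp only [cyl, mem_ofPred_eq, shift_iter]
      constructor
      · intro h
        refine ⟨by simpa using h 0 (by omega), fun j hj => ?_⟩
        have := h (j + 1) (by omega)
        rw [cons_succ] at this
        rw [this]; congr 1; omega
      · rintro ⟨rfl, h⟩ j hj
        cases j with
        | zero => simp
        | succ j => rw [cons_succ, h j (by omega)]; congr 1; omega
    constructor
    · intro hmem
      have hA : A (y k) (x 0) = 1 := by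
        have := hmem 0 (by omega)
        rw [shift_iter, zero_add] at this
        rw [this]; exact hy k
      have hsum : transfer A ψ v x = Real.exp (ψ (cons (y k) x)) * v (cons (y k) x) := by
        rw [transfer, Finset.sum_eq_single (y k)]
        · rw [if_pos hA]
        · intro i _ hi
          split_ifs with h
          · rw [(ih _ (cons_mem hx h)).2 (fun hm => hi ((hiff i).1 hm).1), mul_zero]
          · rfl
        · simp
      have hc := cons_mem hx hA
      have hcm := (hiff (y k)).2 ⟨rfl, hmem⟩
      obtain ⟨l1, l2⟩ := (ih _ hc).1 hcm
      have hl := hψ _ hc _ (shift_iter_mem hy k) (n - k) hcm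
      obtain ⟨m, hm⟩ : ∃ m, n - k = m + 1 := ⟨n - k - 1, by omega⟩
      have hm' : n - (k + 1) = m := by omega
      rw [hm] at hl l1 l2
      rw [hm', hsum]
      have herr : K * θ ^ (m + 1) + K * θ ^ (m + 1) / (1 - θ) ≤ K * θ ^ m / (1 - θ) := by
        rw [← sub_nonneg]
        have : K * θ ^ m / (1 - θ) - (K * θ ^ (m + 1) + K * θ ^ (m + 1) / (1 - θ)) =
            K * θ ^ m * (1 - θ) := by field_simp; ring
        rw [this]; have := hθ.1; positivity
      have hb : birkhoff ψ (k + 1) y = birkhoff ψ k y + ψ ((shiftMap a)^[k] y) := by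
        simp [birkhoff, Finset.sum_range_succ]
      obtain ⟨e1, e2⟩ := abs_le.1 hl
      constructor
      · refine le_trans ?_ (mul_le_mul_of_nonneg_left l1 (Real.exp_pos _).le)
        rw [← Real.exp_add]; apply Real.exp_le_exp.2; rw [hb]; linarith
      · refine (mul_le_mul_of_nonneg_left l2 (Real.exp_pos _).le).trans ?_
        rw [← Real.exp_add]; apply Real.exp_le_exp.2; rw [hb]; linarith
    · intro hmem
      refine Finset.sum_eq_zero fun i _ => ?_
      split_ifs with h
      · rw [(ih _ (cons_mem hx h)).2 (fun hm => hmem ((hiff i).1 hm).2), mul_zero]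
      · rfl

end dual

/-- A shift-invariant measure on a mixing subshift satisfying the Gibbs inequalities for the
Lipschitz potential `ψ` with zero pressure. -/
structure IsGibbs (A : Matrix (Fin a) (Fin a) ℕ) (θ K : ℝ) (d : ℕ) (c₁ c₂ : ℝ)
    (ψ : (ℕ → Fin a) → ℝ) (μ : Measure (ℕ → Fin a)) : Prop where
  hθ : θ ∈ Set.Ioo (0 : ℝ) 1
  hA01 : ∀ i j, A i j = 0 ∨ A i j = 1
  hd : 0 < d
  hAd : ∀ i j, 0 < (A ^ d) i j
  hK : 0 ≤ K
  lip : LipX A θ K ψ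
  meas : Measurable ψ
  supp : μ (SFT A)ᶜ = 0
  inv : MeasurePreserving (shiftMap a) μ μ
  hc₁ : 0 < c₁
  hc₂ : 0 < c₂
  lower : ∀ x ∈ SFT A, ∀ n, 1 ≤ n → ENNReal.ofReal (c₁ * Real.exp (birkhoff ψ n x)) ≤ μ (cyl x n)
  upper : ∀ x ∈ SFT A, ∀ n, 1 ≤ n → μ (cyl x n) ≤ ENNReal.ofReal (c₂ * Real.exp (birkhoff ψ n x))

lemma birkhoff_add (f : (ℕ → Fin a) → ℝ) (m n : ℕ) (x : ℕ → Fin a) :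
    birkhoff f (m + n) x = birkhoff f m x + birkhoff f n ((shiftMap a)^[m] x) := by
  simp only [birkhoff, Finset.sum_range_add, ← Function.iterate_add_apply]
  congr 1
  exact Finset.sum_congr rfl fun i _ => by rw [add_comm]

namespace IsGibbs
variable {A : Matrix (Fin a) (Fin a) ℕ} {θ K c₁ c₂ : ℝ} {d : ℕ} {ψ : (ℕ → Fin a) → ℝ}
  {μ : Measure (ℕ → Fin a)}

/-- The distortion constant comparing a Gibbs measure with its images under the dual operator. -/
def const (θ K c₁ c₂ : ℝ) : ℝ := Real.exp (K / (1 - θ)) * (c₂ / c₁)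

lemma const_pos (hG : IsGibbs A θ K d c₁ c₂ ψ μ) : 0 < const θ K c₁ c₂ :=
  mul_pos (Real.exp_pos _) (div_pos hG.hc₂ hG.hc₁)

lemma ae_mem (hG : IsGibbs A θ K d c₁ c₂ ψ μ) : ∀ᵐ x ∂μ, x ∈ SFT A := by
  rw [ae_iff]; exact hG.supp

lemma dual_iter_null (hG : IsGibbs A θ K d c₁ c₂ ψ μ) (k : ℕ) {B : Set (ℕ → Fin a)}
    (hB : MeasurableSet B) (hBX : ∀ x ∈ SFT A, x ∉ B) : ((dual A ψ)^[k] μ) B = 0 := by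
  rw [← lintegral_indicator_one hB, lintegral_dual_iter hG.meas (measurable_one.indicator hB)]
  rw [lintegral_eq_zero_iff (measurable_etransfer_iter hG.meas (measurable_one.indicator hB) k)]
  filter_upwards [hG.ae_mem] with x hx
  rw [etransfer_iter_ofReal (u := fun _ => 0) (fun _ _ => le_rfl)
    (fun y hy => by simp [hBX y hy]) k x hx]
  have : (transfer A ψ)^[k] (fun _ => 0) x = 0 := by
    have := congrFun (transfer_iter_smul (A := A) (ψ := ψ) 0 (fun _ => 0) k) x
    simpa using this
  simp [this]

lemma dual_iter_cyl (hG : IsGibbs A θ K d c₁ c₂ ψ μ) {k n : ℕ} (hkn : k < n)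
    {y : ℕ → Fin a} (hy : y ∈ SFT A) :
    ((dual A ψ)^[k] μ) (cyl y n) ≤ ENNReal.ofReal (const θ K c₁ c₂) * μ (cyl y n) ∧
    μ (cyl y n) ≤ ENNReal.ofReal (const θ K c₁ c₂) * ((dual A ψ)^[k] μ) (cyl y n) := by
  have h1θ : 0 < 1 - θ := by linarith [hG.hθ.2]
  have hθ0 := hG.hθ.1
  have hc₁ := hG.hc₁
  have hc₂ := hG.hc₂
  have hm := measurableSet_cyl y n
  have hm' := measurableSet_cyl ((shiftMap a)^[k] y) (n - k)
  have hσy := shift_iter_mem hy k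
  have hrw : ((dual A ψ)^[k] μ) (cyl y n) =
      ∫⁻ x, (etransfer A ψ)^[k] ((cyl y n).indicator 1) x ∂μ := by
    rw [← lintegral_indicator_one hm, lintegral_dual_iter hG.meas (measurable_one.indicator hm)]
  have hval : ∀ x ∈ SFT A, (etransfer A ψ)^[k] ((cyl y n).indicator 1) x =
      ENNReal.ofReal ((transfer A ψ)^[k] ((cyl y n).indicator fun _ => 1) x) :=
    etransfer_iter_ofReal (fun x _ => Set.indicator_nonneg (fun _ _ => zero_le_one) x)
      (fun x _ => by by_cases hx : x ∈ cyl y n <;> simp [hx]) k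
  have hE : K * θ ^ (n - k) / (1 - θ) ≤ K / (1 - θ) := by
    gcongr
    exact mul_le_of_le_one_right hG.hK (pow_le_one₀ hθ0.le hG.hθ.2.le)
  have hb := birkhoff_add ψ k (n - k) y
  rw [show k + (n - k) = n by omega] at hb
  constructor
  · have h1 : ((dual A ψ)^[k] μ) (cyl y n) ≤
        ENNReal.ofReal (Real.exp (birkhoff ψ k y + K / (1 - θ))) *
          μ (cyl ((shiftMap a)^[k] y) (n - k)) := by
      rw [hrw, ← lintegral_indicator_const hm']
      refine lintegral_mono_ae ?_
      filter_upwards [hG.ae_mem] with x hx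
      rw [hval x hx]
      obtain ⟨t1, t2⟩ := transfer_iter_cyl hG.hθ hG.hK hG.lip hy k hkn x hx
      by_cases hxm : x ∈ cyl ((shiftMap a)^[k] y) (n - k)
      · rw [Set.indicator_of_mem hxm]
        exact ENNReal.ofReal_le_ofReal ((t1 hxm).2.trans (Real.exp_le_exp.2 (by linarith)))
      · rw [t2 hxm]; simp
    calc _ ≤ _ := h1
      _ ≤ ENNReal.ofReal (Real.exp (birkhoff ψ k y + K / (1 - θ))) *
          ENNReal.ofReal (c₂ * Real.exp (birkhoff ψ (n - k) ((shiftMap a)^[k] y))) := by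
          gcongr; exact hG.upper _ hσy _ (by omega)
      _ = ENNReal.ofReal (const θ K c₁ c₂) *
          ENNReal.ofReal (c₁ * Real.exp (birkhoff ψ n y)) := by
          rw [← ENNReal.ofReal_mul (Real.exp_pos _).le, ← ENNReal.ofReal_mul hG.const_pos.le, hb,
            const, Real.exp_add, Real.exp_add]
          congr 1; field_simp
      _ ≤ _ := by gcongr; exact hG.lower _ hy _ (by omega)
  · have h1 : ENNReal.ofReal (Real.exp (birkhoff ψ k y - K / (1 - θ))) *
          μ (cyl ((shiftMap a)^[k] y) (n - k)) ≤ ((dual A ψ)^[k] μ) (cyl y n) := by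
      rw [hrw, ← lintegral_indicator_const hm']
      refine lintegral_mono_ae ?_
      filter_upwards [hG.ae_mem] with x hx
      rw [hval x hx]
      obtain ⟨t1, t2⟩ := transfer_iter_cyl hG.hθ hG.hK hG.lip hy k hkn x hx
      by_cases hxm : x ∈ cyl ((shiftMap a)^[k] y) (n - k)
      · rw [Set.indicator_of_mem hxm]
        exact ENNReal.ofReal_le_ofReal (le_trans (Real.exp_le_exp.2 (by linarith)) (t1 hxm).1)
      · simp [hxm]
    calc _ ≤ ENNReal.ofReal (c₂ * Real.exp (birkhoff ψ n y)) := hG.upper _ hy _ (by omega)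
      _ = ENNReal.ofReal (const θ K c₁ c₂) *
          (ENNReal.ofReal (Real.exp (birkhoff ψ k y - K / (1 - θ))) *
          ENNReal.ofReal (c₁ * Real.exp (birkhoff ψ (n - k) ((shiftMap a)^[k] y)))) := by
          rw [← ENNReal.ofReal_mul (Real.exp_pos _).le, ← ENNReal.ofReal_mul hG.const_pos.le, hb,
            const, Real.exp_add, Real.exp_sub (birkhoff ψ k y)]
          congr 1; field_simp
      _ ≤ ENNReal.ofReal (const θ K c₁ c₂) *
          (ENNReal.ofReal (Real.exp (birkhoff ψ k y - K / (1 - θ))) *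
          μ (cyl ((shiftMap a)^[k] y) (n - k))) := by
          gcongr; exact hG.lower _ hσy _ (by omega)
      _ ≤ _ := by gcongr

lemma dual_iter_comparable [IsFiniteMeasure μ] (hG : IsGibbs A θ K d c₁ c₂ ψ μ) (k : ℕ)
    (B : Set (ℕ → Fin a)) :
    ((dual A ψ)^[k] μ) B ≤ ENNReal.ofReal (const θ K c₁ c₂) * μ B ∧
    μ B ≤ ENNReal.ofReal (const θ K c₁ c₂) * ((dual A ψ)^[k] μ) B := by
  have hC0 : ENNReal.ofReal (const θ K c₁ c₂) ≠ 0 := by simpa using hG.const_pos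
  have key : ∀ y, ∀ n ≥ k + 1,
      ((dual A ψ)^[k] μ) (cyl y n) ≤ ENNReal.ofReal (const θ K c₁ c₂) * μ (cyl y n) ∧
      μ (cyl y n) ≤ ENNReal.ofReal (const θ K c₁ c₂) * ((dual A ψ)^[k] μ) (cyl y n) := by
    intro y n hn
    by_cases h : ∃ y' ∈ SFT A, y' ∈ cyl y n
    · obtain ⟨y', hy', hc⟩ := h
      rw [← cyl_eq_of_mem hc]
      exact hG.dual_iter_cyl (by omega) hy'
    · push Not at h
      have h1 := hG.dual_iter_null k (measurableSet_cyl y n) h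
      have h2 := hG.dual_iter_null 0 (measurableSet_cyl y n) h
      simp only [Function.iterate_zero, id] at h2
      simp [h1, h2]
  have up := measure_le_of_cyl ENNReal.ofReal_ne_top hC0 (k + 1) fun y n hn => (key y n hn).1
  have : IsFiniteMeasure ((dual A ψ)^[k] μ) :=
    ⟨(up univ).trans_lt (ENNReal.mul_lt_top ENNReal.ofReal_lt_top (measure_lt_top μ univ))⟩
  exact ⟨up B, measure_le_of_cyl ENNReal.ofReal_ne_top hC0 (k + 1) (fun y n hn => (key y n hn).2) B⟩

end IsGibbs

lemma dual_withDensity {A : Matrix (Fin a) (Fin a) ℕ} {ψ : (ℕ → Fin a) → ℝ} (hψ : Measurable ψ)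
    (μ : Measure (ℕ → Fin a)) {u : (ℕ → Fin a) → ℝ≥0∞} (hu : Measurable u) :
    dual A ψ (μ.withDensity u) = (dual A ψ μ).withDensity fun x => u (shiftMap a x) := by
  ext B hB
  have hm : Measurable (B.indicator (1 : (ℕ → Fin a) → ℝ≥0∞)) := measurable_one.indicator hB
  rw [← lintegral_indicator_one hB, lintegral_dual hψ hm, withDensity_apply _ hB,
    lintegral_withDensity_eq_lintegral_mul _ hu (measurable_etransfer hψ hm),
    ← lintegral_indicator hB]
  have : (B.indicator fun x => u (shiftMap a x)) =
      fun x => B.indicator 1 x * u (shiftMap a x) := by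
    funext x; by_cases hx : x ∈ B <;> simp [hx]
  rw [this]
  refine Eq.trans (lintegral_congr fun x => ?_)
    (lintegral_dual hψ (hm.mul (hu.comp measurable_shift)) μ).symm
  change _ = etransfer A ψ (fun x => B.indicator 1 x * u (shiftMap a x)) x
  rw [etransfer_mul_comp, Pi.mul_apply, mul_comm]

lemma IsGibbs.dual_eq {A : Matrix (Fin a) (Fin a) ℕ} {θ K c₁ c₂ : ℝ} {d : ℕ}
    {ψ : (ℕ → Fin a) → ℝ} {μ : Measure (ℕ → Fin a)} [IsProbabilityMeasure μ]
    (hG : IsGibbs A θ K d c₁ c₂ ψ μ)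
    (hN : ∀ x ∈ SFT A, transfer A ψ (fun _ => 1) x = 1) : dual A ψ μ = μ := by
  set C := const θ K c₁ c₂ with hC
  have hCpos : 0 < C := hG.const_pos
  have hcomp := hG.dual_iter_comparable
  have hac : dual A ψ μ ≪ μ := fun B hB => by
    have := (hcomp 1 B).1
    rw [hB, mul_zero] at this
    exact le_antisymm this bot_le
  have : IsFiniteMeasure (dual A ψ μ) :=
    ⟨(hcomp 1 univ).1.trans_lt (ENNReal.mul_lt_top ENNReal.ofReal_lt_top (measure_lt_top μ univ))⟩
  have : (dual A ψ μ).HaveLebesgueDecomposition μ :=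
    Measure.haveLebesgueDecomposition_of_sigmaFinite _ _
  set r := (dual A ψ μ).rnDeriv μ with hr
  have hrm : Measurable r := Measure.measurable_rnDeriv _ _
  have hdr : dual A ψ μ = μ.withDensity r := (Measure.withDensity_rnDeriv_eq (dual A ψ μ) μ hac).symm
  have hRm : ∀ k, Measurable fun x => ∏ j ∈ Finset.range k, r ((shiftMap a)^[j] x) := fun k =>
    Finset.measurable_prod _ fun j _ => hrm.comp (measurable_shift_iter j)
  have hiter : ∀ k, (dual A ψ)^[k] μ =
      μ.withDensity fun x => ∏ j ∈ Finset.range k, r ((shiftMap a)^[j] x) := by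
    intro k
    induction k with
    | zero => simp
    | succ k ih =>
      rw [Function.iterate_succ_apply', ih, dual_withDensity hG.meas _ (hRm k), hdr]
      refine (withDensity_mul μ hrm ((hRm k).comp measurable_shift)).symm.trans ?_
      congr 1; funext x
      rw [Finset.prod_range_succ', mul_comm]
      rfl
  have hup : ∀ᵐ x ∂μ, r x ≤ ENNReal.ofReal C := by
    refine ae_le_of_forall_setLIntegral_le_of_sigmaFinite hrm fun B hB _ => ?_
    rw [← withDensity_apply _ hB, ← hdr, setLIntegral_const]
    exact (hcomp 1 B).1
  have hlow : ∀ k, ∀ᵐ x ∂μ, 1 ≤ ENNReal.ofReal C * ∏ j ∈ Finset.range k, r ((shiftMap a)^[j] x) := by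
    intro k
    refine ae_le_of_forall_setLIntegral_le_of_sigmaFinite measurable_const fun B hB _ => ?_
    rw [setLIntegral_const, one_mul, lintegral_const_mul _ (hRm k), ← withDensity_apply _ hB,
      ← hiter]
    exact (hcomp k B).2
  set ρ : (ℕ → Fin a) → ℝ := fun x => (r x).toReal with hρ
  have hρm : Measurable ρ := hrm.ennreal_toReal
  have hρ_up : ∀ᵐ x ∂μ, ρ x ≤ C := by
    filter_upwards [hup] with x hx
    exact ENNReal.toReal_le_of_le_ofReal hCpos.le hx
  have hρ_low : ∀ᵐ x ∂μ, 1 / C ≤ ρ x := by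
    filter_upwards [hlow 1, hup] with x hx hx'
    have hfin : r x ≠ ∞ := ne_top_of_le_ne_top ENNReal.ofReal_ne_top hx'
    simp only [Finset.range_one, Finset.prod_singleton, Function.iterate_zero, id] at hx
    have := ENNReal.toReal_mono (ENNReal.mul_ne_top ENNReal.ofReal_ne_top hfin) hx
    rw [ENNReal.toReal_mul, ENNReal.toReal_ofReal hCpos.le, ENNReal.toReal_one] at this
    rw [div_le_iff₀ hCpos]; linarith
  have hlogm : Measurable fun x => Real.log (ρ x) := Real.measurable_log.comp hρm
  have hlog_int : Integrable (fun x => Real.log (ρ x)) μ := by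
    refine Integrable.of_bound hlogm.aestronglyMeasurable |Real.log C| ?_
    filter_upwards [hρ_up, hρ_low] with x h1 h2
    have hpos : 0 < ρ x := lt_of_lt_of_le (by positivity) h2
    rw [Real.norm_eq_abs, abs_le]
    have e1 := Real.log_le_log hpos h1
    have e2 := Real.log_le_log (by positivity) h2
    rw [one_div, Real.log_inv] at e2
    exact ⟨by linarith [le_abs_self (Real.log C)], e1.trans (le_abs_self _)⟩
  have hρ_int : Integrable ρ μ := by
    refine Integrable.of_bound hρm.aestronglyMeasurable C ?_
    filter_upwards [hρ_up] with x h1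
    rw [Real.norm_eq_abs, abs_of_nonneg ENNReal.toReal_nonneg]; exact h1
  have hρ_one : ∫ x, ρ x ∂μ = 1 := by
    rw [integral_toReal hrm.aemeasurable (hup.mono fun x hx => hx.trans_lt ENNReal.ofReal_lt_top)]
    rw [← setLIntegral_univ, ← withDensity_apply _ MeasurableSet.univ, ← hdr]
    have h1 := lintegral_dual hG.meas (A := A) (u := fun _ => 1) measurable_const μ
    rw [lintegral_const, one_mul] at h1
    rw [h1]
    have h2 : ∫⁻ x, etransfer A ψ (fun _ => 1) x ∂μ = ∫⁻ _, 1 ∂μ := by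
      refine lintegral_congr_ae ?_
      filter_upwards [hG.ae_mem] with x hx
      rw [etransfer_ofReal (u := fun _ => 1) (fun _ _ => zero_le_one) (by simp) x hx, hN x hx]
      simp
    rw [h2]; simp
  have hlog_nonneg : 0 ≤ ∫ x, Real.log (ρ x) ∂μ := by
    have hk : ∀ k : ℕ, -Real.log C ≤ k * ∫ x, Real.log (ρ x) ∂μ := by
      intro k
      have hmp : ∀ j, MeasurePreserving ((shiftMap a)^[j]) μ μ := fun j => hG.inv.iterate j
      have hj : ∀ j, Integrable (fun x => Real.log (ρ ((shiftMap a)^[j] x))) μ := fun j =>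
        (hmp j).integrable_comp_of_integrable hlog_int
      have hsum : ∫ x, ∑ j ∈ Finset.range k, Real.log (ρ ((shiftMap a)^[j] x)) ∂μ =
          k * ∫ x, Real.log (ρ x) ∂μ := by
        rw [integral_finsetSum _ fun j _ => hj j]
        have : ∀ j, ∫ x, Real.log (ρ ((shiftMap a)^[j] x)) ∂μ = ∫ x, Real.log (ρ x) ∂μ := by
          intro j
          have h3 := integral_map (μ := μ) (hmp j).measurable.aemeasurable
            (f := fun x => Real.log (ρ x)) hlogm.aestronglyMeasurable
          rw [(hmp j).map_eq] at h3
          exact h3.symm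
        simp [this]
      rw [← hsum]
      have hbd : ∀ᵐ x ∂μ, -Real.log C ≤ ∑ j ∈ Finset.range k, Real.log (ρ ((shiftMap a)^[j] x)) := by
        have hall : ∀ᵐ x ∂μ, ∀ j, 1 / C ≤ ρ ((shiftMap a)^[j] x) :=
          ae_all_iff.2 fun j => (hmp j).quasiMeasurePreserving.ae hρ_low
        have hall' : ∀ᵐ x ∂μ, ∀ j, r ((shiftMap a)^[j] x) ≤ ENNReal.ofReal C :=
          ae_all_iff.2 fun j => (hmp j).quasiMeasurePreserving.ae hup
        filter_upwards [hlow k, hall, hall'] with x h1 h2 h3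
        have hpos : ∀ j, 0 < ρ ((shiftMap a)^[j] x) := fun j =>
          lt_of_lt_of_le (by positivity) (h2 j)
        have hfin : ∏ j ∈ Finset.range k, r ((shiftMap a)^[j] x) ≠ ∞ :=
          ENNReal.prod_ne_top fun j _ => ne_top_of_le_ne_top ENNReal.ofReal_ne_top (h3 j)
        have h4 := ENNReal.toReal_mono (ENNReal.mul_ne_top ENNReal.ofReal_ne_top hfin) h1
        rw [ENNReal.toReal_mul, ENNReal.toReal_ofReal hCpos.le, ENNReal.toReal_one,
          ENNReal.toReal_prod] at h4
        have hprod : 0 < ∏ j ∈ Finset.range k, ρ ((shiftMap a)^[j] x) :=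
          Finset.prod_pos fun j _ => hpos j
        rw [← Real.log_prod (fun j _ => (hpos j).ne')]
        have h5 := Real.log_le_log one_pos h4
        rw [Real.log_one, Real.log_mul hCpos.ne' hprod.ne'] at h5
        linarith
      have := integral_mono_ae (integrable_const (-Real.log C))
        (integrable_finsetSum _ fun j _ => hj j) hbd
      simpa using this
    by_contra hneg
    push Not at hneg
    obtain ⟨k, hk'⟩ := exists_nat_gt (Real.log C / (-∫ x, Real.log (ρ x) ∂μ))
    rw [div_lt_iff₀ (by linarith)] at hk'
    linarith [hk k]
  have hdiff : ∫ x, (ρ x - 1 - Real.log (ρ x)) ∂μ ≤ 0 := by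
    rw [integral_sub (f := fun x => ρ x - 1) (hρ_int.sub (integrable_const 1)) hlog_int,
      integral_sub hρ_int (integrable_const 1), hρ_one]
    simp only [integral_const, probReal_univ, smul_eq_mul, mul_one]
    linarith
  have hnn : ∀ᵐ x ∂μ, 0 ≤ ρ x - 1 - Real.log (ρ x) := by
    filter_upwards [hρ_low] with x h
    have := Real.log_le_sub_one_of_pos (lt_of_lt_of_le (by positivity) h : 0 < ρ x)
    linarith
  have hzero := (integral_eq_zero_iff_of_nonneg_ae hnn
    ((hρ_int.sub (integrable_const 1)).sub hlog_int)).1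
    (le_antisymm hdiff (integral_nonneg_of_ae hnn))
  have hr1 : r =ᵐ[μ] 1 := by
    filter_upwards [hzero, hρ_low, hup] with x h1 h2 h3
    have hpos : 0 < ρ x := lt_of_lt_of_le (by positivity) h2
    have h4 : ρ x = 1 := by
      by_contra hne
      have := Real.log_lt_sub_one_of_pos hpos hne
      simp only [Pi.zero_apply] at h1
      linarith
    have hfin : r x ≠ ∞ := ne_top_of_le_ne_top ENNReal.ofReal_ne_top h3
    rw [← ENNReal.ofReal_toReal hfin]
    change ENNReal.ofReal (ρ x) = 1
    rw [h4]; simp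
  rw [hdr, withDensity_congr_ae hr1, withDensity_one]

namespace IsGibbs
variable {A : Matrix (Fin a) (Fin a) ℕ} {θ K c₁ c₂ : ℝ} {d : ℕ} {ψ : (ℕ → Fin a) → ℝ}
  {μ : Measure (ℕ → Fin a)}

/-- The iterates of the transfer operator on the constant function are uniformly bounded. -/
lemma transfer_iter_one_bounds [IsProbabilityMeasure μ] (hG : IsGibbs A θ K d c₁ c₂ ψ μ)
    {z : ℕ → Fin a} (hz : z ∈ SFT A) : ∃ R : ℝ, 0 < R ∧ ∀ j, ∀ x ∈ SFT A,
      R⁻¹ ≤ (transfer A ψ)^[j + d] (fun _ => 1) x ∧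
        (transfer A ψ)^[j + d] (fun _ => 1) x ≤ R := by
  have h1θ : 0 < 1 - θ := by linarith [hG.hθ.2]
  have hθ0 := hG.hθ.1
  set b : ℝ := θ * K / (1 - θ) with hb
  have hb0 : 0 ≤ b := div_nonneg (mul_nonneg hθ0.le hG.hK) h1θ.le
  have hbK : θ * (b + K) ≤ b := by rw [hb]; apply le_of_eq; field_simp; ring
  have hcone : ∀ k, Cone A θ b 0 ((transfer A ψ)^[k] (fun _ => 1)) := fun k => by
    simpa using Cone.iter hθ0.le hG.lip hbK k (cone_one (A := A) hθ0.le hb0)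
  set M := |ψ z| + K
  set Q := Real.exp (b + d * M) with hQ
  have hQ0 : 0 < Q := Real.exp_pos _
  have hcmp : ∀ j, ∀ x ∈ SFT A, ∀ y ∈ SFT A, (transfer A ψ)^[j] (fun _ => 1) y ≤
      Q * (transfer A ψ)^[j + d] (fun _ => 1) x := by
    intro j x hx y hy
    have := cone_le_transfer_iter hG.hθ hb0 (hG.lip.bounded hz) hG.hA01 hG.hAd (hcone j) x hx y hy
    rwa [← Function.iterate_add_apply, add_comm d] at this
  set C := const θ K c₁ c₂ with hC
  have hC0 : 0 < C := hG.const_pos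
  have hmass : ∀ k, ∫⁻ x, ENNReal.ofReal ((transfer A ψ)^[k] (fun _ => 1) x) ∂μ ≤
      ENNReal.ofReal C ∧ 1 ≤ ENNReal.ofReal C *
        ∫⁻ x, ENNReal.ofReal ((transfer A ψ)^[k] (fun _ => 1) x) ∂μ := by
    intro k
    have h1 := hG.dual_iter_comparable k univ
    have h2 := lintegral_dual_iter (A := A) hG.meas (u := fun _ => 1) measurable_const μ k
    rw [lintegral_const, one_mul] at h2
    have h3 : ∫⁻ x, (etransfer A ψ)^[k] (fun _ => 1) x ∂μ =
        ∫⁻ x, ENNReal.ofReal ((transfer A ψ)^[k] (fun _ => 1) x) ∂μ := by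
      refine lintegral_congr_ae ?_
      filter_upwards [hG.ae_mem] with x hx
      exact etransfer_iter_ofReal (fun _ _ => zero_le_one) (by simp) k x hx
    rw [h2, h3] at h1
    simpa using h1
  refine ⟨Q * C, by positivity, fun j x hx => ⟨?_, ?_⟩⟩
  · have h1 : ∫⁻ y, ENNReal.ofReal ((transfer A ψ)^[j] (fun _ => 1) y) ∂μ ≤
        ENNReal.ofReal (Q * (transfer A ψ)^[j + d] (fun _ => 1) x) := by
      calc _ ≤ ∫⁻ y, ENNReal.ofReal (Q * (transfer A ψ)^[j + d] (fun _ => 1) x) ∂μ := by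
            refine lintegral_mono_ae ?_
            filter_upwards [hG.ae_mem] with y hy
            exact ENNReal.ofReal_le_ofReal (hcmp j x hx y hy)
        _ = _ := by simp
    have h2 : 1 ≤ ENNReal.ofReal (C * (Q * (transfer A ψ)^[j + d] (fun _ => 1) x)) := by
      rw [ENNReal.ofReal_mul hC0.le]
      exact (hmass j).2.trans (by gcongr)
    rw [ENNReal.one_le_ofReal] at h2
    rw [inv_le_iff_one_le_mul₀ (by positivity)]
    linarith
  · have h1 : ENNReal.ofReal ((transfer A ψ)^[j + d] (fun _ => 1) x) ≤
        ENNReal.ofReal (Q * C) := by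
      calc _ = ∫⁻ y, ENNReal.ofReal ((transfer A ψ)^[j + d] (fun _ => 1) x) ∂μ := by simp
        _ ≤ ∫⁻ y, ENNReal.ofReal Q *
              ENNReal.ofReal ((transfer A ψ)^[j + d + d] (fun _ => 1) y) ∂μ := by
            refine lintegral_mono_ae ?_
            filter_upwards [hG.ae_mem] with y hy
            rw [← ENNReal.ofReal_mul hQ0.le]
            exact ENNReal.ofReal_le_ofReal (hcmp (j + d) y hy x hx)
        _ = ENNReal.ofReal Q *
              ∫⁻ y, ENNReal.ofReal ((transfer A ψ)^[j + d + d] (fun _ => 1) y) ∂μ :=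
            lintegral_const_mul' _ _ ENNReal.ofReal_ne_top
        _ ≤ ENNReal.ofReal Q * ENNReal.ofReal C := by gcongr; exact (hmass _).1
        _ = _ := by rw [ENNReal.ofReal_mul hQ0.le]
    exact (ENNReal.ofReal_le_ofReal_iff (by positivity)).1 h1

lemma exists_eigenfunction [IsProbabilityMeasure μ] (hG : IsGibbs A θ K d c₁ c₂ ψ μ)
    {z : ℕ → Fin a} (hz : z ∈ SFT A) : ∃ (h : (ℕ → Fin a) → ℝ) (R b : ℝ), 0 < R ∧ 0 ≤ b ∧
      (∀ x ∈ SFT A, R⁻¹ ≤ h x ∧ h x ≤ R) ∧ (∀ x ∈ SFT A, transfer A ψ h x = h x) ∧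
      Cone A θ b 0 h := by
  obtain ⟨R, hR, hbd⟩ := hG.transfer_iter_one_bounds hz
  have h1θ : 0 < 1 - θ := by linarith [hG.hθ.2]
  have hθ0 := hG.hθ.1
  set b : ℝ := θ * K / (1 - θ) with hb
  have hb0 : 0 ≤ b := div_nonneg (mul_nonneg hθ0.le hG.hK) h1θ.le
  have hbK : θ * (b + K) ≤ b := by rw [hb]; apply le_of_eq; field_simp; ring
  set v : ℕ → (ℕ → Fin a) → ℝ := fun j => (transfer A ψ)^[j + d] (fun _ => 1) with hv
  have hcone : ∀ k, Cone A θ b 0 (v k) := fun k => by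
    simpa using Cone.iter hθ0.le hG.lip hbK (k + d) (cone_one (A := A) hθ0.le hb0)
  have hTv : ∀ j, transfer A ψ (v j) = v (j + 1) := fun j => by
    simp only [hv]
    rw [← Function.iterate_succ_apply' (transfer A ψ)]
    congr 2; omega
  set g : ℕ → (ℕ → Fin a) → ℝ := fun k x => ((k : ℝ) + 1)⁻¹ * ∑ j ∈ Finset.range (k + 1), v j x
    with hg
  have hsum_const : ∀ (k : ℕ) (c : ℝ),
      ((k : ℝ) + 1)⁻¹ * ∑ _j ∈ Finset.range (k + 1), c = c := by
    intro k c
    have : (k : ℝ) + 1 ≠ 0 := by positivity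
    simp; field_simp
  have hgbd : ∀ k, ∀ x ∈ SFT A, R⁻¹ ≤ g k x ∧ g k x ≤ R := by
    intro k x hx
    constructor
    · rw [← hsum_const k R⁻¹]
      simp only [hg]; gcongr with j; exact (hbd j x hx).1
    · conv_rhs => rw [← hsum_const k R]
      simp only [hg]; gcongr with j; exact (hbd j x hx).2
  have hTg : ∀ k x, transfer A ψ (g k) x = g k x + ((k : ℝ) + 1)⁻¹ * (v (k + 1) x - v 0 x) := by
    intro k x
    have hsum : ∀ n x, transfer A ψ (fun y => ∑ j ∈ Finset.range n, v j y) x =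
        ∑ j ∈ Finset.range n, v (j + 1) x := by
      intro n
      induction n with
      | zero => intro x; simpa using transfer_zero x
      | succ n ih =>
        intro x
        simp only [Finset.sum_range_succ]
        rw [transfer_add, ih, hTv]
    simp only [hg]
    rw [transfer_smul, hsum, Finset.sum_range_succ, Finset.sum_range_succ' (fun j => v j x)]
    ring
  have hex : ∀ x, ∃ l : ℝ, x ∈ SFT A → Tendsto (fun k => g k x) (hyperfilter ℕ) (nhds l) := by
    intro x
    by_cases hx : x ∈ SFT A
    · obtain ⟨l, -, hl⟩ := (isCompact_Icc (a := R⁻¹) (b := R)).ultrafilter_le_nhds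
        ((hyperfilter ℕ).map fun k => g k x) (by
          rw [le_principal_iff]
          exact Filter.mem_map.2 (Filter.univ_mem' fun k => hgbd k x hx))
      exact ⟨l, fun _ => hl⟩
    · exact ⟨0, fun h => absurd h hx⟩
  choose h hh using hex
  refine ⟨h, R, b, hR, hb0, fun x hx => ?_, fun x hx => ?_, fun x hx => ?_, ?_⟩
  · exact ⟨ge_of_tendsto' (hh x hx) fun k => (hgbd k x hx).1,
      le_of_tendsto' (hh x hx) fun k => (hgbd k x hx).2⟩
  · have h1 : Tendsto (fun k => transfer A ψ (g k) x) (hyperfilter ℕ)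
        (nhds (transfer A ψ h x)) := by
      unfold transfer
      refine tendsto_finsetSum _ fun i _ => ?_
      by_cases hi : A i (x 0) = 1
      · simp only [hi, if_true]
        exact (hh _ (cons_mem hx hi)).const_mul _
      · simp [hi]
    have h2 : Tendsto (fun k : ℕ => ((k : ℝ) + 1)⁻¹ * (v (k + 1) x - v 0 x)) atTop (nhds 0) := by
      have h3 : Tendsto (fun k : ℕ => ((k : ℝ) + 1)⁻¹ * (2 * R)) atTop (nhds 0) := by
        simpa using (tendsto_one_div_add_atTop_nhds_zero_nat (𝕜 := ℝ)).mul_const (2 * R)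
      refine squeeze_zero_norm (fun k => ?_) h3
      rw [Real.norm_eq_abs, abs_mul, abs_of_nonneg (by positivity : (0 : ℝ) ≤ ((k : ℝ) + 1)⁻¹)]
      gcongr
      have e1 := hbd (k + 1) x hx
      have e2 := hbd 0 x hx
      have e3 : 0 < R⁻¹ := by positivity
      simp only [hv]
      rw [abs_le]; constructor <;> linarith
    have h4 : Tendsto (fun k => transfer A ψ (g k) x) (hyperfilter ℕ) (nhds (h x)) := by
      simp only [hTg]
      simpa using (hh x hx).add (h2.mono_left Nat.hyperfilter_le_atTop)
    exact tendsto_nhds_unique h1 h4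
  · exact ge_of_tendsto' (hh x hx) fun k => (by positivity : (0 : ℝ) ≤ R⁻¹).trans (hgbd k x hx).1
  · intro x hx y hy r hr hm hxy
    refine le_of_tendsto_of_tendsto' (hh x hx) ((hh y hy).const_mul _) fun k => ?_
    simp only [hg]
    rw [mul_left_comm]
    refine mul_le_mul_of_nonneg_left ?_ (by positivity)
    rw [Finset.mul_sum]
    refine Finset.sum_le_sum fun j _ => ?_
    exact (hcone j).2 x hx y hy r hr hm hxy

lemma birkhoff_coboundary {f g h : (ℕ → Fin a) → ℝ}
    (hf : ∀ x ∈ SFT A, f x = g x + h x - h (shiftMap a x)) (n : ℕ) :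
    ∀ x ∈ SFT A, birkhoff f n x = birkhoff g n x + h x - h ((shiftMap a)^[n] x) := by
  intro x hx
  induction n with
  | zero => simp [birkhoff]
  | succ n ih =>
    simp only [birkhoff] at ih ⊢
    rw [Finset.sum_range_succ, Finset.sum_range_succ, ih, hf _ (shift_iter_mem hx n),
      Function.iterate_succ_apply']
    ring

/-- Every Gibbs measure is the Gibbs measure of a normalised potential cohomologous to the given
one. -/
lemma exists_normalised [IsProbabilityMeasure μ] (hG : IsGibbs A θ K d c₁ c₂ ψ μ)
    {z : ℕ → Fin a} (hz : z ∈ SFT A) : ∃ (ψ' : (ℕ → Fin a) → ℝ) (K' c₁' c₂' : ℝ),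
      IsGibbs A θ K' d c₁' c₂' ψ' μ ∧ (∀ x ∈ SFT A, transfer A ψ' (fun _ => 1) x = 1) ∧
      ∀ p, ∀ x ∈ SFT A, (shiftMap a)^[p] x = x → birkhoff ψ' p x = birkhoff ψ p x := by
  obtain ⟨h, R, b, hR, hb, hbd, hfix, hcone⟩ := hG.exists_eigenfunction hz
  have hθ0 := hG.hθ.1
  have hR' : 0 < R⁻¹ := by positivity
  have hpos : ∀ x ∈ SFT A, 0 < h x := fun x hx => hR'.trans_le (hbd x hx).1
  have hlog : ∀ x ∈ SFT A, |Real.log (h x)| ≤ Real.log R := by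
    intro x hx
    have e1 := Real.log_le_log hR' (hbd x hx).1
    have e2 := Real.log_le_log (hpos x hx) (hbd x hx).2
    rw [Real.log_inv] at e1
    exact abs_le.2 ⟨e1, e2⟩
  have hlogR : 0 ≤ Real.log R := (abs_nonneg _).trans (hlog z hz)
  set H := b + 2 * Real.log R with hH
  have hH0 : 0 ≤ H := by positivity
  have hlip : LipX A θ H (fun x => Real.log (h x)) := by
    intro x hx y hy n hxy
    rcases Nat.eq_zero_or_pos n with rfl | hn
    · have e1 := abs_le.1 (hlog x hx)
      have e2 := abs_le.1 (hlog y hy)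
      rw [pow_zero, mul_one, abs_le]
      constructor <;> linarith
    · have key : ∀ x ∈ SFT A, ∀ y ∈ SFT A, (∀ i < n, x i = y i) →
          Real.log (h x) ≤ b * θ ^ n + Real.log (h y) := by
        intro x hx y hy hxy
        have := Real.log_le_log (hpos x hx) (hcone.2 x hx y hy n hn (Nat.zero_le _) hxy)
        rwa [Real.log_mul (Real.exp_pos _).ne' (hpos y hy).ne', Real.log_exp] at this
      have e1 := key x hx y hy hxy
      have e2 := key y hy x hx fun i hi => (hxy i hi).symm
      have e3 : b * θ ^ n ≤ H * θ ^ n := by gcongr; linarith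
      rw [abs_le]; constructor <;> linarith
  set ψ' : (ℕ → Fin a) → ℝ := (SFT A).indicator fun x =>
    ψ x + Real.log (h x) - Real.log (h (shiftMap a x)) with hψ'
  have hval : ∀ x ∈ SFT A, ψ' x = ψ x + Real.log (h x) - Real.log (h (shiftMap a x)) :=
    fun x hx => by simp [hψ', hx]
  set K' := K + H + (2 * Real.log R + H / θ) with hK'
  have hlip0 : LipX A θ K' fun x => ψ x + Real.log (h x) - Real.log (h (shiftMap a x)) := by
    intro x hx y hy n hxy
    have e1 := abs_le.1 (hG.lip x hx y hy n hxy)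
    have e2 := abs_le.1 (hlip x hx y hy n hxy)
    have e3 : |Real.log (h (shiftMap a x)) - Real.log (h (shiftMap a y))| ≤
        (2 * Real.log R + H / θ) * θ ^ n := by
      rcases Nat.eq_zero_or_pos n with rfl | hn
      · have e1 := abs_le.1 (hlog _ (shift_mem hx))
        have e2 := abs_le.1 (hlog _ (shift_mem hy))
        have : 0 ≤ H / θ := by positivity
        rw [pow_zero, mul_one, abs_le]
        constructor <;> linarith
      · have := hlip _ (shift_mem hx) _ (shift_mem hy) (n - 1)
          (fun i hi => hxy (i + 1) (by omega))
        refine this.trans ?_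
        obtain ⟨m, rfl⟩ : ∃ m, n = m + 1 := ⟨n - 1, by omega⟩
        have : (2 * Real.log R + H / θ) * θ ^ (m + 1) =
          2 * Real.log R * θ ^ (m + 1) + H * θ ^ m := by rw [pow_succ]; field_simp
        rw [this, Nat.add_sub_cancel]
        have : 0 ≤ 2 * Real.log R * θ ^ (m + 1) := by positivity
        linarith
    have e3 := abs_le.1 e3
    rw [hK', add_mul, add_mul, abs_le]
    constructor <;> linarith
  have hK'0 : 0 ≤ K' := by have := hG.hK; positivity
  have hbirk : ∀ n, ∀ x ∈ SFT A, birkhoff ψ' n x =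
      birkhoff ψ n x + Real.log (h x) - Real.log (h ((shiftMap a)^[n] x)) :=
    birkhoff_coboundary (h := fun x => Real.log (h x)) hval
  refine ⟨ψ', K', c₁ * Real.exp (-(2 * Real.log R)), c₂ * Real.exp (2 * Real.log R),
    ⟨hG.hθ, hG.hA01, hG.hd, hG.hAd, hK'0, ?_, hlip0.measurable_indicator hG.hθ, hG.supp, hG.inv,
      mul_pos hG.hc₁ (Real.exp_pos _), mul_pos hG.hc₂ (Real.exp_pos _), ?_, ?_⟩, ?_, ?_⟩
  · intro x hx y hy n hxy
    rw [hval x hx, hval y hy]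
    exact hlip0 x hx y hy n hxy
  · intro x hx n hn
    refine le_trans (ENNReal.ofReal_le_ofReal ?_) (hG.lower x hx n hn)
    rw [mul_assoc, ← Real.exp_add, hbirk n x hx]
    have e1 := abs_le.1 (hlog x hx)
    have e2 := abs_le.1 (hlog _ (shift_iter_mem hx n))
    have := hG.hc₁
    gcongr
    linarith
  · intro x hx n hn
    refine le_trans (hG.upper x hx n hn) (ENNReal.ofReal_le_ofReal ?_)
    rw [mul_assoc, ← Real.exp_add, hbirk n x hx]
    have e1 := abs_le.1 (hlog x hx)
    have e2 := abs_le.1 (hlog _ (shift_iter_mem hx n))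
    have := hG.hc₂
    gcongr
    linarith
  · intro x hx
    have hx0 := hpos x hx
    have : transfer A ψ' (fun _ => 1) x = (h x)⁻¹ * transfer A ψ h x := by
      unfold transfer
      rw [Finset.mul_sum]
      refine Finset.sum_congr rfl fun i _ => ?_
      by_cases hi : A i (x 0) = 1
      · simp only [hi, if_true]
        have hc := cons_mem hx hi
        have hs : shiftMap a (cons i x) = x := by funext n; rfl
        rw [hval _ hc, hs, Real.exp_sub, Real.exp_add, Real.exp_log (hpos _ hc), Real.exp_log hx0]
        field_simp
      · simp [hi]
    rw [this, hfix x hx, inv_mul_cancel₀ hx0.ne']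
  · intro p x hx hp
    rw [hbirk p x hx, hp]; ring

end IsGibbs

section normalised
variable {A : Matrix (Fin a) (Fin a) ℕ} {θ K c₁ c₂ : ℝ} {d : ℕ} {ψ : (ℕ → Fin a) → ℝ}
  {μ : Measure (ℕ → Fin a)}

lemma measurable_transfer (hψ : Measurable ψ) {u : (ℕ → Fin a) → ℝ} (hu : Measurable u) :
    Measurable (transfer A ψ u) := by
  unfold transfer
  refine Finset.measurable_sum _ fun i _ => Measurable.ite ?_ ?_ measurable_const
  · exact (measurable_pi_apply (0 : ℕ) : Measurable fun x : ℕ → Fin a => x 0)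
      (MeasurableSet.of_discrete (s := {j : Fin a | A i j = 1}))
  · exact ((Real.measurable_exp.comp (hψ.comp (measurable_cons i))).mul
      (hu.comp (measurable_cons i)))

lemma measurable_transfer_iter (hψ : Measurable ψ) {u : (ℕ → Fin a) → ℝ} (hu : Measurable u)
    (k : ℕ) : Measurable ((transfer A ψ)^[k] u) := by
  induction k with
  | zero => exact hu
  | succ k ih => rw [Function.iterate_succ_apply']; exact measurable_transfer hψ ih

lemma transfer_iter_const (hN : ∀ x ∈ SFT A, transfer A ψ (fun _ => 1) x = 1) (c : ℝ) (k : ℕ) :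
    ∀ x ∈ SFT A, (transfer A ψ)^[k] (fun _ => c) x = c := by
  induction k with
  | zero => intro x _; rfl
  | succ k ih =>
    intro x hx
    rw [Function.iterate_succ_apply', transfer_congr (v := fun _ => c * 1)
      (fun y hy => by rw [ih y hy, mul_one]) x hx, transfer_smul, hN x hx, mul_one]

namespace IsGibbs

lemma dual_iter_eq [IsProbabilityMeasure μ] (hG : IsGibbs A θ K d c₁ c₂ ψ μ)
    (hN : ∀ x ∈ SFT A, transfer A ψ (fun _ => 1) x = 1) (k : ℕ) : (dual A ψ)^[k] μ = μ :=
  Function.iterate_fixed (hG.dual_eq hN) k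

lemma integral_transfer_iter [IsProbabilityMeasure μ] (hG : IsGibbs A θ K d c₁ c₂ ψ μ)
    (hN : ∀ x ∈ SFT A, transfer A ψ (fun _ => 1) x = 1) {u : (ℕ → Fin a) → ℝ}
    (hu : Measurable u) (hu0 : ∀ x ∈ SFT A, 0 ≤ u x) (k : ℕ) :
    ∫ x, (transfer A ψ)^[k] u x ∂μ = ∫ x, u x ∂μ := by
  rw [integral_eq_lintegral_of_nonneg_ae
      (hG.ae_mem.mono fun x hx => transfer_iter_nonneg hu0 k x hx)
      (measurable_transfer_iter hG.meas hu k).aestronglyMeasurable,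
    integral_eq_lintegral_of_nonneg_ae (hG.ae_mem.mono fun x hx => hu0 x hx)
      hu.aestronglyMeasurable]
  congr 1
  have h := lintegral_dual_iter (A := A) hG.meas (u := fun x => ENNReal.ofReal (u x))
    hu.ennreal_ofReal μ k
  rw [hG.dual_iter_eq hN] at h
  rw [h]
  refine lintegral_congr_ae ?_
  filter_upwards [hG.ae_mem] with x hx
  exact (etransfer_iter_ofReal hu0 (fun _ _ => rfl) k x hx).symm

lemma integrable_of_bound (hG : IsGibbs A θ K d c₁ c₂ ψ μ) [IsFiniteMeasure μ]
    {u : (ℕ → Fin a) → ℝ} (hu : Measurable u) {S : ℝ} (hS : ∀ x ∈ SFT A, |u x| ≤ S) :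
    Integrable u μ :=
  Integrable.of_bound hu.aestronglyMeasurable S (hG.ae_mem.mono fun x hx => hS x hx)

lemma integral_mem_Icc [IsProbabilityMeasure μ] (hG : IsGibbs A θ K d c₁ c₂ ψ μ)
    {u : (ℕ → Fin a) → ℝ} (hu : Measurable u) {s t : ℝ}
    (hS : ∀ x ∈ SFT A, s ≤ u x ∧ u x ≤ t) : s ≤ ∫ x, u x ∂μ ∧ ∫ x, u x ∂μ ≤ t := by
  have hi : Integrable u μ := hG.integrable_of_bound hu (S := |s| + |t|) fun x hx => by
    have := hS x hx
    rw [abs_le]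
    constructor <;> linarith [neg_abs_le s, le_abs_self t, abs_nonneg s, abs_nonneg t]
  constructor
  · simpa using integral_mono_ae (integrable_const s) hi (hG.ae_mem.mono fun x hx => (hS x hx).1)
  · simpa using integral_mono_ae hi (integrable_const t) (hG.ae_mem.mono fun x hx => (hS x hx).2)

end IsGibbs

lemma exp_sub_one_mul_le {b t : ℝ} (hb : 1 ≤ b) (ht : 0 ≤ t) (ht1 : t ≤ 1) :
    (Real.exp (b * t) - 1) * (Real.exp (-1) / b) ≤
      Real.exp (b * t) - Real.exp ((b - 1) * t) := by
  have hb0 : 0 < b := by linarith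
  have h1 : Real.exp (b * t) - 1 ≤ b * t * Real.exp (b * t) := by
    have := Real.add_one_le_exp (-(b * t))
    have h2 : Real.exp (-(b * t)) * Real.exp (b * t) = 1 := by
      rw [← Real.exp_add]; simp
    nlinarith [Real.exp_pos (b * t)]
  have h3 : Real.exp (-1) * t ≤ 1 - Real.exp (-t) := by
    have e1 := Real.add_one_le_exp t
    have e2 : Real.exp (-t) * Real.exp t = 1 := by rw [← Real.exp_add]; simp
    have e3 : Real.exp (-1) ≤ Real.exp (-t) := Real.exp_le_exp.2 (by linarith)
    nlinarith [Real.exp_pos (-t)]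
  have h4 : Real.exp ((b - 1) * t) = Real.exp (b * t) * Real.exp (-t) := by
    rw [← Real.exp_add]; ring_nf
  have h5 : 0 ≤ Real.exp (-1) / b := by positivity
  calc _ ≤ b * t * Real.exp (b * t) * (Real.exp (-1) / b) := by gcongr
    _ = Real.exp (b * t) * (Real.exp (-1) * t) := by field_simp
    _ ≤ Real.exp (b * t) * (1 - Real.exp (-t)) := by gcongr
    _ = _ := by rw [h4]; ring

/-- One application of `transfer^[d]` splits off a constant and contracts the rest of the cone. -/
lemma IsGibbs.exists_contraction (hG : IsGibbs A θ K d c₁ c₂ ψ μ)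
    (hN : ∀ x ∈ SFT A, transfer A ψ (fun _ => 1) x = 1) {b M : ℝ} (hb1 : 1 ≤ b)
    (hb : θ * (b + K) + 1 ≤ b) (hM0 : 0 ≤ M) (hM : ∀ x ∈ SFT A, |ψ x| ≤ M) :
    ∃ δ : ℝ, 0 < δ ∧ δ < 1 ∧ ∀ (v : (ℕ → Fin a) → ℝ) (S : ℝ), Cone A θ b 0 v → 0 ≤ S →
      (∀ x ∈ SFT A, v x ≤ S) → ∃ c : ℝ, ∃ v' : (ℕ → Fin a) → ℝ, Cone A θ b 0 v' ∧
        (∀ x ∈ SFT A, v' x ≤ (1 - δ) * S) ∧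
        ∀ x ∈ SFT A, (transfer A ψ)^[d] v x = c + v' x := by
  have hθ0 := hG.hθ.1
  have hb0 : 0 < b := by linarith
  set Q := Real.exp (b + d * M) with hQ
  have hQ1 : 1 ≤ Q := Real.one_le_exp (by positivity)
  set η := Real.exp (-1) / b with hη
  have hη0 : 0 < η := by positivity
  have hη1 : η ≤ 1 := by
    rw [hη, div_le_one hb0]
    exact (Real.exp_le_one_iff.2 (by norm_num)).trans hb1
  set δ := η / (2 * Q) with hδ
  have hδ2 : δ ≤ 1 / 2 := by rw [hδ, div_le_div_iff₀ (by positivity) (by norm_num)]; nlinarith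
  refine ⟨δ, by positivity, by linarith, fun v S hv hS hvS => ?_⟩
  have hw : Cone A θ (b - 1) 0 ((transfer A ψ)^[d] v) := by
    obtain ⟨e, rfl⟩ : ∃ e, d = e + 1 := ⟨d - 1, by have := hG.hd; omega⟩
    rw [Function.iterate_succ_apply']
    have h1 := Cone.iter hθ0.le hG.lip (by linarith) e hv
    exact (Cone.transfer hG.lip (h1.mono hθ0.le le_rfl (by omega))).mono hθ0.le
      (by linarith) le_rfl
  have hwS : ∀ x ∈ SFT A, (transfer A ψ)^[d] v x ≤ S := fun x hx => by
    have := transfer_iter_mono (ψ := ψ) hvS d x hx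
    rwa [transfer_iter_const hN S d x hx] at this
  by_cases hy : ∃ y ∈ SFT A, S / 2 < v y
  · obtain ⟨y, hy, hvy⟩ := hy
    set m := S / (2 * Q) with hm
    have hm0 : 0 ≤ m := by positivity
    have hwm : ∀ x ∈ SFT A, m ≤ (transfer A ψ)^[d] v x := fun x hx => by
      have := cone_le_transfer_iter hG.hθ hb0.le hM hG.hA01 hG.hAd hv x hx y hy
      rw [hm, div_le_iff₀ (by positivity)]
      linarith
    refine ⟨η * m, fun x => (transfer A ψ)^[d] v x - η * m, ⟨fun x hx => ?_, ?_⟩, fun x hx => ?_,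
      fun x _ => by ring⟩
    · have := hwm x hx
      nlinarith
    · intro x hx y hy r hr1 hr2 hxy
      have h1 := hw.2 x hx y hy r hr1 hr2 hxy
      have h2 := exp_sub_one_mul_le hb1 (pow_nonneg hθ0.le r) (pow_le_one₀ hθ0.le hG.hθ.2.le)
      have h3 := hwm y hy
      have h4 : 0 ≤ Real.exp (b * θ ^ r) - Real.exp ((b - 1) * θ ^ r) :=
        sub_nonneg.2 (Real.exp_le_exp.2 (by nlinarith [pow_nonneg hθ0.le r]))
      nlinarith [mul_le_mul_of_nonneg_left h3 h4, mul_le_mul_of_nonneg_right h2 hm0]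
    · have : (1 - δ) * S = S - η * m := by rw [hδ, hm]; field_simp
      rw [this]
      linarith [hwS x hx]
  · push Not at hy
    refine ⟨0, (transfer A ψ)^[d] v, hw.mono hθ0.le (by linarith) le_rfl, fun x hx => ?_,
      fun x _ => by ring⟩
    have := transfer_iter_mono (ψ := ψ) hy d x hx
    rw [transfer_iter_const hN (S / 2) d x hx] at this
    nlinarith

/-- Iterates of the normalised transfer operator converge uniformly to the mean, at a rate which is
uniform over functions in a cone. -/
lemma IsGibbs.exists_mixing [IsProbabilityMeasure μ] (hG : IsGibbs A θ K d c₁ c₂ ψ μ)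
    (hN : ∀ x ∈ SFT A, transfer A ψ (fun _ => 1) x = 1) {z : ℕ → Fin a} (hz : z ∈ SFT A)
    {b : ℝ} (hb1 : 1 ≤ b) (hb : θ * (b + K) + 1 ≤ b) :
    ∃ (Q : ℝ) (Ψ : ℕ → ℝ), 0 < Q ∧ (∀ l, 0 ≤ Ψ l) ∧ Tendsto Ψ atTop (nhds 0) ∧
      ∀ (m : ℕ) (u : (ℕ → Fin a) → ℝ), Measurable u → Cone A θ b m u →
        (∀ j ≥ m, ∀ x ∈ SFT A, (transfer A ψ)^[j] u x ≤ Q * ∫ y, u y ∂μ) ∧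
        ∀ l, ∀ x ∈ SFT A,
          |(transfer A ψ)^[m + l] u x - ∫ y, u y ∂μ| ≤ Ψ l * ∫ y, u y ∂μ := by
  have hθ0 := hG.hθ.1
  have hM := hG.lip.bounded hz
  have hM0 : 0 ≤ |ψ z| + K := by have := hG.hK; positivity
  obtain ⟨δ, hδ0, hδ1, hstep⟩ := hG.exists_contraction hN hb1 hb hM0 hM
  set Q := Real.exp (b + d * (|ψ z| + K)) with hQ
  have hQ0 : 0 < Q := Real.exp_pos _
  refine ⟨Q, fun l => (1 - δ) ^ (l / d) * Q, hQ0, fun l => ?_, ?_, fun m u hu hcone => ?_⟩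
  · have : 0 ≤ 1 - δ := by linarith
    positivity
  · have h1 : Tendsto (fun l : ℕ => l / d) atTop atTop := by
      refine Filter.tendsto_atTop_atTop.2 fun N => ⟨N * d, fun l hl => ?_⟩
      exact (Nat.le_div_iff_mul_le hG.hd).2 hl
    simpa using ((tendsto_pow_atTop_nhds_zero_of_lt_one (by linarith : 0 ≤ 1 - δ)
      (by linarith)).comp h1).mul_const Q
  · set v := (transfer A ψ)^[m] u with hv
    have hvm : Measurable v := measurable_transfer_iter hG.meas hu m
    have hvc : Cone A θ b 0 v := by
      have := Cone.iter hθ0.le hG.lip (by linarith) m hcone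
      rwa [Nat.sub_self] at this
    have hmean := hG.integral_transfer_iter hN hu hcone.1
    set I := ∫ y, u y ∂μ with hI
    have hvS : ∀ y ∈ SFT A, v y ≤ Q * I := by
      intro y hy
      have h1 : ∀ x ∈ SFT A, v y ≤ Q * (transfer A ψ)^[d] v x := fun x hx =>
        cone_le_transfer_iter hG.hθ (by linarith) hM hG.hA01 hG.hAd hvc x hx y hy
      have hub : ∀ x ∈ SFT A, v x ≤ Q * (transfer A ψ)^[d] v z := fun x hx =>
        cone_le_transfer_iter hG.hθ (by linarith) hM hG.hA01 hG.hAd hvc z hz x hx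
      have h2 := hG.integral_mem_Icc (u := fun x => Q * (transfer A ψ)^[d] v x)
        ((measurable_transfer_iter hG.meas hvm d).const_mul Q) (s := v y)
        (t := Q * (Q * (transfer A ψ)^[d] v z)) fun x hx => ⟨h1 x hx, by
          have := transfer_iter_mono (ψ := ψ) hub d x hx
          rw [transfer_iter_const hN _ d x hx] at this
          gcongr⟩
      rw [integral_const_mul] at h2
      have h3 : ∫ x, (transfer A ψ)^[d] v x ∂μ = I := by
        rw [hv, ← Function.iterate_add_apply]; exact hmean _
      rw [h3] at h2
      exact h2.1
    have hI0 : 0 ≤ I := integral_nonneg_of_ae (hG.ae_mem.mono fun x hx => hcone.1 x hx)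
    have hup : ∀ i, ∀ x ∈ SFT A, (transfer A ψ)^[i] v x ≤ Q * I := fun i x hx => by
      have := transfer_iter_mono (ψ := ψ) hvS i x hx
      rwa [transfer_iter_const hN _ i x hx] at this
    refine ⟨fun j hj x hx => ?_, fun l x hx => ?_⟩
    · have := hup (j - m) x hx
      rwa [hv, ← Function.iterate_add_apply, Nat.sub_add_cancel hj] at this
    · have hiter : ∀ k, ∃ c : ℝ, ∃ v' : (ℕ → Fin a) → ℝ, Cone A θ b 0 v' ∧
          (∀ x ∈ SFT A, v' x ≤ (1 - δ) ^ k * (Q * I)) ∧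
          ∀ x ∈ SFT A, (transfer A ψ)^[d * k] v x = c + v' x := by
        intro k
        induction k with
        | zero => exact ⟨0, v, hvc, by simpa using hvS, by simp⟩
        | succ k ih =>
          obtain ⟨c, v', h1, h2, h3⟩ := ih
          have hS : 0 ≤ (1 - δ) ^ k * (Q * I) := by
            have : 0 ≤ 1 - δ := by linarith
            positivity
          obtain ⟨c', v'', h4, h5, h6⟩ := hstep v' _ h1 hS h2
          refine ⟨c + c', v'', h4, fun x hx => (h5 x hx).trans_eq (by ring), fun x hx => ?_⟩
          rw [show d * (k + 1) = d + d * k by ring, Function.iterate_add_apply,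
            transfer_iter_congr h3 d x hx, transfer_iter_add (fun _ => c) v' d]
          simp only [transfer_iter_const hN c d x hx, h6 x hx]
          ring
      obtain ⟨c, v', h1, h2, h3⟩ := hiter (l / d)
      have hl : l = (l - d * (l / d)) + d * (l / d) := by
        have := Nat.mul_div_le l d; omega
      have hb : ∀ x ∈ SFT A, c ≤ (transfer A ψ)^[l] v x ∧
          (transfer A ψ)^[l] v x ≤ c + (1 - δ) ^ (l / d) * (Q * I) := by
        intro x hx
        rw [hl, Function.iterate_add_apply, ← hl]
        have e1 := transfer_iter_mono (ψ := ψ) (u := fun _ => c)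
          (v := (transfer A ψ)^[d * (l / d)] v)
          (fun y hy => by rw [h3 y hy]; linarith [h1.1 y hy]) (l - d * (l / d)) x hx
        have e2 := transfer_iter_mono (ψ := ψ) (v := fun _ => c + (1 - δ) ^ (l / d) * (Q * I))
          (u := (transfer A ψ)^[d * (l / d)] v)
          (fun y hy => by rw [h3 y hy]; linarith [h2 y hy]) (l - d * (l / d)) x hx
        rw [transfer_iter_const hN _ _ x hx] at e1 e2
        exact ⟨e1, e2⟩
      have h4 := hG.integral_mem_Icc (measurable_transfer_iter hG.meas hvm l) hb
      have h5 : ∫ x, (transfer A ψ)^[l] v x ∂μ = I := by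
        rw [hv, ← Function.iterate_add_apply]; exact hmean _
      rw [h5] at h4
      have h6 := hb x hx
      rw [add_comm m l, Function.iterate_add_apply, ← hv, mul_assoc, abs_le]
      constructor <;> linarith

/-- The measure of `V ∩ σ⁻ʲ B` through the transfer operator. -/
lemma IsGibbs.measure_inter_preimage [IsProbabilityMeasure μ] (hG : IsGibbs A θ K d c₁ c₂ ψ μ)
    (hN : ∀ x ∈ SFT A, transfer A ψ (fun _ => 1) x = 1) {V B : Set (ℕ → Fin a)}
    (hV : MeasurableSet V) (hB : MeasurableSet B) (j : ℕ) :
    μ (V ∩ (shiftMap a)^[j] ⁻¹' B) =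
      ∫⁻ x in B, ENNReal.ofReal ((transfer A ψ)^[j] (V.indicator fun _ => 1) x) ∂μ := by
  have h1 : (V ∩ (shiftMap a)^[j] ⁻¹' B).indicator (1 : (ℕ → Fin a) → ℝ≥0∞) =
      fun x => V.indicator 1 x * B.indicator 1 ((shiftMap a)^[j] x) := by
    funext x
    by_cases hx : x ∈ V <;> by_cases hy : (shiftMap a)^[j] x ∈ B <;> simp [hx, hy]
  have hVm : Measurable (V.indicator (1 : (ℕ → Fin a) → ℝ≥0∞)) := measurable_one.indicator hV
  have hBm : Measurable (B.indicator (1 : (ℕ → Fin a) → ℝ≥0∞)) := measurable_one.indicator hB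
  rw [← lintegral_indicator_one (hV.inter (measurable_shift_iter j hB)), h1]
  have h2 := lintegral_dual_iter (A := A) hG.meas
    (hVm.mul (hBm.comp (measurable_shift_iter j))) μ j
  rw [hG.dual_iter_eq hN] at h2
  refine Eq.trans h2 ?_
  rw [← lintegral_indicator hB]
  refine lintegral_congr_ae ?_
  filter_upwards [hG.ae_mem] with x hx
  refine (etransfer_iter_mul_comp (V.indicator 1) (B.indicator 1) j x).trans ?_
  rw [etransfer_iter_ofReal (u := V.indicator fun _ => 1)
    (fun y _ => Set.indicator_nonneg (fun _ _ => zero_le_one) y)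
    (fun y _ => by by_cases hy : y ∈ V <;> simp [hy]) j x hx]
  by_cases hxB : x ∈ B <;> simp [hxB]

lemma IsGibbs.measure_inter_preimage_le [IsProbabilityMeasure μ]
    (hG : IsGibbs A θ K d c₁ c₂ ψ μ)
    (hN : ∀ x ∈ SFT A, transfer A ψ (fun _ => 1) x = 1) {V B : Set (ℕ → Fin a)}
    (hV : MeasurableSet V) (hB : MeasurableSet B) (j : ℕ) {t : ℝ} (ht : 0 ≤ t)
    (h : ∀ x ∈ SFT A, x ∈ B → (transfer A ψ)^[j] (V.indicator fun _ => 1) x ≤ t) :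
    μ.real (V ∩ (shiftMap a)^[j] ⁻¹' B) ≤ t * μ.real B := by
  have h1 : μ (V ∩ (shiftMap a)^[j] ⁻¹' B) ≤ ENNReal.ofReal t * μ B := by
    rw [hG.measure_inter_preimage hN hV hB, ← setLIntegral_const]
    refine lintegral_mono_ae ?_
    filter_upwards [ae_restrict_mem hB, ae_restrict_of_ae hG.ae_mem] with x hx hxX
    exact ENNReal.ofReal_le_ofReal (h x hxX hx)
  have h2 := ENNReal.toReal_mono (ENNReal.mul_ne_top ENNReal.ofReal_ne_top (measure_ne_top μ B)) h1
  rwa [ENNReal.toReal_mul, ENNReal.toReal_ofReal ht] at h2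

lemma IsGibbs.le_measure_inter_preimage [IsProbabilityMeasure μ]
    (hG : IsGibbs A θ K d c₁ c₂ ψ μ)
    (hN : ∀ x ∈ SFT A, transfer A ψ (fun _ => 1) x = 1) {V B : Set (ℕ → Fin a)}
    (hV : MeasurableSet V) (hB : MeasurableSet B) (j : ℕ) {t : ℝ}
    (h : ∀ x ∈ SFT A, x ∈ B → t ≤ (transfer A ψ)^[j] (V.indicator fun _ => 1) x) :
    t * μ.real B ≤ μ.real (V ∩ (shiftMap a)^[j] ⁻¹' B) := by
  rcases le_total t 0 with ht | ht
  · exact (mul_nonpos_of_nonpos_of_nonneg ht measureReal_nonneg).trans measureReal_nonneg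
  have h1 : ENNReal.ofReal t * μ B ≤ μ (V ∩ (shiftMap a)^[j] ⁻¹' B) := by
    rw [hG.measure_inter_preimage hN hV hB, ← setLIntegral_const]
    refine lintegral_mono_ae ?_
    filter_upwards [ae_restrict_mem hB, ae_restrict_of_ae hG.ae_mem] with x hx hxX
    exact ENNReal.ofReal_le_ofReal (h x hxX hx)
  have h2 := ENNReal.toReal_mono (measure_ne_top μ _) h1
  rwa [ENNReal.toReal_mul, ENNReal.toReal_ofReal ht] at h2

/-- A set is determined, inside the subshift, by the first `m` coordinates. -/
def DependsOn (A : Matrix (Fin a) (Fin a) ℕ) (m : ℕ) (V : Set (ℕ → Fin a)) : Prop :=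
  ∀ x ∈ SFT A, ∀ y ∈ SFT A, (∀ i < m, x i = y i) → x ∈ V → y ∈ V

lemma DependsOn.cone {m : ℕ} {V : Set (ℕ → Fin a)} (hV : DependsOn A m V) {b : ℝ}
    (hθ : 0 ≤ θ) (hb : 0 ≤ b) : Cone A θ b m (V.indicator fun _ => 1) := by
  refine ⟨fun x _ => Set.indicator_nonneg (fun _ _ => zero_le_one) x, ?_⟩
  intro x hx y hy r _ hm hxy
  have h1 : 1 ≤ Real.exp (b * θ ^ r) := Real.one_le_exp (by positivity)
  by_cases hxV : x ∈ V
  · have := hV x hx y hy (fun i hi => hxy i (by omega)) hxV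
    simpa [hxV, this] using h1
  · rw [Set.indicator_of_notMem hxV]
    exact mul_nonneg (Real.exp_pos _).le (Set.indicator_nonneg (fun _ _ => zero_le_one) y)

/-- Uniform mixing of sets depending on finitely many coordinates with arbitrary sets. -/
lemma IsGibbs.exists_mixing_sets [IsProbabilityMeasure μ] (hG : IsGibbs A θ K d c₁ c₂ ψ μ)
    (hN : ∀ x ∈ SFT A, transfer A ψ (fun _ => 1) x = 1) {z : ℕ → Fin a} (hz : z ∈ SFT A) :
    ∃ (Q : ℝ) (Ψ : ℕ → ℝ), 0 < Q ∧ (∀ l, 0 ≤ Ψ l) ∧ Tendsto Ψ atTop (nhds 0) ∧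
      ∀ (m : ℕ) (V B : Set (ℕ → Fin a)), MeasurableSet V → DependsOn A m V → MeasurableSet B →
        (∀ j ≥ m, μ.real (V ∩ (shiftMap a)^[j] ⁻¹' B) ≤ Q * μ.real V * μ.real B) ∧
        ∀ l, (1 - Ψ l) * μ.real V * μ.real B ≤ μ.real (V ∩ (shiftMap a)^[m + l] ⁻¹' B) ∧
          μ.real (V ∩ (shiftMap a)^[m + l] ⁻¹' B) ≤ (1 + Ψ l) * μ.real V * μ.real B := by
  have h1θ : 0 < 1 - θ := by linarith [hG.hθ.2]
  have hθ0 := hG.hθ.1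
  set b := (1 + θ * K) / (1 - θ) with hbdef
  have hK := hG.hK
  have hb1 : 1 ≤ b := by
    rw [hbdef, le_div_iff₀ h1θ]
    have : 0 ≤ θ * K := by positivity
    linarith
  have hb : θ * (b + K) + 1 ≤ b := by rw [hbdef]; apply le_of_eq; field_simp; ring
  obtain ⟨Q, Ψ, hQ, hΨ, hΨ0, hmix⟩ := hG.exists_mixing hN hz hb1 hb
  refine ⟨Q, Ψ, hQ, hΨ, hΨ0, fun m V B hV hVm hB => ?_⟩
  obtain ⟨h1, h2⟩ := hmix m (V.indicator fun _ => 1) (measurable_const.indicator hV)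
    (hVm.cone hθ0.le (by linarith))
  have hI : ∫ y, V.indicator (fun _ => (1 : ℝ)) y ∂μ = μ.real V := by
    rw [integral_indicator hV]; simp
  rw [hI] at h1 h2
  have hV0 : 0 ≤ μ.real V := measureReal_nonneg
  refine ⟨fun j hj => hG.measure_inter_preimage_le hN hV hB j (by positivity)
    fun x hx _ => h1 j hj x hx, fun l => ⟨?_, ?_⟩⟩
  · refine hG.le_measure_inter_preimage hN hV hB _ fun x hx _ => ?_
    linarith [(abs_le.1 (h2 l x hx)).1]
  · refine hG.measure_inter_preimage_le hN hV hB _ ?_ fun x hx _ => ?_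
    · have := hΨ l; positivity
    · linarith [(abs_le.1 (h2 l x hx)).2]

end normalised

/-- Points whose orbit avoids `U` at times `1, …, k`. -/
def surv (U : Set (ℕ → Fin a)) (k : ℕ) : Set (ℕ → Fin a) :=
  {x | ∀ j, 1 ≤ j → j ≤ k → (shiftMap a)^[j] x ∉ U}

section surv
variable {U : Set (ℕ → Fin a)}

lemma surv_zero : surv U 0 = univ := by
  refine eq_univ_of_forall fun x j h1 h2 => ?_
  omega

lemma surv_anti {j k : ℕ} (h : j ≤ k) : surv U k ⊆ surv U j :=
  fun _ hx i h1 h2 => hx i h1 (h2.trans h)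

lemma surv_succ (k : ℕ) : surv U (k + 1) = shiftMap a ⁻¹' (surv U k \ U) := by
  ext x
  constructor
  · intro hx
    refine ⟨fun j h1 h2 => ?_, ?_⟩
    · rw [← Function.iterate_succ_apply]; exact hx (j + 1) (by omega) (by omega)
    · exact hx 1 le_rfl (by omega)
  · rintro ⟨h1, h2⟩ j hj1 hj2
    obtain ⟨i, rfl⟩ : ∃ i, j = i + 1 := ⟨j - 1, by omega⟩
    rw [Function.iterate_succ_apply]
    rcases Nat.eq_zero_or_pos i with rfl | hi
    · exact h2
    · exact h1 i hi (by omega)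

lemma surv_subset_preimage (q k : ℕ) : surv U k ⊆ (shiftMap a)^[q] ⁻¹' surv U (k - q) := by
  intro x hx j h1 h2
  rw [← Function.iterate_add_apply]
  exact hx _ (by omega) (by omega)

lemma measurableSet_surv (hU : MeasurableSet U) (k : ℕ) : MeasurableSet (surv U k) := by
  induction k with
  | zero => rw [surv_zero]; exact MeasurableSet.univ
  | succ k ih => rw [surv_succ]; exact measurable_shift (ih.diff hU)

variable {μ : Measure (ℕ → Fin a)} [IsProbabilityMeasure μ]

lemma measure_surv_succ (hinv : MeasurePreserving (shiftMap a) μ μ) (hU : MeasurableSet U)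
    (k : ℕ) : μ.real (surv U (k + 1)) = μ.real (surv U k) - μ.real (U ∩ surv U k) := by
  have h1 : μ.real (surv U (k + 1)) = μ.real (surv U k \ U) := by
    rw [surv_succ, measureReal_def, measureReal_def,
      hinv.measure_preimage ((measurableSet_surv hU k).diff hU).nullMeasurableSet]
  have h2 := measureReal_inter_add_sdiff (μ := μ) (s := surv U k) hU
  rw [h1, inter_comm]; linarith

lemma one_sub_mul_le_measure_surv (hinv : MeasurePreserving (shiftMap a) μ μ)
    (hU : MeasurableSet U) (k : ℕ) : 1 - k * μ.real U ≤ μ.real (surv U k) := by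
  induction k with
  | zero => simp [surv_zero]
  | succ k ih =>
    rw [measure_surv_succ hinv hU]
    have : μ.real (U ∩ surv U k) ≤ μ.real U := measureReal_mono inter_subset_left
    push_cast; linarith

/-- Mixing hypotheses relating a target `U`, the part `U'` of it which does not return immediately,
and a mixing time `q`. -/
structure GoodTarget (μ : Measure (ℕ → Fin a)) (U U' : Set (ℕ → Fin a)) (q : ℕ) (τ : ℝ) :
    Prop where
  meas : MeasurableSet U
  meas' : MeasurableSet U'
  subset : U' ⊆ U
  inter_surv : ∀ k ≥ q, U ∩ surv U k ⊆ U'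
  hτ : 0 ≤ τ
  hτ1 : τ ≤ 1
  hε : 8 * q * μ.real U ≤ 1 / 2
  lower : ∀ B, MeasurableSet B →
    (1 - τ) * μ.real U' * μ.real B ≤ μ.real (U' ∩ (shiftMap a)^[q] ⁻¹' B)
  upper : ∀ B, MeasurableSet B →
    μ.real (U' ∩ (shiftMap a)^[q] ⁻¹' B) ≤ (1 + τ) * μ.real U' * μ.real B
  upper_return : ∀ j, 1 ≤ j → j ≤ q → ∀ B, MeasurableSet B →
    μ.real ((U' ∩ (shiftMap a)^[j] ⁻¹' U) ∩ (shiftMap a)^[2 * q] ⁻¹' B) ≤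
      (1 + τ) * μ.real (U' ∩ (shiftMap a)^[j] ⁻¹' U) * μ.real B

namespace GoodTarget
variable {U' : Set (ℕ → Fin a)} {q : ℕ} {τ : ℝ}

lemma upper_hit (h : GoodTarget μ U U' q τ) {k : ℕ} (hk : q ≤ k) :
    μ.real (U ∩ surv U k) ≤ (1 + τ) * μ.real U' * μ.real (surv U (k - q)) := by
  refine le_trans (measureReal_mono ?_) (h.upper _ (measurableSet_surv h.meas (k - q)))
  exact fun x hx => ⟨h.inter_surv k hk hx, surv_subset_preimage q k hx.2⟩

lemma lower_hit (h : GoodTarget μ U U' q τ) {k : ℕ} (hk : 2 * q ≤ k) :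
    (1 - τ) * μ.real U' * μ.real (surv U (k - q)) -
      (1 + τ) * (∑ j ∈ Finset.Icc 1 q, μ.real (U' ∩ (shiftMap a)^[j] ⁻¹' U)) *
        μ.real (surv U (k - 2 * q)) ≤ μ.real (U ∩ surv U k) := by
  have hsub : U' ∩ (shiftMap a)^[q] ⁻¹' surv U (k - q) ⊆ (U ∩ surv U k) ∪
      ⋃ j ∈ Finset.Icc 1 q, ((U' ∩ (shiftMap a)^[j] ⁻¹' U) ∩
        (shiftMap a)^[2 * q] ⁻¹' surv U (k - 2 * q)) := by
    rintro x ⟨hx1, hx2⟩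
    have hlate : ∀ j, q < j → j ≤ k → (shiftMap a)^[j] x ∉ U := by
      intro j h1 h2
      have := hx2 (j - q) (by omega) (by omega)
      rwa [← Function.iterate_add_apply, Nat.sub_add_cancel h1.le] at this
    by_cases hs : x ∈ surv U k
    · exact Or.inl ⟨h.subset hx1, hs⟩
    · right
      simp only [surv, mem_ofPred_eq, not_forall, not_not] at hs
      obtain ⟨j, h1, h2, h3⟩ := hs
      have hjq : j ≤ q := by
        by_contra hlt
        exact hlate j (by omega) h2 h3
      simp only [mem_iUnion]
      refine ⟨j, Finset.mem_Icc.2 ⟨h1, hjq⟩, ⟨hx1, h3⟩, fun i hi1 hi2 => ?_⟩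
      rw [← Function.iterate_add_apply]
      exact hlate _ (by omega) (by omega)
  have h1 := h.lower _ (measurableSet_surv h.meas (k - q))
  have h2 : μ.real (U' ∩ (shiftMap a)^[q] ⁻¹' surv U (k - q)) ≤ μ.real (U ∩ surv U k) +
      ∑ j ∈ Finset.Icc 1 q, μ.real ((U' ∩ (shiftMap a)^[j] ⁻¹' U) ∩
        (shiftMap a)^[2 * q] ⁻¹' surv U (k - 2 * q)) :=
    (measureReal_mono hsub).trans ((measureReal_union_le _ _).trans
      (by gcongr; exact measureReal_biUnion_finset_le _ _))
  have h3 : ∑ j ∈ Finset.Icc 1 q, μ.real ((U' ∩ (shiftMap a)^[j] ⁻¹' U) ∩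
        (shiftMap a)^[2 * q] ⁻¹' surv U (k - 2 * q)) ≤
      (1 + τ) * (∑ j ∈ Finset.Icc 1 q, μ.real (U' ∩ (shiftMap a)^[j] ⁻¹' U)) *
        μ.real (surv U (k - 2 * q)) := by
    rw [Finset.mul_sum, Finset.sum_mul]
    refine Finset.sum_le_sum fun j hj => ?_
    rw [Finset.mem_Icc] at hj
    exact h.upper_return j hj.1 hj.2 _ (measurableSet_surv h.meas _)
  linarith

lemma one_sub_mul_le_surv_add {ν : Measure (ℕ → Fin a)} {ε : ℝ} (hε : 4 * ε ≤ 1)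
    {k0 : ℕ} :
    ∀ i, (∀ k, k0 ≤ k → k < k0 + i → (1 - 4 * ε) * ν.real (surv U k) ≤ ν.real (surv U (k + 1))) →
    (1 - 4 * ε * i) * ν.real (surv U k0) ≤ ν.real (surv U (k0 + i)) := by
  intro i hi
  have h1 : (1 - 4 * ε) ^ i * ν.real (surv U k0) ≤ ν.real (surv U (k0 + i)) := by
    induction i with
    | zero => simp
    | succ i ih =>
      have := ih fun k h1 h2 => hi k h1 (by omega)
      refine le_trans ?_ (hi (k0 + i) (by omega) (by omega))
      rw [pow_succ', mul_assoc]
      exact mul_le_mul_of_nonneg_left this (by linarith)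
  have h2 := one_add_mul_le_pow (a := -(4 * ε)) (by linarith) i
  refine le_trans (mul_le_mul_of_nonneg_right ?_ measureReal_nonneg) h1
  calc _ = 1 + i * -(4 * ε) := by ring
    _ ≤ _ := h2
    _ = _ := by ring

lemma surv_ratio (h : GoodTarget μ U U' q τ) (hinv : MeasurePreserving (shiftMap a) μ μ)
    (hq : 1 ≤ q) (k : ℕ) :
    (1 - 4 * μ.real U) * μ.real (surv U k) ≤ μ.real (surv U (k + 1)) := by
  have hε0 : 0 ≤ μ.real U := measureReal_nonneg
  have hε := h.hε
  have hq' : (1 : ℝ) ≤ q := by exact_mod_cast hq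
  have hε4 : 4 * μ.real U ≤ 1 := by nlinarith
  induction k using Nat.strong_induction_on with
  | _ k ih =>
    rw [measure_surv_succ hinv h.meas]
    suffices μ.real (U ∩ surv U k) ≤ 4 * μ.real U * μ.real (surv U k) by linarith
    rcases lt_or_ge k q with hk | hk
    · have h1 := one_sub_mul_le_measure_surv hinv h.meas k
      have h2 : (k : ℝ) * μ.real U ≤ q * μ.real U := by gcongr
      have h3 : μ.real (U ∩ surv U k) ≤ μ.real U := measureReal_mono inter_subset_left
      nlinarith
    · have h1 := one_sub_mul_le_surv_add (ν := μ) (U := U) hε4 (k0 := k - q) q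
        fun j _ h2 => ih j (by omega)
      rw [Nat.sub_add_cancel hk] at h1
      have h2 := h.upper_hit hk
      have h3 : μ.real U' ≤ μ.real U := measureReal_mono h.subset
      have h4 : 0 ≤ μ.real (surv U (k - q)) := measureReal_nonneg
      have h5 : 1 / 2 * μ.real (surv U (k - q)) ≤ μ.real (surv U k) :=
        le_trans (mul_le_mul_of_nonneg_right (by linarith) h4) h1
      have h6 : (1 + τ) * μ.real U' * μ.real (surv U (k - q)) ≤
          2 * μ.real U * μ.real (surv U (k - q)) := by
        have := h.hτ1; have := h.hτ
        gcongr; linarith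
      nlinarith

/-- Two-sided bounds for the conditional hitting probability. -/
lemma hit_bounds (h : GoodTarget μ U U' q τ) (hinv : MeasurePreserving (shiftMap a) μ μ)
    (hq : 1 ≤ q) {k : ℕ} (hk : 2 * q ≤ k) :
    μ.real (U ∩ surv U k) ≤
      (1 + τ) / (1 - 4 * q * μ.real U) * μ.real U' * μ.real (surv U k) ∧
    ((1 - τ) * μ.real U' - 4 * ∑ j ∈ Finset.Icc 1 q, μ.real (U' ∩ (shiftMap a)^[j] ⁻¹' U)) *
      μ.real (surv U k) ≤ μ.real (U ∩ surv U k) := by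
  have hε0 : 0 ≤ μ.real U := measureReal_nonneg
  have hε := h.hε
  have hτ := h.hτ
  have hτ1 := h.hτ1
  have hq' : (1 : ℝ) ≤ q := by exact_mod_cast hq
  have hε4 : 4 * μ.real U ≤ 1 := by nlinarith
  have h1 := one_sub_mul_le_surv_add (ν := μ) (U := U) hε4 (k0 := k - q) q
    fun j _ h2 => h.surv_ratio hinv hq j
  have h2 := one_sub_mul_le_surv_add (ν := μ) (U := U) hε4 (k0 := k - 2 * q) (2 * q)
    fun j _ h2 => h.surv_ratio hinv hq j
  rw [Nat.sub_add_cancel (by omega)] at h1 h2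
  push_cast at h2
  have hU' : 0 ≤ μ.real U' := measureReal_nonneg
  have hs1 : 0 ≤ μ.real (surv U (k - q)) := measureReal_nonneg
  have hs2 : 0 ≤ μ.real (surv U (k - 2 * q)) := measureReal_nonneg
  constructor
  · refine (h.upper_hit (by omega)).trans ?_
    have hpos : 0 < 1 - 4 * q * μ.real U := by linarith
    have h3 : μ.real (surv U (k - q)) ≤ μ.real (surv U k) / (1 - 4 * q * μ.real U) := by
      rw [le_div_iff₀ hpos]; linarith
    calc _ ≤ (1 + τ) * μ.real U' * (μ.real (surv U k) / (1 - 4 * q * μ.real U)) := by gcongr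
      _ = _ := by ring
  · refine le_trans ?_ (h.lower_hit hk)
    set Z := ∑ j ∈ Finset.Icc 1 q, μ.real (U' ∩ (shiftMap a)^[j] ⁻¹' U)
    have hZ : 0 ≤ Z := Finset.sum_nonneg fun _ _ => measureReal_nonneg
    have h3 : μ.real (surv U (k - 2 * q)) ≤ 2 * μ.real (surv U k) := by
      have : 1 / 2 * μ.real (surv U (k - 2 * q)) ≤ μ.real (surv U k) :=
        le_trans (mul_le_mul_of_nonneg_right (by linarith) hs2) h2
      linarith
    have h4 : μ.real (surv U k) ≤ μ.real (surv U (k - q)) :=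
      measureReal_mono (surv_anti (by omega))
    have h5 : (1 - τ) * μ.real U' * μ.real (surv U k) ≤
        (1 - τ) * μ.real U' * μ.real (surv U (k - q)) := by
      have : 0 ≤ 1 - τ := by linarith
      gcongr
    have h6 : (1 + τ) * Z * μ.real (surv U (k - 2 * q)) ≤ 2 * Z * (2 * μ.real (surv U k)) := by
      gcongr; linarith
    linarith

lemma surv_pos (h : GoodTarget μ U U' q τ) (hinv : MeasurePreserving (shiftMap a) μ μ)
    (hq : 1 ≤ q) (k : ℕ) : 0 < μ.real (surv U k) := by
  have hε0 : 0 ≤ μ.real U := measureReal_nonneg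
  have hε := h.hε
  have hq' : (1 : ℝ) ≤ q := by exact_mod_cast hq
  induction k with
  | zero => simp [surv_zero]
  | succ k ih =>
    refine lt_of_lt_of_le (mul_pos ?_ ih) (h.surv_ratio hinv hq k)
    nlinarith

end GoodTarget

/-- Exponential bounds for survival probabilities from bounds on the conditional hitting
probability. -/
lemma exists_surv_exp_bounds (hinv : MeasurePreserving (shiftMap a) μ μ) (hU : MeasurableSet U)
    {k₀ : ℕ} (hpos : 0 < μ.real (surv U k₀)) {s t : ℝ} (ht0 : 0 ≤ t) (ht1 : t < 1)
    (hs : ∀ k ≥ k₀, s * μ.real (surv U k) ≤ μ.real (U ∩ surv U k))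
    (ht : ∀ k ≥ k₀, μ.real (U ∩ surv U k) ≤ t * μ.real (surv U k)) :
    ∃ c C : ℝ, 0 < c ∧ 0 < C ∧ ∀ k : ℕ, c * Real.exp (-(t / (1 - t) * k)) ≤ μ.real (surv U k) ∧
      μ.real (surv U k) ≤ C * Real.exp (-(s * k)) := by
  have hlow : ∀ i : ℕ, μ.real (surv U k₀) * (1 - t) ^ i ≤ μ.real (surv U (k₀ + i)) := by
    intro i
    induction i with
    | zero => simp
    | succ i ih =>
      rw [← add_assoc, measure_surv_succ hinv hU, pow_succ]
      have h1 := ht (k₀ + i) (by omega)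
      have h2 := mul_le_mul_of_nonneg_right ih (by linarith : 0 ≤ 1 - t)
      linarith
  have hup : ∀ i : ℕ, μ.real (surv U (k₀ + i)) ≤ Real.exp (-(s * i)) := by
    intro i
    induction i with
    | zero => simp
    | succ i ih =>
      rw [← add_assoc, measure_surv_succ hinv hU]
      have h1 := hs (k₀ + i) (by omega)
      have h2 := Real.add_one_le_exp (-s)
      have h3 : Real.exp (-(s * ((i + 1 : ℕ) : ℝ))) = Real.exp (-s) * Real.exp (-(s * i)) := by
        rw [← Real.exp_add]; push_cast; ring_nf
      rw [h3]
      have h4 : 0 ≤ μ.real (surv U (k₀ + i)) := measureReal_nonneg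
      calc _ ≤ (-s + 1) * μ.real (surv U (k₀ + i)) := by linarith
        _ ≤ Real.exp (-s) * μ.real (surv U (k₀ + i)) := by gcongr
        _ ≤ _ := by gcongr
  refine ⟨μ.real (surv U k₀), Real.exp (|s| * k₀), hpos, Real.exp_pos _, fun k => ⟨?_, ?_⟩⟩
  · have h1t : 0 < 1 - t := by linarith
    have h1 : Real.exp (-(t / (1 - t) * k)) ≤ (1 - t) ^ k := by
      have := Real.one_sub_inv_le_log_of_pos h1t
      have h2 : -(t / (1 - t)) ≤ Real.log (1 - t) := by
        refine le_trans (le_of_eq ?_) this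
        field_simp; ring
      calc Real.exp (-(t / (1 - t) * k)) ≤ Real.exp (k * Real.log (1 - t)) := by
            apply Real.exp_le_exp.2
            have := mul_le_mul_of_nonneg_left h2 (Nat.cast_nonneg (α := ℝ) k)
            linarith
        _ = _ := by rw [Real.exp_nat_mul, Real.exp_log h1t]
    have h2 : μ.real (surv U k₀) * (1 - t) ^ k ≤ μ.real (surv U k) := by
      rcases le_total k₀ k with hk | hk
      · obtain ⟨i, rfl⟩ := Nat.exists_eq_add_of_le hk
        refine le_trans ?_ (hlow i)
        gcongr ?_ * ?_
        exact pow_le_pow_of_le_one h1t.le (by linarith) (by omega)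
      · refine le_trans (mul_le_of_le_one_right hpos.le (pow_le_one₀ h1t.le (by linarith))) ?_
        exact measureReal_mono (surv_anti hk)
    exact le_trans (by gcongr) h2
  · rw [← Real.exp_add]
    rcases le_total k₀ k with hk | hk
    · obtain ⟨i, rfl⟩ := Nat.exists_eq_add_of_le hk
      refine (hup i).trans (Real.exp_le_exp.2 ?_)
      have := mul_le_mul_of_nonneg_right (le_abs_self s) (Nat.cast_nonneg (α := ℝ) k₀)
      push_cast; linarith
    · refine measureReal_le_one.trans (Real.one_le_exp ?_)
      have h1 : s * k ≤ |s| * k := by gcongr; exact le_abs_self s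
      have h2 : |s| * k ≤ |s| * k₀ := by gcongr
      linarith

end surv

section nested
variable {A : Matrix (Fin a) (Fin a) ℕ} {θ K c₁ c₂ : ℝ} {d : ℕ} {ψ : (ℕ → Fin a) → ℝ}
  {μ : Measure (ℕ → Fin a)} {I : ℕ → Set (ℕ → Fin a)} {z : ℕ → Fin a}

lemma nested_subset_SFT (hI : NestedCondition A μ I z) {n : ℕ} (hn : 1 ≤ n) : I n ⊆ SFT A := by
  obtain ⟨S, -, hS⟩ := hI.1 n hn
  rw [hS]
  exact iUnion₂_subset fun x _ => inter_subset_left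

lemma nested_measurableSet (hI : NestedCondition A μ I z) {n : ℕ} (hn : 1 ≤ n) :
    MeasurableSet (I n) := by
  obtain ⟨S, -, hS⟩ := hI.1 n hn
  rw [hS]
  exact S.measurableSet_biUnion fun x _ => (measurableSet_SFT A).inter (measurableSet_cyl x n)

lemma nested_dependsOn (hI : NestedCondition A μ I z) {n : ℕ} (hn : 1 ≤ n) :
    DependsOn A n (I n) := by
  obtain ⟨S, -, hS⟩ := hI.1 n hn
  rw [hS]
  intro x hx y hy hxy hxI
  simp only [mem_iUnion] at hxI ⊢
  obtain ⟨w, hw, -, hxw⟩ := hxI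
  exact ⟨w, hw, hy, fun i hi => by rw [← hxy i hi]; exact hxw i hi⟩

lemma nested_mem (hI : NestedCondition A μ I z) {n : ℕ} (hn : 1 ≤ n) : z ∈ I n := by
  have h : z ∈ ⋂ n ∈ Set.Ici 1, I n := by rw [hI.2.2.1]; rfl
  exact mem_iInter₂.1 h n hn

lemma nested_cyl_subset (hI : NestedCondition A μ I z) {n : ℕ} (hn : 1 ≤ n) :
    SFT A ∩ cyl z n ⊆ I n := fun x hx =>
  nested_dependsOn hI hn z (nested_subset_SFT hI hn (nested_mem hI hn)) x hx.1
    (fun i hi => (hx.2 i hi).symm) (nested_mem hI hn)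

lemma IsGibbs.measure_inter_SFT (hG : IsGibbs A θ K d c₁ c₂ ψ μ) (B : Set (ℕ → Fin a)) :
    μ (SFT A ∩ B) = μ B := by
  refine measure_congr ?_
  filter_upwards [hG.ae_mem] with x hx
  exact propext ⟨fun h => h.2, fun h => ⟨hx, h⟩⟩

lemma IsGibbs.nested_pos [IsProbabilityMeasure μ] (hG : IsGibbs A θ K d c₁ c₂ ψ μ)
    (hz : z ∈ SFT A) (hI : NestedCondition A μ I z) {n : ℕ} (hn : 1 ≤ n) : 0 < μ.real (I n) := by
  have h1 := hG.lower z hz n hn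
  have h2 : μ (cyl z n) ≤ μ (I n) := by
    rw [← hG.measure_inter_SFT]; exact measure_mono (nested_cyl_subset hI hn)
  have h3 : 0 < μ (I n) :=
    lt_of_lt_of_le (ENNReal.ofReal_pos.2 (mul_pos hG.hc₁ (Real.exp_pos _))) (h1.trans h2)
  exact ENNReal.toReal_pos h3.ne' (measure_ne_top _ _)

/-- The part `U' n` of `I n` which does not return at the period `p` of the centre, together with
the asymptotic proportion `γ` of `I n` it occupies. -/
structure ReducedTarget (A : Matrix (Fin a) (Fin a) ℕ) (μ : Measure (ℕ → Fin a))
    (I : ℕ → Set (ℕ → Fin a)) (p : ℕ) (U' : ℕ → Set (ℕ → Fin a)) (γ : ℝ) : Prop where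
  subset : ∀ n, U' n ⊆ I n
  meas : ∀ n, 1 ≤ n → MeasurableSet (U' n)
  dep : ∀ n, 1 ≤ n → DependsOn A (n + p) (U' n)
  inter_surv : ∀ n, 1 ≤ n → ∀ k ≥ p, I n ∩ surv (I n) k ⊆ U' n
  no_return : ∀ j, 1 ≤ j → ∀ᶠ n in atTop, U' n ∩ (shiftMap a)^[j] ⁻¹' I n = ∅
  ratio : Tendsto (fun n => μ.real (U' n) / μ.real (I n)) atTop (nhds γ)

lemma nested_bound [IsProbabilityMeasure μ] (hI : NestedCondition A μ I z) : ∃ c ρ : ℝ, 0 < c ∧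
    0 < ρ ∧ ρ < 1 ∧ ∀ n, 1 ≤ n → μ.real (I n) ≤ c * ρ ^ n := by
  obtain ⟨c, hc, ρ, hρ0, hρ1, h⟩ := hI.2.2.2.1
  exact ⟨c, ρ, hc, hρ0, hρ1, fun n hn => ENNReal.toReal_le_of_le_ofReal (by positivity) (h n hn)⟩

lemma tendsto_linear_mul_nested [IsProbabilityMeasure μ] (hI : NestedCondition A μ I z) (p : ℕ) :
    Tendsto (fun n : ℕ => ((n + p + n : ℕ) : ℝ) * μ.real (I n)) atTop (nhds 0) := by
  obtain ⟨c, ρ, hc, hρ0, hρ1, h⟩ := nested_bound hI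
  have h1 : Tendsto (fun n : ℕ => (n : ℝ) * ρ ^ n) atTop (nhds 0) :=
    tendsto_self_mul_const_pow_of_lt_one hρ0.le hρ1
  have h2 := tendsto_pow_atTop_nhds_zero_of_lt_one hρ0.le hρ1
  have h3 : Tendsto (fun n : ℕ => c * (2 * ((n : ℝ) * ρ ^ n) + p * ρ ^ n)) atTop (nhds 0) := by
    simpa using ((h1.const_mul 2).add (h2.const_mul (p : ℝ))).const_mul c
  refine squeeze_zero' (Eventually.of_forall fun n => by positivity) ?_ h3
  filter_upwards [eventually_ge_atTop 1] with n hn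
  calc _ ≤ ((n + p + n : ℕ) : ℝ) * (c * ρ ^ n) := by gcongr; exact h n hn
    _ = _ := by push_cast; ring

lemma tendsto_nested [IsProbabilityMeasure μ] (hI : NestedCondition A μ I z) :
    Tendsto (fun n : ℕ => μ.real (I n)) atTop (nhds 0) := by
  obtain ⟨c, ρ, hc, hρ0, hρ1, h⟩ := nested_bound hI
  have h3 : Tendsto (fun n : ℕ => c * ρ ^ n) atTop (nhds 0) := by
    simpa using (tendsto_pow_atTop_nhds_zero_of_lt_one hρ0.le hρ1).const_mul c
  refine squeeze_zero' (Eventually.of_forall fun n => measureReal_nonneg) ?_ h3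
  filter_upwards [eventually_ge_atTop 1] with n hn using h n hn

/-- The relative measure of short returns tends to zero. -/
lemma IsGibbs.tendsto_sum_return [IsProbabilityMeasure μ] (hG : IsGibbs A θ K d c₁ c₂ ψ μ)
    (hN : ∀ x ∈ SFT A, transfer A ψ (fun _ => 1) x = 1) (hz : z ∈ SFT A)
    (hI : NestedCondition A μ I z) {p : ℕ} {U' : ℕ → Set (ℕ → Fin a)} {γ : ℝ}
    (hU : ReducedTarget A μ I p U' γ) :
    Tendsto (fun n => (∑ j ∈ Finset.Icc 1 (n + p + n),
      μ.real (U' n ∩ (shiftMap a)^[j] ⁻¹' I n)) / μ.real (I n)) atTop (nhds 0) := by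
  obtain ⟨c, ρ, hc, hρ0, hρ1, hbd⟩ := nested_bound hI
  obtain ⟨Q, Ψ, hQ, -, -, hmix⟩ := hG.exists_mixing_sets hN hz
  obtain ⟨l, κ, hκ, hl⟩ := hI.2.2.2.2.1
  set τ : ℝ := ρ ^ (κ / 2) with hτ
  have hτ0 : 0 < τ := Real.rpow_pos_of_pos hρ0 _
  have hτ1 : τ < 1 := Real.rpow_lt_one hρ0.le hρ1 (by positivity)
  set F : ℕ → ℕ → ℝ := fun n j => if j ∈ Finset.Icc 1 (n + p + n) then
    μ.real (U' n ∩ (shiftMap a)^[j] ⁻¹' I n) / μ.real (I n) else 0 with hF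
  have hsum : Summable fun j : ℕ => Q * (c * (ρ ^ j + τ ^ j / τ ^ p)) :=
    (((summable_geometric_of_lt_one hρ0.le hρ1).add
      ((summable_geometric_of_lt_one hτ0.le hτ1).div_const _)).mul_left c).mul_left Q
  have hlim := tendsto_tsum_of_dominated_convergence (f := F) (g := fun _ => (0 : ℝ))
    (𝓕 := atTop) hsum ?_ ?_
  · rw [tsum_zero] at hlim
    refine hlim.congr fun n => ?_
    rw [Finset.sum_div, tsum_eq_sum (s := Finset.Icc 1 (n + p + n))]
    · exact Finset.sum_congr rfl fun j hj => by simp only [hF]; rw [if_pos hj]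
    · intro j hj; simp only [hF]; rw [if_neg hj]
  · intro j
    refine tendsto_const_nhds.congr' ?_
    rcases Nat.eq_zero_or_pos j with rfl | hj
    · exact Eventually.of_forall fun n => by simp [hF]
    · filter_upwards [hU.no_return j hj] with n hn
      simp [hF, hn]
  · filter_upwards [eventually_ge_atTop 1] with n hn j
    have hb0 : 0 ≤ Q * (c * (ρ ^ j + τ ^ j / τ ^ p)) := by positivity
    simp only [hF]
    split_ifs with hj
    swap
    · simpa using hb0
    rw [Finset.mem_Icc] at hj
    have hε := hG.nested_pos hz hI hn
    rw [Real.norm_eq_abs, abs_of_nonneg (by positivity), div_le_iff₀ hε]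
    obtain ⟨hl1, hl2, hl3⟩ := hl n hn
    have hn' : (1 : ℝ) ≤ n := by exact_mod_cast hn
    have hlpos : 1 ≤ l n := by
      have : (0 : ℝ) < l n := lt_of_le_of_lt (by positivity) hl1
      exact_mod_cast this
    set i := min j (l n) with hi
    have hi1 : 1 ≤ i := le_min hj.1 hlpos
    have h1 : μ.real (U' n ∩ (shiftMap a)^[j] ⁻¹' I n) ≤
        μ.real (cyl z i ∩ (shiftMap a)^[j] ⁻¹' I n) := by
      refine measureReal_mono (inter_subset_inter_left _ ?_)
      exact ((hU.subset n).trans hl3).trans (inter_subset_right.trans (cyl_anti z (min_le_right _ _)))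
    have hdep : DependsOn A i (cyl z i) := fun x _ y _ hxy hxz k hk => by
      rw [← hxy k hk]; exact hxz k hk
    have h2 := (hmix i (cyl z i) (I n) (measurableSet_cyl z i) hdep
      (nested_measurableSet hI hn)).1 j (min_le_left _ _)
    have h3 : μ.real (cyl z i) ≤ c * ρ ^ i := by
      rw [measureReal_def, ← hG.measure_inter_SFT]
      exact (measureReal_mono (nested_cyl_subset hI hi1)).trans (hbd i hi1)
    have h4 : ρ ^ i ≤ ρ ^ j + ρ ^ l n := by
      rcases min_choice j (l n) with h | h
      · rw [hi, h]; linarith [pow_pos hρ0 (l n)]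
      · rw [hi, h]; linarith [pow_pos hρ0 j]
    have h5 : ρ ^ l n ≤ τ ^ j / τ ^ p := by
      rw [le_div_iff₀ (by positivity)]
      have e1 : ρ ^ l n ≤ τ ^ (n + n) := by
        rw [hτ, ← Real.rpow_natCast, ← Real.rpow_natCast, ← Real.rpow_mul hρ0.le]
        refine Real.rpow_le_rpow_of_exponent_ge hρ0 hρ1.le ?_
        push_cast; linarith
      calc _ ≤ τ ^ (n + n) * τ ^ p := by gcongr
        _ = τ ^ (n + p + n) := by rw [← pow_add]; congr 1; ring
        _ ≤ τ ^ j := pow_le_pow_of_le_one hτ0.le hτ1.le hj.2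
    calc _ ≤ Q * μ.real (cyl z i) * μ.real (I n) := h1.trans h2
      _ ≤ Q * (c * (ρ ^ j + τ ^ j / τ ^ p)) * μ.real (I n) := by
          gcongr
          refine h3.trans ?_
          gcongr
          linarith

lemma ReducedTarget.eventually_goodTarget [IsProbabilityMeasure μ]
    (hI : NestedCondition A μ I z) {p : ℕ} {U' : ℕ → Set (ℕ → Fin a)} {γ : ℝ}
    (hU : ReducedTarget A μ I p U' γ) {Ψ : ℕ → ℝ} (hΨ : ∀ l, 0 ≤ Ψ l)
    (hΨ0 : Tendsto Ψ atTop (nhds 0))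
    (hmix : ∀ (m : ℕ) (V B : Set (ℕ → Fin a)), MeasurableSet V → DependsOn A m V →
      MeasurableSet B → ∀ l,
        (1 - Ψ l) * μ.real V * μ.real B ≤ μ.real (V ∩ (shiftMap a)^[m + l] ⁻¹' B) ∧
          μ.real (V ∩ (shiftMap a)^[m + l] ⁻¹' B) ≤ (1 + Ψ l) * μ.real V * μ.real B) :
    ∀ᶠ n in atTop, GoodTarget μ (I n) (U' n) (n + p + n) (Ψ n) := by
  have h1 := (tendsto_linear_mul_nested hI p).eventually (gt_mem_nhds (by norm_num : (0 : ℝ) < 1 / 16))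
  have h2 := hΨ0.eventually (gt_mem_nhds (by norm_num : (0 : ℝ) < 1))
  filter_upwards [h1, h2, eventually_ge_atTop 1] with n h1 h2 hn
  have hm := nested_measurableSet hI hn
  have hm' := hU.meas n hn
  refine ⟨hm, hm', hU.subset n, fun k hk => hU.inter_surv n hn k (by omega), hΨ n, h2.le,
    by linarith, fun B hB => (hmix (n + p) (U' n) B hm' (hU.dep n hn) hB n).1,
    fun B hB => (hmix (n + p) (U' n) B hm' (hU.dep n hn) hB n).2, fun j hj1 hj2 B hB => ?_⟩
  have hdep : DependsOn A (n + p + (n + p + n)) (U' n ∩ (shiftMap a)^[j] ⁻¹' I n) := by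
    rintro x hx y hy hxy ⟨h3, h4⟩
    refine ⟨hU.dep n hn x hx y hy (fun i hi => hxy i (by omega)) h3,
      nested_dependsOn hI hn _ (shift_iter_mem hx j) _ (shift_iter_mem hy j) (fun i hi => ?_) h4⟩
    rw [shift_iter, shift_iter]
    exact hxy _ (by omega)
  have := (hmix _ _ B (hm'.inter (measurable_shift_iter j hm)) hdep hB n).2
  rwa [show n + p + (n + p + n) + n = 2 * (n + p + n) by ring] at this

/-- Exponential rate of the survival probabilities for small targets. -/
lemma IsGibbs.eventually_surv_bounds [IsProbabilityMeasure μ] (hG : IsGibbs A θ K d c₁ c₂ ψ μ)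
    (hN : ∀ x ∈ SFT A, transfer A ψ (fun _ => 1) x = 1) (hz : z ∈ SFT A)
    (hI : NestedCondition A μ I z) {p : ℕ} {U' : ℕ → Set (ℕ → Fin a)} {γ : ℝ}
    (hU : ReducedTarget A μ I p U' γ) {η : ℝ} (hη : 0 < η) :
    ∀ᶠ n in atTop, ∃ c C : ℝ, 0 < c ∧ 0 < C ∧ ∀ k : ℕ,
      c * Real.exp (-((γ + η) * μ.real (I n) * k)) ≤ μ.real (surv (I n) k) ∧
      μ.real (surv (I n) k) ≤ C * Real.exp (-((γ - η) * μ.real (I n) * k)) := by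
  obtain ⟨Q, Ψ, hQ, hΨ, hΨ0, hmix⟩ := hG.exists_mixing_sets hN hz
  have hgood := hU.eventually_goodTarget hI hΨ hΨ0
    fun m V B h1 h2 h3 => (hmix m V B h1 h2 h3).2
  have hret := hG.tendsto_sum_return hN hz hI hU
  have hlin := tendsto_linear_mul_nested hI p
  have hε0 := tendsto_nested hI
  set Z : ℕ → ℝ := fun n => ∑ j ∈ Finset.Icc 1 (n + p + n),
      μ.real (U' n ∩ (shiftMap a)^[j] ⁻¹' I n) with hZ
  set r : ℕ → ℝ := fun n => μ.real (U' n) / μ.real (I n) with hr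
  have hs : Tendsto (fun n => (1 - Ψ n) * r n - 4 * (Z n / μ.real (I n))) atTop (nhds γ) := by
    have h := (((tendsto_const_nhds (x := (1 : ℝ))).sub hΨ0).mul hU.ratio).sub (hret.const_mul 4)
    simpa only [sub_zero, one_mul, mul_zero] using h
  set w : ℕ → ℝ := fun n =>
    (1 + Ψ n) / (1 - 4 * (((n + p + n : ℕ) : ℝ) * μ.real (I n))) * r n with hw
  have hw0 : Tendsto w atTop (nhds γ) := by
    have h := (((tendsto_const_nhds (x := (1 : ℝ))).add hΨ0).div
      ((tendsto_const_nhds (x := (1 : ℝ))).sub (hlin.const_mul 4)) (by norm_num)).mul hU.ratio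
    simp only [sub_zero, add_zero, one_mul, mul_zero, div_one] at h
    exact h
  have ht : Tendsto (fun n => w n * μ.real (I n)) atTop (nhds 0) := by
    simpa using hw0.mul hε0
  have ht' : Tendsto (fun n => w n / (1 - w n * μ.real (I n))) atTop (nhds γ) := by
    have h : Tendsto (fun n => w n / (1 - w n * μ.real (I n))) atTop (nhds (γ / (1 - 0))) :=
      hw0.div ((tendsto_const_nhds (x := (1 : ℝ))).sub ht) (by norm_num)
    simpa only [sub_zero, div_one] using h
  filter_upwards [hgood, eventually_ge_atTop 1, hs.eventually (lt_mem_nhds (by linarith : γ - η < γ)),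
    ht.eventually (gt_mem_nhds (by norm_num : (0 : ℝ) < 1)),
    ht'.eventually (gt_mem_nhds (by linarith : γ < γ + η))] with n hg hn h1 h2 h3
  have hε := hG.nested_pos hz hI hn
  have hq : 1 ≤ n + p + n := by omega
  have hr' : r n * μ.real (I n) = μ.real (U' n) := by simp only [hr]; field_simp
  have hZ' : Z n / μ.real (I n) * μ.real (I n) = Z n := by field_simp
  have hden : 0 < 1 - 4 * (((n + p + n : ℕ) : ℝ) * μ.real (I n)) := by
    have := hg.hε; linarith
  have hwn : 0 ≤ w n := by
    have := hΨ n
    simp only [hw, hr]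
    positivity
  have hlow : ∀ k ≥ 2 * (n + p + n), (γ - η) * μ.real (I n) * μ.real (surv (I n) k) ≤
      μ.real (I n ∩ surv (I n) k) := fun k hk => by
    refine le_trans ?_ (hg.hit_bounds hG.inv hq hk).2
    gcongr
    have := mul_le_mul_of_nonneg_right h1.le hε.le
    rw [sub_mul ((1 - Ψ n) * r n), mul_assoc, hr', mul_assoc 4, hZ'] at this
    exact this
  have hupp : ∀ k ≥ 2 * (n + p + n), μ.real (I n ∩ surv (I n) k) ≤
      w n * μ.real (I n) * μ.real (surv (I n) k) := fun k hk => by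
    refine (hg.hit_bounds hG.inv hq hk).1.trans (le_of_eq ?_)
    simp only [hw]
    rw [mul_assoc _ (r n), hr']
    ring
  obtain ⟨c, C, hc, hC, hb⟩ := exists_surv_exp_bounds hG.inv hg.meas
    (hg.surv_pos hG.inv hq (2 * (n + p + n))) (by positivity) h2 hlow hupp
  refine ⟨c, C, hc, hC, fun k => ⟨le_trans ?_ (hb k).1, (hb k).2⟩⟩
  gcongr
  rw [mul_div_right_comm]
  gcongr

end nested

section targets
variable {A : Matrix (Fin a) (Fin a) ℕ} {θ K c₁ c₂ : ℝ} {d : ℕ} {ψ : (ℕ → Fin a) → ℝ}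
  {μ : Measure (ℕ → Fin a)} {I : ℕ → Set (ℕ → Fin a)} {z : ℕ → Fin a}

lemma nested_exists_depth (hI : NestedCondition A μ I z) : ∃ l : ℕ → ℕ, Tendsto l atTop atTop ∧
    ∀ n, 1 ≤ n → I n ⊆ SFT A ∩ cyl z (l n) := by
  obtain ⟨l, κ, hκ, hl⟩ := hI.2.2.2.2.1
  refine ⟨l, ?_, fun n hn => (hl n hn).2.2⟩
  have h : Tendsto (fun n : ℕ => κ * (n : ℝ)) atTop atTop :=
    tendsto_natCast_atTop_atTop.const_mul_atTop hκ
  refine (tendsto_natCast_atTop_iff (R := ℝ)).1 (tendsto_atTop_mono' _ ?_ h)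
  filter_upwards [eventually_ge_atTop 1] with n hn using (hl n hn).1.le

/-- Times that do not fix the centre give no return for small targets. -/
lemma nested_no_return (hI : NestedCondition A μ I z) {j : ℕ} (hj : (shiftMap a)^[j] z ≠ z) :
    ∀ᶠ n in atTop, I n ∩ (shiftMap a)^[j] ⁻¹' I n = ∅ := by
  obtain ⟨l, hl, hIl⟩ := nested_exists_depth hI
  obtain ⟨i, hi⟩ := Function.ne_iff.1 hj
  filter_upwards [hl.eventually_gt_atTop (i + j), eventually_ge_atTop 1] with n hn h1
  refine eq_empty_of_forall_notMem fun x hx => hi ?_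
  have e1 := (hIl n h1 hx.1).2 (i + j) hn
  have e2 := (hIl n h1 hx.2).2 i (by omega)
  rw [shift_iter] at e2 ⊢
  rw [← e1, e2]

lemma reducedTarget_of_not_periodic [IsProbabilityMeasure μ] (hG : IsGibbs A θ K d c₁ c₂ ψ μ)
    (hz : z ∈ SFT A) (hI : NestedCondition A μ I z)
    (hper : ∀ p : ℕ, 0 < p → (shiftMap a)^[p] z ≠ z) : ReducedTarget A μ I 0 I 1 where
  subset _ := Subset.rfl
  meas _ hn := nested_measurableSet hI hn
  dep _ hn := nested_dependsOn hI hn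
  inter_surv _ _ _ _ := inter_subset_left
  no_return j hj := nested_no_return hI (hper j hj)
  ratio := by
    refine tendsto_const_nhds.congr' ?_
    filter_upwards [eventually_ge_atTop 1] with n hn
    have hpos := hG.nested_pos hz hI hn
    rw [div_self hpos.ne.symm]

/-- Descending along the period of the centre. -/
lemma mem_of_iter_period_mem {p n : ℕ} (hp : (shiftMap a)^[p] z = z)
    (h : (shiftMap a)^[p] ⁻¹' (I n) ∩ (SFT A ∩ cyl z p) ⊆ I n) :
    ∀ i : ℕ, ∀ y ∈ SFT A, y ∈ cyl z (p * i) → (shiftMap a)^[p * i] y ∈ I n → y ∈ I n := by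
  intro i
  induction i with
  | zero => intro y _ _ hy; simpa using hy
  | succ i ih =>
    intro y hy hyc hyI
    refine h ⟨ih _ (shift_iter_mem hy p) (fun t ht => ?_) ?_, hy, fun t ht => hyc t ?_⟩
    · rw [shift_iter, hyc _ (by rw [mul_add, mul_one]; omega), ← shift_iter p z, hp]
    · rwa [← Function.iterate_add_apply, ← Nat.mul_succ]
    · rw [mul_add, mul_one]; omega

lemma nested_ratio_period [IsProbabilityMeasure μ] (hG : IsGibbs A θ K d c₁ c₂ ψ μ)
    (hN : ∀ x ∈ SFT A, transfer A ψ (fun _ => 1) x = 1) (hz : z ∈ SFT A)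
    (hI : NestedCondition A μ I z) {p : ℕ} (hp0 : 0 < p) (hp : (shiftMap a)^[p] z = z)
    (hmin : ∀ q : ℕ, 0 < q → (shiftMap a)^[q] z = z → p ≤ q) :
    Tendsto (fun n => μ.real (I n ∩ (shiftMap a)^[p] ⁻¹' I n) / μ.real (I n)) atTop
      (nhds (Real.exp (birkhoff ψ p z))) := by
  obtain ⟨l, hl, hIl⟩ := nested_exists_depth hI
  obtain ⟨N, hN5⟩ := hI.2.2.2.2.2 p hp0 hp hmin
  have hθl : Tendsto (fun n => K * θ ^ l n / (1 - θ)) atTop (nhds 0) := by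
    have h := (((tendsto_pow_atTop_nhds_zero_of_lt_one hG.hθ.1.le hG.hθ.2).comp hl).const_mul
      K).div_const (1 - θ)
    simp only [mul_zero, zero_div] at h
    exact h
  have hlow : Tendsto (fun n => Real.exp (birkhoff ψ p z - K * θ ^ l n / (1 - θ))) atTop
      (nhds (Real.exp (birkhoff ψ p z))) := by
    have h := (Real.continuous_exp.tendsto _).comp
      ((tendsto_const_nhds (x := birkhoff ψ p z)).sub hθl)
    simp only [sub_zero] at h
    exact h
  have hupp : Tendsto (fun n => Real.exp (birkhoff ψ p z + K * θ ^ l n / (1 - θ))) atTop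
      (nhds (Real.exp (birkhoff ψ p z))) := by
    have h := (Real.continuous_exp.tendsto _).comp
      ((tendsto_const_nhds (x := birkhoff ψ p z)).add hθl)
    simp only [add_zero] at h
    exact h
  have hkey : ∀ᶠ n in atTop,
      Real.exp (birkhoff ψ p z - K * θ ^ l n / (1 - θ)) * μ.real (I n) ≤
        μ.real (I n ∩ (shiftMap a)^[p] ⁻¹' I n) ∧
      μ.real (I n ∩ (shiftMap a)^[p] ⁻¹' I n) ≤
        Real.exp (birkhoff ψ p z + K * θ ^ l n / (1 - θ)) * μ.real (I n) := by
    filter_upwards [hl.eventually_ge_atTop p, eventually_ge_atTop N, eventually_ge_atTop 1]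
      with n hln hnN hn
    have hm := nested_measurableSet hI hn
    have heq : μ.real (I n ∩ (shiftMap a)^[p] ⁻¹' I n) =
        μ.real (cyl z (p + l n) ∩ (shiftMap a)^[p] ⁻¹' I n) := by
      rw [measureReal_def, measureReal_def, ← hG.measure_inter_SFT (I n ∩ _),
        ← hG.measure_inter_SFT (cyl z _ ∩ _)]
      congr 2
      ext x
      refine and_congr_right fun hx => and_congr_left fun hx' => ⟨fun h i hi => ?_, fun h => ?_⟩
      · rcases lt_or_ge i p with h' | h'
        · exact (hIl n hn h).2 i (by omega)
        · have e := (hIl n hn hx').2 (i - p) (by omega)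
          rw [shift_iter, Nat.sub_add_cancel h'] at e
          rw [e]
          conv_lhs => rw [← hp]
          rw [shift_iter, Nat.sub_add_cancel h']
      · exact hN5 n hnN ⟨hx', hx, cyl_anti z (Nat.le_add_right p _) h⟩
    have hcyl := transfer_iter_cyl hG.hθ hG.hK hG.lip hz (n := p + l n) p (by omega)
    rw [Nat.add_sub_cancel_left, hp] at hcyl
    rw [heq]
    exact ⟨hG.le_measure_inter_preimage hN (measurableSet_cyl z _) hm p fun x hx hxI =>
        ((hcyl x hx).1 (hIl n hn hxI).2).1,
      hG.measure_inter_preimage_le hN (measurableSet_cyl z _) hm p (Real.exp_pos _).le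
        fun x hx hxI => ((hcyl x hx).1 (hIl n hn hxI).2).2⟩
  refine tendsto_of_tendsto_of_tendsto_of_le_of_le' hlow hupp ?_ ?_
  · filter_upwards [hkey, eventually_ge_atTop 1] with n h hn
    exact (le_div_iff₀ (hG.nested_pos hz hI hn)).2 h.1
  · filter_upwards [hkey, eventually_ge_atTop 1] with n h hn
    exact (div_le_iff₀ (hG.nested_pos hz hI hn)).2 h.2

lemma reducedTarget_of_periodic [IsProbabilityMeasure μ] (hG : IsGibbs A θ K d c₁ c₂ ψ μ)
    (hN : ∀ x ∈ SFT A, transfer A ψ (fun _ => 1) x = 1) (hz : z ∈ SFT A)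
    (hI : NestedCondition A μ I z) {p : ℕ} (hp0 : 0 < p) (hp : (shiftMap a)^[p] z = z)
    (hmin : ∀ q : ℕ, 0 < q → (shiftMap a)^[q] z = z → p ≤ q) :
    ReducedTarget A μ I p (fun n => I n \ (shiftMap a)^[p] ⁻¹' I n)
      (1 - Real.exp (birkhoff ψ p z)) where
  subset _ := sdiff_subset
  meas _ hn := (nested_measurableSet hI hn).diff
    (measurable_shift_iter p (nested_measurableSet hI hn))
  dep n hn x hx y hy hxy hxI := by
    refine ⟨nested_dependsOn hI hn x hx y hy (fun i hi => hxy i (by omega)) hxI.1,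
      fun h => hxI.2 ?_⟩
    refine nested_dependsOn hI hn _ (shift_iter_mem hy p) _ (shift_iter_mem hx p)
      (fun i hi => ?_) h
    rw [shift_iter, shift_iter]
    exact (hxy _ (by omega)).symm
  inter_surv _ _ _ hk _ hx := ⟨hx.1, hx.2 p hp0 hk⟩
  no_return j hj := by
    by_cases hjz : (shiftMap a)^[j] z = z
    swap
    · filter_upwards [nested_no_return hI hjz] with n hn
      exact subset_empty_iff.1 (hn ▸ inter_subset_inter_left _ sdiff_subset)
    obtain ⟨l, hl, hIl⟩ := nested_exists_depth hI
    obtain ⟨N, hN5⟩ := hI.2.2.2.2.2 p hp0 hp hmin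
    have hdvd : p ∣ j := by
      by_contra h
      have h1 : 0 < j % p := Nat.pos_of_ne_zero fun h0 => h (Nat.dvd_of_mod_eq_zero h0)
      have h2 : (shiftMap a)^[j % p] z = z := Function.IsPeriodicPt.mod hjz hp
      exact absurd (hmin _ h1 h2) (Nat.mod_lt j hp0).not_ge
    obtain ⟨i, rfl⟩ := hdvd
    obtain ⟨i, rfl⟩ : ∃ i', i = i' + 1 :=
      ⟨i - 1, by have := Nat.pos_of_mul_pos_left hj; omega⟩
    filter_upwards [hl.eventually_ge_atTop (p * (i + 1)), eventually_ge_atTop N,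
      eventually_ge_atTop 1] with n hln hnN hn
    refine eq_empty_of_forall_notMem fun x hx => hx.1.2 ?_
    have hxl := hIl n hn hx.1.1
    refine mem_of_iter_period_mem hp (hN5 n hnN) i _ (shift_iter_mem hxl.1 p) (fun t ht => ?_) ?_
    · rw [shift_iter, hxl.2 _ (by rw [mul_add, mul_one] at hln; omega), ← shift_iter p z, hp]
    · rw [← Function.iterate_add_apply, ← Nat.mul_succ]
      exact hx.2
  ratio := by
    refine ((tendsto_const_nhds (x := (1 : ℝ))).sub
      (nested_ratio_period hG hN hz hI hp0 hp hmin)).congr' ?_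
    filter_upwards [eventually_ge_atTop 1] with n hn
    have h := measureReal_inter_add_sdiff (μ := μ) (s := I n)
      (measurable_shift_iter p (nested_measurableSet hI hn))
    have h' := hG.nested_pos hz hI hn
    rw [eq_div_iff h'.ne', sub_mul, div_mul_cancel₀ _ h'.ne']
    linarith

end targets

section deviations
variable {A : Matrix (Fin a) (Fin a) ℕ} {θ K c₁ c₂ : ℝ} {d : ℕ} {ψ : (ℕ → Fin a) → ℝ}
  {μ : Measure (ℕ → Fin a)} {z : ℕ → Fin a} {g : (ℕ → Fin a) → ℝ}

lemma measurable_birkhoff (hg : Measurable g) (n : ℕ) : Measurable (birkhoff g n) := by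
  unfold birkhoff
  exact Finset.measurable_fun_sum _ fun k _ => hg.comp (measurable_shift_iter k)

lemma abs_birkhoff_le {F : ℝ} (hF : ∀ x ∈ SFT A, |g x| ≤ F) (n : ℕ) {x : ℕ → Fin a}
    (hx : x ∈ SFT A) : |birkhoff g n x| ≤ n * F := by
  refine (Finset.abs_sum_le_sum_abs _ _).trans ?_
  refine (Finset.sum_le_card_nsmul _ _ F fun k _ => hF _ (shift_iter_mem hx k)).trans ?_
  simp

lemma transfer_iter_birkhoff (hN : ∀ x ∈ SFT A, transfer A ψ (fun _ => 1) x = 1) (n : ℕ) :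
    ∀ x ∈ SFT A, (transfer A ψ)^[n] (birkhoff g n) x =
      ∑ k ∈ Finset.range n, (transfer A ψ)^[k + 1] g x := by
  induction n with
  | zero =>
    intro x _
    simp [birkhoff]
  | succ n ih =>
    intro x hx
    have h : birkhoff g (n + 1) = fun y => g y + 1 * birkhoff g n (shiftMap a y) := by
      funext y
      rw [add_comm n 1, birkhoff_add]
      simp [birkhoff]
    rw [h, transfer_iter_add]
    have h2 : (transfer A ψ)^[n + 1] (fun y => 1 * birkhoff g n (shiftMap a y)) x =
        (transfer A ψ)^[n] (birkhoff g n) x := by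
      rw [Function.iterate_succ_apply]
      refine transfer_iter_congr (fun y hy => ?_) n x hx
      rw [transfer_mul_comp (fun _ => 1), hN y hy, one_mul]
    simp only [h2, ih x hx]
    rw [Finset.sum_range_succ, add_comm]

/-- Birkhoff averages are uniformly close to the mean after applying the transfer operator. -/
lemma IsGibbs.exists_birkhoff_average [IsProbabilityMeasure μ] (hG : IsGibbs A θ K d c₁ c₂ ψ μ)
    (hN : ∀ x ∈ SFT A, transfer A ψ (fun _ => 1) x = 1) (hz : z ∈ SFT A) {b : ℝ}
    (hg : Measurable g) (hgc : Cone A θ b 0 g) {δ : ℝ} (hδ : 0 < δ) :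
    ∃ n : ℕ, 1 ≤ n ∧ ∀ x ∈ SFT A,
      |(transfer A ψ)^[n] (birkhoff g n) x - n * ∫ y, g y ∂μ| ≤ n * δ := by
  obtain ⟨b', hb1, hb2, hb3⟩ : ∃ b' : ℝ, 1 ≤ b' ∧ θ * (b' + K) + 1 ≤ b' ∧ b ≤ b' := by
    have hθ : 0 < 1 - θ := sub_pos.2 hG.hθ.2
    refine ⟨max (max 1 b) ((1 + θ * K) / (1 - θ)), (le_max_left _ _).trans (le_max_left _ _), ?_,
      (le_max_right _ _).trans (le_max_left _ _)⟩
    have h := le_max_right (max 1 b) ((1 + θ * K) / (1 - θ))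
    rw [div_le_iff₀ hθ] at h
    linarith
  obtain ⟨Q, Ψ, -, -, hΨ0, hmix⟩ := hG.exists_mixing hN hz hb1 hb2
  have hm := (hmix 0 g hg (hgc.mono hG.hθ.1.le hb3 le_rfl)).2
  have hces := ((hΨ0.comp (tendsto_add_atTop_nat 1)).cesaro).mul_const (∫ y, g y ∂μ)
  rw [zero_mul] at hces
  obtain ⟨n, hn, hn1⟩ := ((hces.eventually (gt_mem_nhds hδ)).and (eventually_ge_atTop 1)).exists
  refine ⟨n, hn1, fun x hx => ?_⟩
  have hn0 : (0 : ℝ) < n := by exact_mod_cast hn1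
  rw [transfer_iter_birkhoff hN n x hx]
  have h1 : ∑ k ∈ Finset.range n, (transfer A ψ)^[k + 1] g x - n * ∫ y, g y ∂μ =
      ∑ k ∈ Finset.range n, ((transfer A ψ)^[k + 1] g x - ∫ y, g y ∂μ) := by
    rw [Finset.sum_sub_distrib]; simp
  rw [h1]
  refine (Finset.abs_sum_le_sum_abs _ _).trans ?_
  calc _ ≤ ∑ k ∈ Finset.range n, Ψ (k + 1) * ∫ y, g y ∂μ :=
        Finset.sum_le_sum fun k _ => by simpa only [zero_add] using hm (k + 1) x hx
    _ = n * ((n : ℝ)⁻¹ * (∑ k ∈ Finset.range n, (Ψ ∘ fun k => k + 1) k) * ∫ y, g y ∂μ) := by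
        rw [← Finset.sum_mul, mul_assoc, ← mul_assoc (n : ℝ), mul_inv_cancel₀ hn0.ne', one_mul]
        rfl
    _ ≤ n * δ := by gcongr

lemma transfer_iter_exp_le (hN : ∀ x ∈ SFT A, transfer A ψ (fun _ => 1) x = 1) {F : ℝ}
    (hF : ∀ x ∈ SFT A, |g x| ≤ F) {n : ℕ} {m δ s : ℝ}
    (hn : ∀ x ∈ SFT A, |(transfer A ψ)^[n] (birkhoff g n) x - n * m| ≤ n * δ)
    (hs1 : |s| * (n * F) ≤ 1) (hs2 : |s| * (n * F ^ 2) ≤ δ) :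
    ∀ x ∈ SFT A, (transfer A ψ)^[n] (fun y => Real.exp (s * birkhoff g n y)) x ≤
      Real.exp (s * (n * m) + 2 * |s| * (n * δ)) := by
  intro x hx
  have h1 : ∀ y ∈ SFT A, Real.exp (s * birkhoff g n y) ≤
      s * birkhoff g n y + (1 + |s| * (n * δ)) := by
    intro y hy
    have hb := abs_birkhoff_le hF n hy
    have hsb : |s * birkhoff g n y| ≤ |s| * (n * F) := by
      rw [abs_mul]; gcongr
    have e1 := (abs_le.1 (Real.abs_exp_sub_one_sub_id_le (hsb.trans hs1))).2
    have e2 : (s * birkhoff g n y) ^ 2 ≤ |s| * (n * δ) := by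
      rw [← sq_abs]
      calc _ ≤ (|s| * (n * F)) ^ 2 := by gcongr
        _ = |s| * (n * (|s| * (n * F ^ 2))) := by ring
        _ ≤ _ := by gcongr
    linarith
  have h2 := transfer_iter_mono (ψ := ψ) h1 n x hx
  rw [transfer_iter_add, transfer_iter_smul] at h2
  simp only [transfer_iter_const hN _ n x hx] at h2
  have h3 : s * ((transfer A ψ)^[n] (birkhoff g n) x - n * m) ≤ |s| * (n * δ) := by
    refine (le_abs_self _).trans ?_
    rw [abs_mul]
    gcongr
    exact hn x hx
  have h4 := Real.add_one_le_exp (s * (n * m) + 2 * |s| * (n * δ))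
  linarith

lemma transfer_iter_exp_mul_le {n : ℕ} {s t : ℝ}
    (hst : ∀ x ∈ SFT A, (transfer A ψ)^[n] (fun y => Real.exp (s * birkhoff g n y)) x ≤
      Real.exp t) (k : ℕ) :
    ∀ x ∈ SFT A, (transfer A ψ)^[k * n] (fun y => Real.exp (s * birkhoff g (k * n) y)) x ≤
      Real.exp (k * t) := by
  induction k with
  | zero => intro x _; simp [birkhoff]
  | succ k ih =>
    intro x hx
    have h1 : (fun y => Real.exp (s * birkhoff g ((k + 1) * n) y)) = fun y =>
        Real.exp (s * birkhoff g n y) * Real.exp (s * birkhoff g (k * n) ((shiftMap a)^[n] y)) := by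
      funext y
      rw [← Real.exp_add, ← mul_add, ← birkhoff_add, Nat.succ_mul, add_comm n]
    rw [h1, Nat.succ_mul, Function.iterate_add_apply]
    calc _ ≤ (transfer A ψ)^[k * n] (fun y => Real.exp t *
          Real.exp (s * birkhoff g (k * n) y)) x := by
          refine transfer_iter_mono (fun y hy => ?_) _ x hx
          rw [transfer_iter_mul_comp (fun y => Real.exp (s * birkhoff g n y))
            (fun y => Real.exp (s * birkhoff g (k * n) y))]
          exact mul_le_mul_of_nonneg_right (hst y hy) (Real.exp_pos _).le
      _ = Real.exp t * (transfer A ψ)^[k * n] (fun y =>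
          Real.exp (s * birkhoff g (k * n) y)) x := by rw [transfer_iter_smul]
      _ ≤ Real.exp t * Real.exp (k * t) := by gcongr; exact ih x hx
      _ = _ := by rw [← Real.exp_add]; congr 1; push_cast; ring

/-- Exponential large deviation bounds for Birkhoff sums. -/
lemma IsGibbs.exists_deviation_bounds [IsProbabilityMeasure μ]
    (hG : IsGibbs A θ K d c₁ c₂ ψ μ)
    (hN : ∀ x ∈ SFT A, transfer A ψ (fun _ => 1) x = 1) (hz : z ∈ SFT A) {b : ℝ}
    (hg : Measurable g) (hgc : Cone A θ b 0 g) {F : ℝ} (hF : ∀ x ∈ SFT A, |g x| ≤ F)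
    {δ : ℝ} (hδ : 0 < δ) :
    ∃ (n : ℕ) (c : ℝ), 1 ≤ n ∧ 0 < c ∧ ∀ k : ℕ,
      μ.real {x | ((k * n : ℕ) : ℝ) * (∫ y, g y ∂μ + δ) ≤ birkhoff g (k * n) x} ≤
        Real.exp (-(c * k)) ∧
      μ.real {x | birkhoff g (k * n) x ≤ ((k * n : ℕ) : ℝ) * (∫ y, g y ∂μ - δ)} ≤
        Real.exp (-(c * k)) := by
  obtain ⟨n, hn1, hn⟩ := hG.exists_birkhoff_average hN hz hg hgc (δ := δ / 4) (by positivity)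
  have hn0 : (0 : ℝ) < n := by exact_mod_cast hn1
  wlog hF0 : 0 < F generalizing F
  · exact this (F := 1) (fun x hx => ((hF x hx).trans (not_lt.1 hF0)).trans zero_le_one) one_pos
  obtain ⟨s, hs0, hs1, hs2⟩ : ∃ s : ℝ, 0 < s ∧ s * (n * F) ≤ 1 ∧ s * (n * F ^ 2) ≤ δ / 4 := by
    refine ⟨min (1 / (n * F)) (δ / 4 / (n * F ^ 2)), by positivity, ?_, ?_⟩
    · rw [← le_div_iff₀ (by positivity)]; exact min_le_left _ _
    · rw [← le_div_iff₀ (by positivity)]; exact min_le_right _ _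
  have hmgf : ∀ s' : ℝ, |s'| = s → ∀ k : ℕ,
      Integrable (fun x => Real.exp (s' * birkhoff g (k * n) x)) μ ∧
      ProbabilityTheory.mgf (birkhoff g (k * n)) μ s' ≤
        Real.exp (k * (s' * (n * ∫ y, g y ∂μ) + 2 * |s'| * (n * (δ / 4)))) := by
    intro s' hs' k
    have hm : Measurable fun x => Real.exp (s' * birkhoff g (k * n) x) :=
      ((measurable_birkhoff hg _).const_mul s').exp
    have hT := transfer_iter_exp_mul_le (transfer_iter_exp_le hN hF hn
      (hs'.symm ▸ hs1) (hs'.symm ▸ hs2)) k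
    refine ⟨hG.integrable_of_bound hm (S := Real.exp (s * ((k * n : ℕ) * F))) fun x hx => ?_, ?_⟩
    · rw [Real.abs_exp]
      refine Real.exp_le_exp.2 ((le_abs_self _).trans ?_)
      rw [abs_mul, hs']
      gcongr
      exact abs_birkhoff_le hF _ hx
    · rw [ProbabilityTheory.mgf, ← hG.integral_transfer_iter hN hm
        (fun x _ => (Real.exp_pos _).le) (k * n)]
      exact (hG.integral_mem_Icc (measurable_transfer_iter hG.meas hm _) (s := 0) fun x hx =>
        ⟨transfer_iter_nonneg (fun x _ => (Real.exp_pos _).le) _ x hx, hT x hx⟩).2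
  refine ⟨n, s * (n * (δ / 2)), hn1, by positivity, fun k => ⟨?_, ?_⟩⟩
  · obtain ⟨hi, hb⟩ := hmgf s (abs_of_pos hs0) k
    refine (ProbabilityTheory.measure_ge_le_exp_mul_mgf _ hs0.le hi).trans ?_
    refine (mul_le_mul_of_nonneg_left hb (Real.exp_pos _).le).trans (le_of_eq ?_)
    rw [← Real.exp_add, abs_of_pos hs0]
    congr 1
    push_cast; ring
  · obtain ⟨hi, hb⟩ := hmgf (-s) (by rw [abs_neg, abs_of_pos hs0]) k
    refine (ProbabilityTheory.measure_le_le_exp_mul_mgf _ (by linarith) hi).trans ?_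
    refine (mul_le_mul_of_nonneg_left hb (Real.exp_pos _).le).trans (le_of_eq ?_)
    rw [← Real.exp_add, abs_neg, abs_of_pos hs0]
    congr 1
    push_cast; ring

lemma cone_of_lipX {L : ℝ} (hL : LipX A θ L g) (hL0 : 0 ≤ L) (hθ : 0 ≤ θ)
    (hg1 : ∀ x ∈ SFT A, 1 < g x) : Cone A θ L 0 g := by
  refine ⟨fun x hx => (zero_lt_one.trans (hg1 x hx)).le, fun x hx y hy r _ _ hxy => ?_⟩
  have h1 := (abs_le.1 (hL x hx y hy r hxy)).2
  have h2 := Real.add_one_le_exp (L * θ ^ r)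
  have h3 : 0 ≤ L * θ ^ r := by positivity
  nlinarith [hg1 y hy]

end deviations

section flow
variable {A : Matrix (Fin a) (Fin a) ℕ} {θ K c₁ c₂ : ℝ} {d : ℕ} {ψ : (ℕ → Fin a) → ℝ}
  {μ : Measure (ℕ → Fin a)} {z : ℕ → Fin a} {f g : (ℕ → Fin a) → ℝ} {U : Set (ℕ → Fin a)}

lemma birkhoff_congr (h : ∀ x ∈ SFT A, f x = g x) (n : ℕ) {x : ℕ → Fin a} (hx : x ∈ SFT A) :
    birkhoff f n x = birkhoff g n x :=
  Finset.sum_congr rfl fun k _ => h _ (shift_iter_mem hx k)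

lemma birkhoff_strictMono (hf : ∀ x ∈ SFT A, 0 < f x) {x : ℕ → Fin a} (hx : x ∈ SFT A) :
    StrictMono fun n => birkhoff f n x :=
  strictMono_nat_of_lt_succ fun n => by
    simp only [birkhoff, Finset.sum_range_succ]
    linarith [hf _ (shift_iter_mem hx n)]

/-- The points of the subshift whose flow orbit does not cross `U × {0}` at heights in `(0, t]`
over the base. -/
def roofSurv (A : Matrix (Fin a) (Fin a) ℕ) (f : (ℕ → Fin a) → ℝ) (U : Set (ℕ → Fin a))
    (t : ℝ) : Set (ℕ → Fin a) :=
  {x | x ∈ SFT A ∧ ∀ j : ℕ, 1 ≤ j → birkhoff f j x ≤ t → (shiftMap a)^[j] x ∉ U}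

lemma roofSurv_congr (h : ∀ x ∈ SFT A, f x = g x) (t : ℝ) :
    roofSurv A f U t = roofSurv A g U t := by
  ext x
  refine and_congr_right fun hx => forall₂_congr fun j _ => ?_
  rw [birkhoff_congr h j hx]

lemma roofSurv_subset (hf : ∀ x ∈ SFT A, 0 < f x) {t s : ℝ} (hst : s ≤ t) (k : ℕ) :
    roofSurv A f U t ⊆ surv U k ∪ {x | s ≤ birkhoff f k x} := by
  rintro x ⟨hx, h⟩
  by_cases hk : birkhoff f k x ≤ t
  · exact Or.inl fun j hj hjk => h j hj (((birkhoff_strictMono hf hx).monotone hjk).trans hk)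
  · exact Or.inr (hst.trans (not_le.1 hk).le)

lemma inter_surv_subset_roofSurv (hf : ∀ x ∈ SFT A, 0 < f x) {t s : ℝ} (hst : t ≤ s) (k : ℕ) :
    SFT A ∩ surv U k ⊆ roofSurv A f U t ∪ {x | birkhoff f k x ≤ s} := by
  rintro x ⟨hx, h⟩
  by_cases hk : birkhoff f k x ≤ t
  · exact Or.inr (hk.trans hst)
  · refine Or.inl ⟨hx, fun j hj hjt => h j hj ?_⟩
    exact ((birkhoff_strictMono hf hx).lt_iff_lt.1 (lt_of_le_of_lt hjt (not_le.1 hk))).le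

lemma susFlow_eq (hf : ∀ x ∈ SFT A, 0 < f x) {x : ℕ → Fin a} (hx : x ∈ SFT A) (r : ℝ) (j : ℕ) :
    susFlow f (birkhoff f j x - r) (x, r) = ((shiftMap a)^[j] x, 0) := by
  have hmono := birkhoff_strictMono hf hx
  have h : ∃ m : ℕ, birkhoff f m (x, r).1 ≤ (x, r).2 + (birkhoff f j x - r) ∧
      (x, r).2 + (birkhoff f j x - r) < birkhoff f (m + 1) (x, r).1 := by
    have h1 : birkhoff f j x < birkhoff f (j + 1) x := hmono (Nat.lt_succ_self j)
    exact ⟨j, by simp, by simpa using h1⟩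
  have hc1 : birkhoff f h.choose x ≤ r + (birkhoff f j x - r) := h.choose_spec.1
  have hc2 : r + (birkhoff f j x - r) < birkhoff f (h.choose + 1) x := h.choose_spec.2
  have hj : h.choose = j := by
    have h1 : h.choose ≤ j := hmono.le_iff_le.1 (hc1.trans_eq (by ring))
    have h2 : j < h.choose + 1 := hmono.lt_iff_lt.1 (lt_of_eq_of_lt (by ring) hc2)
    omega
  rw [susFlow, dif_pos h, hj]
  simp

/-- The points of the suspension surviving up to time `t`. -/
def flowSurv (A : Matrix (Fin a) (Fin a) ℕ) (f : (ℕ → Fin a) → ℝ) (U : Set (ℕ → Fin a))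
    (t : ℝ) : Set ((ℕ → Fin a) × ℝ) :=
  {p | p ∈ susp (SFT A) f ∧ ∀ s ∈ Set.Icc (0 : ℝ) t, susFlow f s p ∉ U ×ˢ ({0} : Set ℝ)}

lemma flowSurv_subset (hf : ∀ x ∈ SFT A, 0 < f x) {F : ℝ} (hF : ∀ x ∈ SFT A, f x ≤ F) (t : ℝ) :
    flowSurv A f U t ⊆ roofSurv A f U t ×ˢ Set.Ico 0 F := by
  rintro ⟨x, r⟩ ⟨⟨hx, hr0, hrf⟩, h⟩
  simp only at hx hr0 hrf
  refine ⟨⟨hx, fun j hj hjt hU => ?_⟩, hr0, hrf.trans_le (hF x hx)⟩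
  have h1 : f x ≤ birkhoff f j x := by
    have h2 : birkhoff f 1 x ≤ birkhoff f j x := (birkhoff_strictMono hf hx).monotone hj
    simpa [birkhoff] using h2
  refine h (birkhoff f j x - r) ⟨by linarith, by linarith⟩ ?_
  rw [susFlow_eq hf hx]
  exact ⟨hU, rfl⟩

lemma subset_flowSurv (hf : ∀ x ∈ SFT A, 1 < f x) (t : ℝ) :
    roofSurv A f U (t + 1) ×ˢ Set.Ioo 0 1 ⊆ flowSurv A f U t := by
  rintro ⟨x, r⟩ ⟨⟨hx, h⟩, hr0, hr1⟩
  simp only at hx hr0 hr1 h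
  refine ⟨⟨hx, hr0.le, hr1.trans (hf x hx)⟩, fun s hs hmem => ?_⟩
  unfold susFlow at hmem
  split_ifs at hmem with hm
  · obtain ⟨h1, h2⟩ := hmem
    simp only [mem_singleton_iff] at h2
    rcases Nat.eq_zero_or_pos hm.choose with h0 | h0
    · rw [h0] at h2
      simp [birkhoff] at h2
      linarith [hs.1]
    · exact h _ h0 (by linarith [hs.2]) h1
  · exact hr0.ne' hmem.2

lemma flowSurv_measure_bounds [IsProbabilityMeasure μ] (hf : ∀ x ∈ SFT A, 1 < f x) {F : ℝ}
    (hF : ∀ x ∈ SFT A, f x ≤ F) (hF0 : 0 ≤ F) (hmean : 0 < ∫ x, f x ∂μ) (t : ℝ) :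
    μ.real (roofSurv A f U (t + 1)) / ∫ x, f x ∂μ ≤
        (suspMeasure μ (SFT A) f (flowSurv A f U t)).toReal ∧
      (suspMeasure μ (SFT A) f (flowSurv A f U t)).toReal ≤
        F * μ.real (roofSurv A f U t) / ∫ x, f x ∂μ := by
  have h1 : (suspMeasure μ (SFT A) f (flowSurv A f U t)).toReal =
      ((μ.prod volume).restrict (susp (SFT A) f) (flowSurv A f U t)).toReal / ∫ x, f x ∂μ := by
    rw [suspMeasure, Measure.smul_apply, smul_eq_mul, ENNReal.toReal_mul, ENNReal.toReal_inv,
      ENNReal.toReal_ofReal hmean.le, div_eq_inv_mul]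
  have hup : (μ.prod volume).restrict (susp (SFT A) f) (flowSurv A f U t) ≤
      μ (roofSurv A f U t) * ENNReal.ofReal F := by
    refine (Measure.restrict_apply_le _ _).trans ?_
    refine (measure_mono (flowSurv_subset (fun x hx => zero_lt_one.trans (hf x hx)) hF t)).trans ?_
    rw [Measure.prod_prod, Real.volume_Ico, sub_zero]
  have hlo : μ (roofSurv A f U (t + 1)) ≤
      (μ.prod volume).restrict (susp (SFT A) f) (flowSurv A f U t) := by
    have e : flowSurv A f U t ∩ susp (SFT A) f = flowSurv A f U t :=
      inter_eq_left.2 fun p hp => hp.1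
    refine le_trans ?_ (Measure.le_restrict_apply _ _)
    rw [e]
    refine le_trans ?_ (measure_mono (subset_flowSurv hf t))
    rw [Measure.prod_prod, Real.volume_Ioo]
    simp
  have hfin : μ (roofSurv A f U t) * ENNReal.ofReal F ≠ ∞ :=
    ENNReal.mul_ne_top (measure_ne_top _ _) ENNReal.ofReal_ne_top
  rw [h1]
  constructor
  · gcongr
    exact ENNReal.toReal_mono (ne_top_of_le_ne_top hfin hup) hlo
  · gcongr
    refine (ENNReal.toReal_mono hfin hup).trans (le_of_eq ?_)
    rw [ENNReal.toReal_mul, ENNReal.toReal_ofReal hF0, mul_comm]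
    rfl

lemma suspMeasure_prod_Icc [IsProbabilityMeasure μ] (hf : ∀ x ∈ SFT A, 1 < f x)
    (hmean : 0 < ∫ x, f x ∂μ) (hU : MeasurableSet U) (hUX : U ⊆ SFT A) :
    (suspMeasure μ (SFT A) f (U ×ˢ Set.Icc (0 : ℝ) 1)).toReal = μ.real U / ∫ x, f x ∂μ := by
  have e : U ×ˢ Set.Icc (0 : ℝ) 1 ∩ susp (SFT A) f = U ×ˢ Set.Icc (0 : ℝ) 1 :=
    inter_eq_left.2 fun p hp => ⟨hUX hp.1, hp.2.1, hp.2.2.trans_lt (hf _ (hUX hp.1))⟩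
  rw [suspMeasure, Measure.smul_apply, smul_eq_mul, ENNReal.toReal_mul, ENNReal.toReal_inv,
    ENNReal.toReal_ofReal hmean.le, Measure.restrict_apply (hU.prod measurableSet_Icc), e,
    Measure.prod_prod, Real.volume_Icc, div_eq_inv_mul]
  simp [measureReal_def]

lemma neg_limsup_log_mem_Icc {M : ℝ → ℝ} {c C α β : ℝ} (hc : 0 < c) (hC : 0 < C)
    (hlow : ∀ᶠ t in atTop, c * Real.exp (-(α * t)) ≤ M t)
    (hupp : ∀ᶠ t in atTop, M t ≤ C * Real.exp (-(β * t))) :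
    β ≤ -limsup (fun t => Real.log (M t) / t) atTop ∧
      -limsup (fun t => Real.log (M t) / t) atTop ≤ α := by
  have hlim : ∀ c α : ℝ, Tendsto (fun t : ℝ => Real.log c / t + -α) atTop (nhds (-α)) := by
    intro c α
    simpa using (tendsto_id.const_div_atTop (Real.log c)).add_const (-α)
  have h1 : ∀ᶠ t in atTop, Real.log c / t + -α ≤ Real.log (M t) / t := by
    filter_upwards [hlow, eventually_gt_atTop 0] with t ht ht0
    have := Real.log_le_log (by positivity) ht
    rw [Real.log_mul hc.ne' (Real.exp_pos _).ne', Real.log_exp] at this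
    rw [le_div_iff₀ ht0, add_mul, div_mul_cancel₀ _ ht0.ne']
    linarith
  have h2 : ∀ᶠ t in atTop, Real.log (M t) / t ≤ Real.log C / t + -β := by
    filter_upwards [hlow, hupp, eventually_gt_atTop 0] with t hl ht ht0
    have hM : 0 < M t := lt_of_lt_of_le (by positivity) hl
    have := Real.log_le_log hM ht
    rw [Real.log_mul hC.ne' (Real.exp_pos _).ne', Real.log_exp] at this
    rw [div_le_iff₀ ht0, add_mul, div_mul_cancel₀ _ ht0.ne']
    linarith
  have hbv := (hlim C β).isBoundedUnder_le
  have hbu : IsBoundedUnder (· ≤ ·) atTop fun t => Real.log (M t) / t := hbv.mono_le h2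
  have hbu' : IsBoundedUnder (· ≥ ·) atTop fun t => Real.log (M t) / t :=
    (hlim c α).isBoundedUnder_ge.mono_ge h1
  have e1 := limsup_le_limsup h2 hbu'.isCoboundedUnder_le hbv
  have e2 := limsup_le_limsup h1 (hlim c α).isBoundedUnder_ge.isCoboundedUnder_le hbu
  rw [(hlim _ _).limsup_eq] at e1 e2
  constructor <;> linarith

/-- Survival in the base together with large deviation bounds gives survival along the flow. -/
lemma roofSurv_bounds [IsProbabilityMeasure μ] (hX : ∀ B : Set (ℕ → Fin a), μ (SFT A ∩ B) = μ B)
    (hf : ∀ x ∈ SFT A, 0 < f x) {m δ c₀ r s c C : ℝ} {n : ℕ} (hn : 1 ≤ n) (hδ : 0 < δ)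
    (hδm : δ < m) (hdev : ∀ k : ℕ,
      μ.real {x | ((k * n : ℕ) : ℝ) * (m + δ) ≤ birkhoff f (k * n) x} ≤ Real.exp (-(c₀ * k)) ∧
      μ.real {x | birkhoff f (k * n) x ≤ ((k * n : ℕ) : ℝ) * (m - δ)} ≤ Real.exp (-(c₀ * k)))
    (hc : 0 < c) (hC : 0 < C) (hr : 0 ≤ r) (hs : 0 ≤ s) (hrn : r * n < c₀) (hsn : s * n ≤ c₀)
    (hsurv : ∀ k : ℕ, c * Real.exp (-(r * k)) ≤ μ.real (surv U k) ∧
      μ.real (surv U k) ≤ C * Real.exp (-(s * k))) :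
    ∃ c' C' : ℝ, 0 < c' ∧ 0 < C' ∧
      (∀ᶠ t in atTop, c' * Real.exp (-(r / (m - δ) * t)) ≤ μ.real (roofSurv A f U (t + 1))) ∧
      (∀ᶠ t in atTop, μ.real (roofSurv A f U t) ≤ C' * Real.exp (-(s / (m + δ) * t))) := by
  have hn0 : (0 : ℝ) < n := by exact_mod_cast hn
  have hm1 : 0 < m - δ := by linarith
  have hm2 : 0 < m + δ := by linarith
  refine ⟨c / 2 * Real.exp (-(r * (1 / (m - δ) + n))), (C + 1) * Real.exp (s * n),
    by positivity, by positivity, ?_, ?_⟩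
  · have htend : Tendsto (fun t : ℝ => ⌈(t + 1) / (n * (m - δ))⌉₊) atTop atTop :=
      tendsto_nat_ceil_atTop.comp
        ((tendsto_atTop_add_const_right _ 1 tendsto_id).atTop_div_const (by positivity))
    have hsmall : ∀ᶠ k : ℕ in atTop, Real.exp (-((c₀ - r * n) * k)) ≤ c / 2 := by
      have h1 : Tendsto (fun k : ℕ => Real.exp (-((c₀ - r * n) * k))) atTop (nhds 0) :=
        Real.tendsto_exp_neg_atTop_nhds_zero.comp
          (tendsto_natCast_atTop_atTop.const_mul_atTop (by linarith))
      exact (h1.eventually (gt_mem_nhds (by positivity : 0 < c / 2))).mono fun _ h => h.le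
    filter_upwards [htend.eventually hsmall, eventually_ge_atTop 0] with t hk ht
    set k := ⌈(t + 1) / (n * (m - δ))⌉₊ with hkdef
    have hk1 : t + 1 ≤ ((k * n : ℕ) : ℝ) * (m - δ) := by
      have := Nat.le_ceil ((t + 1) / (n * (m - δ)))
      rw [div_le_iff₀ (by positivity)] at this
      push_cast; linarith
    have hk2 : ((k * n : ℕ) : ℝ) ≤ t / (m - δ) + (1 / (m - δ) + n) := by
      have := (Nat.ceil_lt_add_one (a := (t + 1) / (n * (m - δ))) (by positivity)).le
      have h2 := mul_le_mul_of_nonneg_right this hn0.le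
      push_cast
      refine h2.trans (le_of_eq ?_)
      field_simp
      ring
    have h1 : μ.real (surv U (k * n)) ≤
        μ.real (roofSurv A f U (t + 1)) + Real.exp (-(c₀ * k)) := by
      rw [measureReal_def, ← hX]
      exact (measureReal_mono (inter_surv_subset_roofSurv hf hk1 _)).trans
        ((measureReal_union_le _ _).trans (add_le_add le_rfl (hdev k).2))
    have h2 : Real.exp (-(c₀ * k)) ≤ c / 2 * Real.exp (-(r * (k * n : ℕ))) := by
      have e : Real.exp (-(c₀ * k)) =
          Real.exp (-((c₀ - r * n) * k)) * Real.exp (-(r * (k * n : ℕ))) := by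
        rw [← Real.exp_add]; congr 1; push_cast; ring
      rw [e]
      gcongr
    have h3 : Real.exp (-(r * (1 / (m - δ) + n))) * Real.exp (-(r / (m - δ) * t)) ≤
        Real.exp (-(r * (k * n : ℕ))) := by
      rw [← Real.exp_add]
      refine Real.exp_le_exp.2 ?_
      have := mul_le_mul_of_nonneg_left hk2 hr
      have e : r * (t / (m - δ) + (1 / (m - δ) + n)) =
        r * (1 / (m - δ) + n) + r / (m - δ) * t := by ring
      linarith
    have h4 := (hsurv (k * n)).1
    have h5 := mul_le_mul_of_nonneg_left h3 (by positivity : 0 ≤ c / 2)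
    linarith
  · filter_upwards [eventually_ge_atTop 0] with t ht
    set k := ⌊t / (n * (m + δ))⌋₊ with hkdef
    have hk1 : ((k * n : ℕ) : ℝ) * (m + δ) ≤ t := by
      have := Nat.floor_le (a := t / (n * (m + δ))) (by positivity)
      rw [le_div_iff₀ (by positivity)] at this
      push_cast; linarith
    have hk2 : t / (m + δ) - n ≤ ((k * n : ℕ) : ℝ) := by
      have := (Nat.lt_floor_add_one (t / (n * (m + δ)))).le
      have h2 := mul_le_mul_of_nonneg_right this hn0.le
      have e : t / (n * (m + δ)) * n = t / (m + δ) := by field_simp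
      rw [e, add_mul, one_mul] at h2
      push_cast
      linarith
    have h1 : μ.real (roofSurv A f U t) ≤ μ.real (surv U (k * n)) + Real.exp (-(c₀ * k)) :=
      (measureReal_mono (roofSurv_subset hf hk1 _)).trans
        ((measureReal_union_le _ _).trans (add_le_add le_rfl (hdev k).1))
    have h2 : Real.exp (-(c₀ * k)) ≤ Real.exp (-(s * (k * n : ℕ))) := by
      refine Real.exp_le_exp.2 (neg_le_neg ?_)
      have := mul_le_mul_of_nonneg_right hsn (Nat.cast_nonneg (α := ℝ) k)
      push_cast; linarith
    have h3 : Real.exp (-(s * (k * n : ℕ))) ≤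
        Real.exp (s * n) * Real.exp (-(s / (m + δ) * t)) := by
      rw [← Real.exp_add]
      refine Real.exp_le_exp.2 ?_
      have := mul_le_mul_of_nonneg_left hk2 hs
      have e : s * (t / (m + δ) - n) = s / (m + δ) * t - s * n := by ring
      linarith
    have h4 := (hsurv (k * n)).2
    have h5 := mul_le_mul_of_nonneg_left h3 (by positivity : 0 ≤ C + 1)
    linarith

end flow

section main
variable {A : Matrix (Fin a) (Fin a) ℕ} {θ K c₁ c₂ : ℝ} {d : ℕ} {φ ψ : (ℕ → Fin a) → ℝ}
  {μ : Measure (ℕ → Fin a)} {I : ℕ → Set (ℕ → Fin a)} {z : ℕ → Fin a} {f : (ℕ → Fin a) → ℝ}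

/-- The normalised escape rate through the target `I n × {0}`. -/
def rateRatio (A : Matrix (Fin a) (Fin a) ℕ) (μ : Measure (ℕ → Fin a)) [SFinite μ]
    (f : (ℕ → Fin a) → ℝ) (I : ℕ → Set (ℕ → Fin a)) (n : ℕ) : ℝ :=
  Rc (suspMeasure μ (SFT A) f) ((I n) ×ˢ ({0} : Set ℝ)) (SFT A) f /
    ((suspMeasure μ (SFT A) f) ((I n) ×ˢ Set.Icc (0 : ℝ) 1)).toReal

lemma IsGibbs.eventually_rateRatio_mem_Icc [IsProbabilityMeasure μ]
    (hG : IsGibbs A θ K d c₁ c₂ ψ μ)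
    (hN : ∀ x ∈ SFT A, transfer A ψ (fun _ => 1) x = 1) (hz : z ∈ SFT A)
    (hI : NestedCondition A μ I z) {p : ℕ} {U' : ℕ → Set (ℕ → Fin a)} {γ : ℝ} (hγ : 0 ≤ γ)
    (hU : ReducedTarget A μ I p U' γ) (hf : ∀ x ∈ SFT A, 1 < f x) {L : ℝ} (hL0 : 0 ≤ L)
    (hL : LipX A θ L f) :
    1 ≤ ∫ x, f x ∂μ ∧ ∀ η, 0 < η → η < ∫ x, f x ∂μ → ∀ᶠ n in atTop,
      (γ - η) * (∫ x, f x ∂μ) / (∫ x, f x ∂μ + η) ≤ rateRatio A μ f I n ∧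
      rateRatio A μ f I n ≤ (γ + η) * (∫ x, f x ∂μ) / (∫ x, f x ∂μ - η) := by
  set g := (SFT A).indicator f with hg
  have hfg : ∀ x ∈ SFT A, f x = g x := fun x hx => (indicator_of_mem hx f).symm
  have hgm : Measurable g := hL.measurable_indicator hG.hθ
  have hg1 : ∀ x ∈ SFT A, 1 < g x := fun x hx => hfg x hx ▸ hf x hx
  have hgL : LipX A θ L g := fun x hx y hy n hxy => by
    rw [← hfg x hx, ← hfg y hy]; exact hL x hx y hy n hxy
  have hgc := cone_of_lipX hgL hL0 hG.hθ.1.le hg1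
  have hF := hgL.bounded hz
  set F := |g z| + L
  have hF0 : 0 ≤ F := by positivity
  have hmean : ∫ x, f x ∂μ = ∫ x, g x ∂μ := integral_congr_ae <| by
    filter_upwards [hG.ae_mem] with x hx using hfg x hx
  have hm1 : 1 ≤ ∫ x, f x ∂μ := hmean ▸ (hG.integral_mem_Icc hgm (t := F) fun x hx =>
    ⟨(hg1 x hx).le, (le_abs_self _).trans (hF x hx)⟩).1
  refine ⟨hm1, fun η hη hηm => ?_⟩
  have hmean0 : 0 < ∫ x, f x ∂μ := by linarith
  obtain ⟨N, c₀, hN1, hc₀, hdev⟩ := hG.exists_deviation_bounds hN hz hgm hgc hF hη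
  have hsmall : Tendsto (fun n => (γ + η) * μ.real (I n) * N) atTop (nhds 0) := by
    simpa using ((tendsto_nested hI).const_mul (γ + η)).mul_const (N : ℝ)
  filter_upwards [hG.eventually_surv_bounds hN hz hI hU hη,
    hsmall.eventually (gt_mem_nhds hc₀), eventually_ge_atTop 1] with n hsurv hrn hn
  obtain ⟨c, C, hc, hC, hs⟩ := hsurv
  have hε := hG.nested_pos hz hI hn
  have hs0 : 0 ≤ max (γ - η) 0 * μ.real (I n) := by positivity
  have hsr : max (γ - η) 0 ≤ γ + η := max_le (by linarith) (by linarith)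
  have hs' : ∀ k : ℕ, c * Real.exp (-((γ + η) * μ.real (I n) * k)) ≤ μ.real (surv (I n) k) ∧
      μ.real (surv (I n) k) ≤ max C 1 * Real.exp (-(max (γ - η) 0 * μ.real (I n) * k)) := by
    refine fun k => ⟨(hs k).1, ?_⟩
    rcases le_total (γ - η) 0 with h | h
    · rw [max_eq_right h]
      simp
    · rw [max_eq_left h]
      exact (hs k).2.trans (by gcongr; exact le_max_left _ _)
  rw [← hmean] at hdev
  obtain ⟨c', C', hc', hC', hlow, hupp⟩ := roofSurv_bounds (U := I n) (hG.measure_inter_SFT)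
    (fun x hx => zero_lt_one.trans (hg1 x hx)) hN1 hη hηm hdev hc (by positivity : 0 < max C 1)
    (by positivity) hs0 hrn
    ((mul_le_mul_of_nonneg_right (mul_le_mul_of_nonneg_right hsr hε.le)
      (Nat.cast_nonneg N)).trans hrn.le) hs'
  have hM := flowSurv_measure_bounds (μ := μ) (U := I n) hf
    (fun x hx => (hfg x hx).le.trans ((le_abs_self _).trans (hF x hx))) hF0 hmean0
  have hlow' : ∀ᶠ t in atTop, c' / (∫ x, f x ∂μ) *
      Real.exp (-((γ + η) * μ.real (I n) / (∫ x, f x ∂μ - η) * t)) ≤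
        (suspMeasure μ (SFT A) f (flowSurv A f (I n) t)).toReal := by
    filter_upwards [hlow] with t ht
    rw [← roofSurv_congr hfg] at ht
    refine le_trans ?_ (hM t).1
    rw [div_mul_eq_mul_div]
    gcongr
  have hupp' : ∀ᶠ t in atTop, (suspMeasure μ (SFT A) f (flowSurv A f (I n) t)).toReal ≤
      (F + 1) * C' / (∫ x, f x ∂μ) *
        Real.exp (-(max (γ - η) 0 * μ.real (I n) / (∫ x, f x ∂μ + η) * t)) := by
    filter_upwards [hupp] with t ht
    rw [← roofSurv_congr hfg] at ht
    refine (hM t).2.trans ?_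
    rw [div_mul_eq_mul_div, mul_assoc]
    gcongr
    linarith
  have hmem := neg_limsup_log_mem_Icc
    (M := fun t => (suspMeasure μ (SFT A) f (flowSurv A f (I n) t)).toReal)
    (by positivity) (by positivity) hlow' hupp'
  have hR : Rc (suspMeasure μ (SFT A) f) ((I n) ×ˢ ({0} : Set ℝ)) (SFT A) f =
      -limsup (fun t => Real.log (suspMeasure μ (SFT A) f (flowSurv A f (I n) t)).toReal / t)
        atTop := rfl
  rw [rateRatio, hR, suspMeasure_prod_Icc hf hmean0 (nested_measurableSet hI hn)
    (nested_subset_SFT hI hn)]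
  have hη' : 0 < ∫ x, f x ∂μ - η := by linarith
  constructor
  · rw [le_div_iff₀ (by positivity)]
    refine le_trans (le_of_eq_of_le ?_ (?_ : (γ - η) * μ.real (I n) / (∫ x, f x ∂μ + η) ≤ _))
      hmem.1
    · field_simp
    · gcongr
      exact le_max_left _ _
  · rw [div_le_iff₀ (by positivity)]
    refine hmem.2.trans (le_of_eq ?_)
    field_simp

lemma IsGibbs.tendsto_rateRatio [IsProbabilityMeasure μ]
    (hG : IsGibbs A θ K d c₁ c₂ ψ μ)
    (hN : ∀ x ∈ SFT A, transfer A ψ (fun _ => 1) x = 1) (hz : z ∈ SFT A)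
    (hI : NestedCondition A μ I z) {p : ℕ} {U' : ℕ → Set (ℕ → Fin a)} {γ : ℝ}
    (hU : ReducedTarget A μ I p U' γ) (hf : ∀ x ∈ SFT A, 1 < f x) {L : ℝ} (hL0 : 0 ≤ L)
    (hL : LipX A θ L f) : Tendsto (rateRatio A μ f I) atTop (nhds γ) := by
  have hγ : 0 ≤ γ := ge_of_tendsto' hU.ratio fun n => by positivity
  obtain ⟨hm, h⟩ := hG.eventually_rateRatio_mem_Icc hN hz hI hγ hU hf hL0 hL
  set m := ∫ x, f x ∂μ
  have hm0 : 0 < m := by linarith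
  have hrange : ∀ᶠ η in nhdsWithin (0 : ℝ) (Ioi 0), 0 < η ∧ η < m :=
    (eventually_mem_nhdsWithin).and (nhdsWithin_le_nhds (gt_mem_nhds hm0))
  have hlo : Tendsto (fun η => (γ - η) * m / (m + η)) (nhds 0) (nhds γ) := by
    have h1 : ContinuousAt (fun η => (γ - η) * m / (m + η)) 0 :=
      ContinuousAt.div (by fun_prop) (by fun_prop) (by simpa using hm0.ne')
    have h2 := h1.tendsto
    simpa [mul_div_cancel_right₀ γ hm0.ne'] using h2
  have hup : Tendsto (fun η => (γ + η) * m / (m - η)) (nhds 0) (nhds γ) := by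
    have h1 : ContinuousAt (fun η => (γ + η) * m / (m - η)) 0 :=
      ContinuousAt.div (by fun_prop) (by fun_prop) (by simpa using hm0.ne')
    have h2 := h1.tendsto
    simpa [mul_div_cancel_right₀ γ hm0.ne'] using h2
  refine tendsto_order.2 ⟨fun γ' hγ' => ?_, fun γ' hγ' => ?_⟩
  · obtain ⟨η, hη, hη0, hηm⟩ :=
      (((hlo.mono_left nhdsWithin_le_nhds).eventually (lt_mem_nhds hγ')).and hrange).exists
    exact (h η hη0 hηm).mono fun n hn => hη.trans_le hn.1
  · obtain ⟨η, hη, hη0, hηm⟩ :=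
      (((hup.mono_left nhdsWithin_le_nhds).eventually (gt_mem_nhds hγ')).and hrange).exists
    exact (h η hη0 hηm).mono fun n hn => hn.2.trans_lt hη

lemma birkhoff_sub_const (P : ℝ) (n : ℕ) {x : ℕ → Fin a} (hx : x ∈ SFT A) :
    birkhoff ((SFT A).indicator fun y => φ y - P) n x = birkhoff φ n x - n * P := by
  rw [birkhoff_congr (g := fun y => φ y - P) (fun y hy => indicator_of_mem hy _) n hx]
  simp [birkhoff, Finset.sum_sub_distrib]

lemma isGibbs_of_bounds [IsProbabilityMeasure μ] (hθ : θ ∈ Set.Ioo (0 : ℝ) 1)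
    (hA01 : ∀ i j, A i j = 0 ∨ A i j = 1) (hd : 0 < d) (hAd : ∀ i j, 0 < (A ^ d) i j)
    (hK : 0 ≤ K) (hφ : LipX A θ K φ) (hsupp : μ (SFT A) = 1)
    (hinv : ∀ B : Set (ℕ → Fin a), MeasurableSet B → μ (shiftMap a ⁻¹' B) = μ B)
    {P : ℝ} (hc₁ : 0 < c₁) (hc₂ : 0 < c₂)
    (hGibbs : ∀ x ∈ SFT A, ∀ n : ℕ, 1 ≤ n →
        c₁ ≤ (μ (SFT A ∩ cyl x n)).toReal / Real.exp (-P * n + birkhoff φ n x) ∧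
        (μ (SFT A ∩ cyl x n)).toReal / Real.exp (-P * n + birkhoff φ n x) ≤ c₂) :
    IsGibbs A θ K d c₁ c₂ ((SFT A).indicator fun y => φ y - P) μ := by
  have hlip : LipX A θ K fun y => φ y - P := fun x hx y hy n h => by
    rw [sub_sub_sub_cancel_right]; exact hφ x hx y hy n h
  have hnull : μ (SFT A)ᶜ = 0 := (prob_compl_eq_zero_iff (measurableSet_SFT A)).2 hsupp
  have hae : ∀ᵐ x ∂μ, x ∈ SFT A := hnull
  have hcyl : ∀ x n, μ (SFT A ∩ cyl x n) = μ (cyl x n) := fun x n => by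
    refine measure_congr ?_
    filter_upwards [hae] with y hy
    exact propext ⟨fun h => h.2, fun h => ⟨hy, h⟩⟩
  have hexp : ∀ x ∈ SFT A, ∀ n : ℕ, Real.exp (-P * n + birkhoff φ n x) =
      Real.exp (birkhoff ((SFT A).indicator fun y => φ y - P) n x) := fun x hx n => by
    rw [birkhoff_sub_const P n hx]; congr 1; ring
  refine ⟨hθ, hA01, hd, hAd, hK, fun x hx y hy n h => ?_, hlip.measurable_indicator hθ, hnull,
    ⟨measurable_shift, Measure.ext fun B hB => ?_⟩, hc₁, hc₂, fun x hx n hn => ?_,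
    fun x hx n hn => ?_⟩
  · rw [indicator_of_mem hx, indicator_of_mem hy]; exact hlip x hx y hy n h
  · rw [Measure.map_apply measurable_shift hB, hinv B hB]
  · have h := (hGibbs x hx n hn).1
    rw [hcyl, hexp x hx, le_div_iff₀ (Real.exp_pos _)] at h
    exact (ENNReal.ofReal_le_iff_le_toReal (measure_ne_top _ _)).2 h
  · have h := (hGibbs x hx n hn).2
    rw [hcyl, hexp x hx, div_le_iff₀ (Real.exp_pos _)] at h
    exact (ENNReal.le_ofReal_iff_toReal_le (measure_ne_top _ _) (by positivity)).2 h

end main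

end EscapeRate

/-- **Main theorem.** Escape rate asymptotics for special semi-flows over
non-invertible subshifts of finite type: for a Gibbs measure `μ` of a Lipschitz potential
`φ` with pressure `P`, a Lipschitz roof function `f > 1`, and a family `{I_n}` satisfying
the nested condition shrinking to `z`, the escape rate of the suspension flow through
`I_n × {0}` normalized by `ν(I_n × [0,1])` converges to `γ(z)`. -/
theorem escape_rate_special_semiflow
    (a : ℕ) (ha : 2 ≤ a) (A : Matrix (Fin a) (Fin a) ℕ)
    (hA01 : ∀ i j, A i j = 0 ∨ A i j = 1)
    (hAper : ∃ d : ℕ, 0 < d ∧ ∀ i j, 0 < (A ^ d) i j)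
    (θ : ℝ) (hθ : θ ∈ Set.Ioo (0 : ℝ) 1)
    (φ : (ℕ → Fin a) → ℝ)
    (hφLip : ∃ L : ℝ, ∀ x ∈ SFT A, ∀ y ∈ SFT A, ∀ n : ℕ,
        (∀ i < n, x i = y i) → |φ x - φ y| ≤ L * θ ^ n)
    (μ : Measure (ℕ → Fin a)) [IsProbabilityMeasure μ]
    (hsupp : μ (SFT A) = 1)
    (hinv : ∀ B : Set (ℕ → Fin a), MeasurableSet B → μ (shiftMap a ⁻¹' B) = μ B)
    (P : ℝ) (hP : 0 ≤ P) (c₁ c₂ : ℝ) (hc₁ : 0 < c₁) (hc₂ : 0 < c₂)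
    (hGibbs : ∀ x ∈ SFT A, ∀ n : ℕ, 1 ≤ n →
        c₁ ≤ (μ (SFT A ∩ cyl x n)).toReal / Real.exp (-P * n + birkhoff φ n x) ∧
        (μ (SFT A ∩ cyl x n)).toReal / Real.exp (-P * n + birkhoff φ n x) ≤ c₂)
    (f : (ℕ → Fin a) → ℝ) (hf1 : ∀ x ∈ SFT A, 1 < f x)
    (hfLip : ∃ L : ℝ, ∀ x ∈ SFT A, ∀ y ∈ SFT A, ∀ n : ℕ,
        (∀ i < n, x i = y i) → |f x - f y| ≤ L * θ ^ n)
    (I : ℕ → Set (ℕ → Fin a)) (z : ℕ → Fin a) (hz : z ∈ SFT A)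
    (hnested : NestedCondition A μ I z) :
    ((∀ p : ℕ, 0 < p → (shiftMap a)^[p] z ≠ z) →
      Tendsto (fun n : ℕ =>
          Rc (suspMeasure μ (SFT A) f) ((I n) ×ˢ ({0} : Set ℝ)) (SFT A) f /
            ((suspMeasure μ (SFT A) f) ((I n) ×ˢ Set.Icc (0 : ℝ) 1)).toReal)
        atTop (nhds 1)) ∧
    (∀ p : ℕ, 0 < p → (shiftMap a)^[p] z = z →
      (∀ q : ℕ, 0 < q → (shiftMap a)^[q] z = z → p ≤ q) →
      Tendsto (fun n : ℕ =>
          Rc (suspMeasure μ (SFT A) f) ((I n) ×ˢ ({0} : Set ℝ)) (SFT A) f /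
            ((suspMeasure μ (SFT A) f) ((I n) ×ˢ Set.Icc (0 : ℝ) 1)).toReal)
        atTop (nhds (1 - Real.exp (birkhoff φ p z - p * P)))) := by
  obtain ⟨d, hd, hAd⟩ := hAper
  obtain ⟨K, hK⟩ := hφLip
  obtain ⟨L, hL⟩ := hfLip
  have hθ0 : ∀ n : ℕ, 0 ≤ θ ^ n := fun n => pow_nonneg hθ.1.le n
  have hK' : EscapeRate.LipX A θ (max K 0) φ := fun x hx y hy n h =>
    (hK x hx y hy n h).trans (mul_le_mul_of_nonneg_right (le_max_left _ _) (hθ0 n))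
  have hL' : EscapeRate.LipX A θ (max L 0) f := fun x hx y hy n h =>
    (hL x hx y hy n h).trans (mul_le_mul_of_nonneg_right (le_max_left _ _) (hθ0 n))
  have hG₀ := EscapeRate.isGibbs_of_bounds hθ hA01 hd hAd (le_max_right K 0) hK' hsupp hinv hc₁ hc₂ hGibbs
  obtain ⟨ψ, K₁, b₁, b₂, hG, hN, hper⟩ := hG₀.exists_normalised hz
  refine ⟨fun hnp => ?_, fun p hp0 hp hmin => ?_⟩
  · exact hG.tendsto_rateRatio hN hz hnested (EscapeRate.reducedTarget_of_not_periodic hG hz hnested hnp)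
      hf1 (le_max_right L 0) hL'
  · have h := hG.tendsto_rateRatio hN hz hnested
      (EscapeRate.reducedTarget_of_periodic hG hN hz hnested hp0 hp hmin) hf1 (le_max_right L 0) hL'
    rw [hper p z hz hp, EscapeRate.birkhoff_sub_const P p hz] at h
    exact h

end
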